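/- The bounded-time verification problem for HCMTL* in the interval-based semantics is decidable: there is an algorithm that, given a timed automaton A, an HCMTL* sentence φ, and a time bound N ∈ ℕ with N > 0, decides whether {}, 0, ε ⊨^N_A φ. -/

import Mathlib

namespace HyTime

/-! ### Comparisons and clock constraints -/

/-- Comparison operators `<, ≤, =, ≥, >` used in clock constraints. -/
inductive Cmp where
  | lt | le | eq | ge | gt
  deriving DecidableEq

def Cmp.denote : Cmp → ℝ → ℝ → Prop
  | .lt => fun a b => a < b
  | .le => fun a b => a ≤ b
  | .eq => fun a b => a = b
  | .ge => fun a b => b ≤ a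
  | .gt => fun a b => b < a

def Cmp.code : Cmp → ℕ
  | .lt => 0
  | .le => 1
  | .eq => 2
  | .ge => 3
  | .gt => 4

/-- Clock constraints over one clock: positive boolean combinations of atoms `x ∼ c`,
where the constants `c` come from `α` (naturals, or rationals). -/
inductive ClkC (α : Type) where
  | atom : Cmp → α → ClkC α
  | disj : ClkC α → ClkC α → ClkC α
  | conj : ClkC α → ClkC α → ClkC α
  deriving DecidableEq

namespace ClkC
variable {α β : Type}

/-- Satisfaction of a clock constraint by a clock value `v : ℝ`;
`toR` interprets the constants as reals. -/
def holds (toR : α → ℝ) (v : ℝ) : ClkC α → Prop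
  | .atom c k => c.denote v (toR k)
  | .disj a b => a.holds toR v ∨ b.holds toR v
  | .conj a b => a.holds toR v ∧ b.holds toR v

/-- A missing constraint (`none`) is the trivial constraint. -/
def holdsOpt (toR : α → ℝ) (v : ℝ) : Option (ClkC α) → Prop
  | none => True
  | some c => c.holds toR v

def map (f : α → β) : ClkC α → ClkC β
  | .atom c k => .atom c (f k)
  | .disj a b => .disj (a.map f) (b.map f)
  | .conj a b => .conj (a.map f) (b.map f)

/-- The list of constants appearing in a clock constraint. -/
def consts : ClkC α → List α
  | .atom _ k => [k]
  | .disj a b => a.consts ++ b.consts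
  | .conj a b => a.consts ++ b.consts

end ClkC

/-- The canonical interpretation of natural-number constants as reals. -/
def natR : ℕ → ℝ := fun n => (n : ℝ)

/-- The canonical interpretation of rational constants as reals. -/
def ratR : ℚ → ℝ := fun q => (q : ℝ)

/-! ### Intervals of reals -/

/-- A bounded real interval, with open/closed information at both endpoints. -/
structure TIvl where
  lo : ℝ
  hi : ℝ
  loC : Bool
  hiC : Bool
  deriving Inhabited

namespace TIvl

/-- Membership of a time point in an interval. -/
def Mem (t : ℝ) (I : TIvl) : Prop :=
  (if I.loC then I.lo ≤ t else I.lo < t) ∧ (if I.hiC then t ≤ I.hi else t < I.hi)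

/-- A well-formed (nonempty) interval: either nondegenerate, or a closed singular interval. -/
def WF (I : TIvl) : Prop :=
  I.lo < I.hi ∨ (I.lo = I.hi ∧ I.loC = true ∧ I.hiC = true)

/-- Two intervals are consecutive: they share the endpoint `R(I) = L(J)`,
which belongs to exactly one of them (hence they are disjoint). -/
def Consecutive (I J : TIvl) : Prop := I.hi = J.lo ∧ I.hiC = !J.loC

end TIvl

/-! ### Timed automata (interval-based) -/

/-- An edge of an interval-based timed automaton:
source, destination, guard (a set of constraints, each over a designated clock), reset set. -/
abbrev IEdge (α : Type) := ℕ × ℕ × List (ℕ × ClkC α) × List ℕ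

/-- A timed automaton `A = (V, V₀, α, X, β, E, V_F)` over atomic propositions `props`.
States, propositions and clocks are natural numbers; all components are finite (lists).
`label` is the state labeling, `beta` assigns to (state, clock) pairs a clock constraint. -/
structure TA (α : Type) where
  states : List ℕ
  init : List ℕ
  props : List ℕ
  clocks : List ℕ
  label : List (ℕ × List ℕ)
  beta : List ((ℕ × ℕ) × ClkC α)
  edges : List (IEdge α)
  final : List ℕ

namespace TA
variable {α β : Type}

def labelOf (A : TA α) (v : ℕ) : List ℕ := (A.label.lookup v).getD []

def betaOf (A : TA α) (v x : ℕ) : Option (ClkC α) :=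
  (A.beta.find? (fun q => q.1.1 == v && q.1.2 == x)).map (·.2)

/-- All constants appearing in the constraints of a timed automaton. -/
def consts (A : TA α) : List α :=
  (A.beta.map (·.2)).flatMap ClkC.consts ++
    A.edges.flatMap (fun e => (e.2.2.1.map (·.2)).flatMap ClkC.consts)

/-- Apply a function to every constant of the automaton. -/
def map (f : α → β) (A : TA α) : TA β where
  states := A.states
  init := A.init
  props := A.props
  clocks := A.clocks
  label := A.label
  beta := A.beta.map (fun q => (q.1, q.2.map f))
  edges := A.edges.map (fun e => (e.1, e.2.1, e.2.2.1.map (fun p => (p.1, p.2.map f)), e.2.2.2))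
  final := A.final

end TA

/-! ### Executions of timed automata -/

/-- The raw data of an execution `(v₁,I₁) →^{γ₁}_{Ψ₁} ⋯ →^{γ_{n-1}}_{Ψ_{n-1}} (vₙ,Iₙ)`. -/
structure RawExec (α : Type) where
  states : List ℕ
  ivls : List TIvl
  guards : List (List (ℕ × ClkC α))
  resets : List (List ℕ)
  deriving Inhabited

namespace RawExec
variable {α : Type}

def n (ρ : RawExec α) : ℕ := ρ.states.length
def ivl (ρ : RawExec α) (i : ℕ) : TIvl := ρ.ivls.getD i default
def state (ρ : RawExec α) (i : ℕ) : ℕ := ρ.states.getD i 0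
def reset (ρ : RawExec α) (i : ℕ) : List ℕ := ρ.resets.getD i []
def guard (ρ : RawExec α) (i : ℕ) : List (ℕ × ClkC α) := ρ.guards.getD i []

/-- The `i`-th edge taken by the execution. -/
def edge (ρ : RawExec α) (i : ℕ) : IEdge α := (ρ.state i, ρ.state (i+1), ρ.guard i, ρ.reset i)

/-- The clock valuation `μ_{i+1}` when entering the `(i+1)`-st state: clocks start at `0`,
advance with elapsed time, and the clocks reset at a transition are set to `0`. -/
def mu (ρ : RawExec α) : ℕ → ℕ → ℝ
  | 0, _ => 0
  | i+1, x => if x ∈ ρ.reset i then 0 else ρ.mu i x + ((ρ.ivl i).hi - (ρ.ivl i).lo)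

/-- `t ∈ len(ρ)`. -/
def MemLen (t : ℝ) (ρ : RawExec α) : Prop := ∃ i, i < ρ.n ∧ TIvl.Mem t (ρ.ivl i)

/-- `ρ(t) = v`: at time `t` the execution is at state `v`. -/
def StateAt (ρ : RawExec α) (t : ℝ) (v : ℕ) : Prop :=
  ∃ i, i < ρ.n ∧ TIvl.Mem t (ρ.ivl i) ∧ ρ.state i = v

/-- `ρ` is an execution of `A`: consistent lengths, an interval sequence starting at `0`,
an initial state, edges of `A`, state constraints throughout each interval, and
guard constraints at the transition times. -/
def IsExec (toR : α → ℝ) (A : TA α) (ρ : RawExec α) : Prop :=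
  0 < ρ.n ∧ ρ.ivls.length = ρ.n ∧ ρ.guards.length = ρ.n - 1 ∧ ρ.resets.length = ρ.n - 1 ∧
  (ρ.ivl 0).lo = 0 ∧ (ρ.ivl 0).loC = true ∧
  (∀ i, i < ρ.n → (ρ.ivl i).WF) ∧
  (∀ i, i + 1 < ρ.n → (ρ.ivl i).Consecutive (ρ.ivl (i+1))) ∧
  ρ.state 0 ∈ A.init ∧
  (∀ i, i + 1 < ρ.n → ρ.edge i ∈ A.edges) ∧
  (∀ i, i < ρ.n → ∀ x ∈ A.clocks, ∀ t : ℝ, TIvl.Mem t (ρ.ivl i) →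
    ClkC.holdsOpt toR (ρ.mu i x + t - (ρ.ivl i).lo) (A.betaOf (ρ.state i) x)) ∧
  (∀ i, i + 1 < ρ.n → ∀ q ∈ ρ.guard i,
    ClkC.holds toR (ρ.mu i q.1 + (ρ.ivl i).hi - (ρ.ivl i).lo) q.2)

/-- An accepting execution: ends in a final state. -/
def IsAccExec (toR : α → ℝ) (A : TA α) (ρ : RawExec α) : Prop :=
  ρ.IsExec toR A ∧ ρ.state (ρ.n - 1) ∈ A.final

/-- The execution is bounded by `N`: no time point `≥ N` belongs to it. -/
def BoundedBy (ρ : RawExec α) (N : ℝ) : Prop := ∀ t : ℝ, N ≤ t → ¬ MemLen t ρ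

/-- Membership in `Exec(A)` (if `bd = none`) resp. `Exec_N(A)` (if `bd = some N`). -/
def InSem (toR : α → ℝ) (A : TA α) (bd : Option ℝ) (ρ : RawExec α) : Prop :=
  ρ.IsAccExec toR A ∧ ∀ N, bd = some N → ρ.BoundedBy N

/-- Index of the interval containing `t`. -/
noncomputable def idxAt (ρ : RawExec α) (t : ℝ) : ℕ :=
  ρ.ivls.findIdx (fun I => @decide (TIvl.Mem t I) (Classical.propDecidable _))

/-- The prefix `ρ|_t` of an execution up to time `t`:
the last interval is intersected with `[0, t]`. -/
noncomputable def prefixUpTo (ρ : RawExec α) (t : ℝ) : RawExec α :=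
  let i := ρ.idxAt t
  ⟨ρ.states.take (i + 1),
   ρ.ivls.take i ++ [⟨(ρ.ivl i).lo, t, (ρ.ivl i).loC, true⟩],
   ρ.guards.take i, ρ.resets.take i⟩

/-- Two executions are equal up to time `t` if their prefixes up to `t` are identical. -/
def EqUpTo (ρ₁ ρ₂ : RawExec α) (t : ℝ) : Prop := ρ₁.prefixUpTo t = ρ₂.prefixUpTo t

end RawExec

/-! ### HCMTL* syntax -/

/-- An interval annotating a temporal operator: endpoints from `α`, with `hi = none`
denoting `∞`. -/
structure FIvl (α : Type) where
  lo : α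
  hi : Option α
  loC : Bool
  hiC : Bool

namespace FIvl
variable {α β : Type}

/-- `t ∈ base + I`. -/
def Mem (toR : α → ℝ) (base t : ℝ) (I : FIvl α) : Prop :=
  (if I.loC then base + toR I.lo ≤ t else base + toR I.lo < t) ∧
  (∀ h, I.hi = some h → (if I.hiC then t ≤ base + toR h else t < base + toR h))

/-- A singular interval `[c, c]`. -/
def Singular (I : FIvl α) : Prop := I.loC = true ∧ I.hiC = true ∧ I.hi = some I.lo

def map (f : α → β) (I : FIvl α) : FIvl β := ⟨f I.lo, I.hi.map f, I.loC, I.hiC⟩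

def consts (I : FIvl α) : List α := I.lo :: I.hi.toList

end FIvl

/-- HCMTL* formulas in negation normal form:
`φ ::= p_π | ¬p_π | φ ∨ φ | φ ∧ φ | F_I φ | G_I φ | φ U_I φ | ∃π φ | ∀π φ`.
Propositions and path variables are natural numbers; interval endpoints come from `α`. -/
inductive HF (α : Type) where
  | pos : ℕ → ℕ → HF α
  | neg : ℕ → ℕ → HF α
  | disj : HF α → HF α → HF α
  | conj : HF α → HF α → HF α
  | fut : FIvl α → HF α → HF α
  | glob : FIvl α → HF α → HF α
  | untl : FIvl α → HF α → HF α → HF α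
  | ex : ℕ → HF α → HF α
  | all : ℕ → HF α → HF α

namespace HF
variable {α β : Type}

/-- Free path variables. -/
def free : HF α → Finset ℕ
  | .pos _ π => {π}
  | .neg _ π => {π}
  | .disj a b => a.free ∪ b.free
  | .conj a b => a.free ∪ b.free
  | .fut _ a => a.free
  | .glob _ a => a.free
  | .untl _ a b => a.free ∪ b.free
  | .ex π a => a.free.erase π
  | .all π a => a.free.erase π

/-- A sentence has no free path variables. -/
def Sentence (φ : HF α) : Prop := φ.free = ∅

/-- Quantifier-free formulas. -/
def QFree : HF α → Prop
  | .pos _ _ => True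
  | .neg _ _ => True
  | .disj a b => a.QFree ∧ b.QFree
  | .conj a b => a.QFree ∧ b.QFree
  | .fut _ a => a.QFree
  | .glob _ a => a.QFree
  | .untl _ a b => a.QFree ∧ b.QFree
  | .ex _ _ => False
  | .all _ _ => False

/-- All intervals occurring in the formula are non-singular. -/
def NonSing : HF α → Prop
  | .pos _ _ => True
  | .neg _ _ => True
  | .disj a b => a.NonSing ∧ b.NonSing
  | .conj a b => a.NonSing ∧ b.NonSing
  | .fut I a => ¬ I.Singular ∧ a.NonSing
  | .glob I a => ¬ I.Singular ∧ a.NonSing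
  | .untl I a b => ¬ I.Singular ∧ a.NonSing ∧ b.NonSing
  | .ex _ a => a.NonSing
  | .all _ a => a.NonSing

/-- The HyperMITL fragment: all quantifiers at the top level, all intervals non-singular. -/
def HyperMITL : HF α → Prop
  | .ex _ a => a.HyperMITL
  | .all _ a => a.HyperMITL
  | φ => φ.QFree ∧ φ.NonSing

/-- Apply a function to every interval endpoint of the formula. -/
def map (f : α → β) : HF α → HF β
  | .pos p π => .pos p π
  | .neg p π => .neg p π
  | .disj a b => .disj (a.map f) (b.map f)
  | .conj a b => .conj (a.map f) (b.map f)
  | .fut I a => .fut (I.map f) (a.map f)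
  | .glob I a => .glob (I.map f) (a.map f)
  | .untl I a b => .untl (I.map f) (a.map f) (b.map f)
  | .ex π a => .ex π (a.map f)
  | .all π a => .all π (a.map f)

/-- The list of interval endpoints appearing in the formula. -/
def consts : HF α → List α
  | .pos _ _ => []
  | .neg _ _ => []
  | .disj a b => a.consts ++ b.consts
  | .conj a b => a.consts ++ b.consts
  | .fut I a => I.consts ++ a.consts
  | .glob I a => I.consts ++ a.consts
  | .untl I a b => I.consts ++ a.consts ++ b.consts
  | .ex _ a => a.consts
  | .all _ a => a.consts

end HF

/-! ### HCMTL* interval-based semantics -/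

/-- Time bound restriction: with `bd = some N`, only times `< N` are considered. -/
def inBd : Option ℝ → ℝ → Prop
  | none, _ => True
  | some N, t => t < N

/-- The interval-based satisfaction relation `Π, t, † ⊨_A φ` (with `bd = none`),
resp. its time-bounded variant `Π, t, † ⊨^N_A φ` (with `bd = some N`).
`d = none` represents `† = ε`, and `d = some π` represents `† = π`. -/
def HSat {α : Type} (toR : α → ℝ) (A : TA α) (bd : Option ℝ) :
    HF α → (ℕ → RawExec α) → ℝ → Option ℕ → Prop
  | .pos p π, Env, t, _ =>
      RawExec.MemLen t (Env π) ∧ ∃ v, RawExec.StateAt (Env π) t v ∧ p ∈ A.labelOf v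
  | .neg p π, Env, t, _ =>
      RawExec.MemLen t (Env π) ∧ ∃ v, RawExec.StateAt (Env π) t v ∧ p ∉ A.labelOf v
  | .disj a b, Env, t, d => HSat toR A bd a Env t d ∨ HSat toR A bd b Env t d
  | .conj a b, Env, t, d => HSat toR A bd a Env t d ∧ HSat toR A bd b Env t d
  | .fut I a, Env, t, d => ∃ t', t < t' ∧ inBd bd t' ∧ FIvl.Mem toR t t' I ∧
      HSat toR A bd a Env t' d
  | .glob I a, Env, t, d => ∀ t', t < t' → inBd bd t' → FIvl.Mem toR t t' I →
      HSat toR A bd a Env t' d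
  | .untl I a b, Env, t, d => ∃ t', t < t' ∧ inBd bd t' ∧ FIvl.Mem toR t t' I ∧
      HSat toR A bd b Env t' d ∧ ∀ t'', t < t'' → t'' < t' → HSat toR A bd a Env t'' d
  | .ex π a, Env, t, d => ∃ ρ, RawExec.InSem toR A bd ρ ∧
      ((d = none ∧ t = 0) ∨
        ∃ d₀, d = some d₀ ∧ RawExec.MemLen t (Env d₀) ∧ RawExec.EqUpTo ρ (Env d₀) t) ∧
      HSat toR A bd a (Function.update Env π ρ) t (some π)
  | .all π a, Env, t, d => ∀ ρ, RawExec.InSem toR A bd ρ →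
      ((d = none ∧ t = 0) ∨
        ∃ d₀, d = some d₀ ∧ RawExec.MemLen t (Env d₀) ∧ RawExec.EqUpTo ρ (Env d₀) t) →
      HSat toR A bd a (Function.update Env π ρ) t (some π)

/-! ### MSO(<, +1) -/

/-- MSO(<,+1) formulas over monadic predicate names `σ` and first-order variables `ℕ`:
`φ ::= x < y | +1(x,y) | P(x) | φ ∨ φ | ¬φ | ∃x φ | ∃P φ`. -/
inductive MSO (σ : Type) where
  | lt : ℕ → ℕ → MSO σ
  | succ : ℕ → ℕ → MSO σ
  | app : σ → ℕ → MSO σ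
  | disj : MSO σ → MSO σ → MSO σ
  | neg : MSO σ → MSO σ
  | exFO : ℕ → MSO σ → MSO σ
  | exSO : σ → MSO σ → MSO σ

/-- Continuity of a flow at `t` (within the time domain `D`). -/
def ContAt {σ : Type} (D : Set ℝ) (f : ℝ → Set σ) (t : ℝ) : Prop :=
  ∃ ε : ℝ, 0 < ε ∧ ∀ s ∈ D, |s - t| < ε → f s = f t

/-- A flow is finitely variable: on every bounded interval it has only finitely many
discontinuities. -/
def FinVar {σ : Type} (D : Set ℝ) (f : ℝ → Set σ) : Prop :=
  ∀ a b : ℝ, Set.Finite {t | t ∈ D ∩ Set.Icc a b ∧ ¬ ContAt D f t}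

namespace MSO
variable {σ : Type}

/-- Satisfaction `f, I ⊨ φ` of an MSO(<,+1) formula over the time domain `D`,
by a flow `f` and a first-order interpretation `ivar`. Second-order quantification
ranges over finitely variable flows agreeing with `f` except at the quantified predicate. -/
def Sat (D : Set ℝ) : MSO σ → (ℝ → Set σ) → (ℕ → ℝ) → Prop
  | .lt x y, _, ivar => ivar x < ivar y
  | .succ x y, _, ivar => ivar y = ivar x + 1
  | .app P x, f, ivar => P ∈ f (ivar x)
  | .disj a b, f, ivar => Sat D a f ivar ∨ Sat D b f ivar
  | .neg a, f, ivar => ¬ Sat D a f ivar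
  | .exFO x a, f, ivar => ∃ r ∈ D, Sat D a f (Function.update ivar x r)
  | .exSO P a, f, ivar => ∃ g : ℝ → Set σ, FinVar D g ∧
      (∀ t ∈ D, ∀ Q, Q ≠ P → (Q ∈ g t ↔ Q ∈ f t)) ∧ Sat D a g ivar

/-- Free first-order variables. -/
def freeFO : MSO σ → Finset ℕ
  | .lt x y => {x, y}
  | .succ x y => {x, y}
  | .app _ x => {x}
  | .disj a b => a.freeFO ∪ b.freeFO
  | .neg a => a.freeFO
  | .exFO x a => a.freeFO.erase x
  | .exSO _ a => a.freeFO

/-- Free monadic (second-order) predicates. -/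
def freeSO [DecidableEq σ] : MSO σ → Finset σ
  | .lt _ _ => ∅
  | .succ _ _ => ∅
  | .app P _ => {P}
  | .disj a b => a.freeSO ∪ b.freeSO
  | .neg a => a.freeSO
  | .exFO _ a => a.freeSO
  | .exSO P a => a.freeSO.erase P

/-- Purely first-order formulas: no monadic predicates occur at all. -/
def FOonly : MSO σ → Prop
  | .lt _ _ => True
  | .succ _ _ => True
  | .app _ _ => False
  | .disj a b => a.FOonly ∧ b.FOonly
  | .neg a => a.FOonly
  | .exFO _ a => a.FOonly
  | .exSO _ _ => False

end MSO

/-! ### The monadic predicates `MP = V ∪ T ∪ R` and the encoding ι of executions as flows -/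

/-- The monadic predicates associated to a timed automaton: states `v`, transition markers
`T⁻_e`, `T⁺_e` for edges `e`, and reset markers `R⁰_x`, `R¹_x` for clocks `x`. -/
inductive MPred (α : Type) where
  | st : ℕ → MPred α
  | tminus : IEdge α → MPred α
  | tplus : IEdge α → MPred α
  | r0 : ℕ → MPred α
  | r1 : ℕ → MPred α
  deriving DecidableEq

/-- The encoding `ι_A` of an execution as a flow over `MP = V ∪ T ∪ R`:
at each time, the current state; at a `T⁻` transition time `t = L(I_{i+1}) ∈ I_{i+1}`,
the marker `T⁻_e` and resets `R⁰_x` (for the clocks `x` reset by `e`);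
at a `T⁺` transition time `t = R(I_i) ∈ I_i`, the marker `T⁺_e` and resets `R¹_x`;
and `∅` after the execution has ended. -/
def iota {α : Type} (ρ : RawExec α) (t : ℝ) : Set (MPred α) :=
  {mp | match mp with
    | .st v => RawExec.StateAt ρ t v
    | .tminus e => ∃ i, i + 1 < ρ.n ∧ ρ.edge i = e ∧
        t = (ρ.ivl (i+1)).lo ∧ TIvl.Mem t (ρ.ivl (i+1))
    | .tplus e => ∃ i, i + 1 < ρ.n ∧ ρ.edge i = e ∧
        t = (ρ.ivl i).hi ∧ TIvl.Mem t (ρ.ivl i)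
    | .r0 x => ∃ i, i + 1 < ρ.n ∧ x ∈ ρ.reset i ∧
        t = (ρ.ivl (i+1)).lo ∧ TIvl.Mem t (ρ.ivl (i+1))
    | .r1 x => ∃ i, i + 1 < ρ.n ∧ x ∈ ρ.reset i ∧
        t = (ρ.ivl i).hi ∧ TIvl.Mem t (ρ.ivl i)}

/-- The combined flow `f_Π` of a path environment `Π` on path variables `1, …, m`,
over the pairwise disjoint indexed copies `MP_1 ∪ ⋯ ∪ MP_m` (tagged by the index). -/
def fPi (m : ℕ) (Env : ℕ → RawExec ℕ) : ℝ → Set (ℕ × MPred ℕ) :=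
  fun t => {q | 1 ≤ q.1 ∧ q.1 ≤ m ∧ q.2 ∈ iota (Env q.1) t}

end HyTime

namespace HyTime

/-! ### Timed automata in the point-based semantics -/

/-- A transition of a point-based timed automaton: source state, event (a set of
propositions), guard, reset set, destination state. -/
abbrev PEdge (α : Type) := ℕ × List ℕ × List (ℕ × ClkC α) × List ℕ × ℕ

def PEdge.src {α : Type} (e : PEdge α) : ℕ := e.1
def PEdge.event {α : Type} (e : PEdge α) : List ℕ := e.2.1
def PEdge.guard {α : Type} (e : PEdge α) : List (ℕ × ClkC α) := e.2.2.1
def PEdge.rst {α : Type} (e : PEdge α) : List ℕ := e.2.2.2.1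
def PEdge.dst {α : Type} (e : PEdge α) : ℕ := e.2.2.2.2

/-- A timed automaton in the point-based semantics `B = (𝒫(P), S, s₀, X, Δ, F)`. -/
structure PTA (α : Type) where
  states : List ℕ
  start : ℕ
  props : List ℕ
  clocks : List ℕ
  trans : List (PEdge α)
  final : List ℕ

/-- The raw data of a run `(s₀,μ₀) →^{e₁,t₁} ⋯ →^{eₙ,tₙ} (sₙ,μₙ)`:
the transitions taken and their times. -/
structure PRun (α : Type) where
  edges : List (PEdge α)
  times : List ℝ
  deriving Inhabited

namespace PRun
variable {α : Type}

def n (η : PRun α) : ℕ := η.edges.length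
def edge (η : PRun α) (i : ℕ) : PEdge α := η.edges.getD i default
def time (η : PRun α) (i : ℕ) : ℝ := η.times.getD i 0
def tprev (η : PRun α) (i : ℕ) : ℝ := if i = 0 then 0 else η.time (i - 1)

/-- The clock valuation `μ_i` after `i` transitions. -/
def mu (η : PRun α) : ℕ → ℕ → ℝ
  | 0, _ => 0
  | i+1, x => if x ∈ PEdge.rst (η.edge i) then 0 else η.mu i x + (η.time i - η.tprev i)

/-- `η` is a run of `B`: nonempty, increasing nonnegative transition times,
starting at the start state, consecutive transitions of `Δ`, guards holding at
transition times. -/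
def IsRun (toR : α → ℝ) (B : PTA α) (η : PRun α) : Prop :=
  0 < η.n ∧ η.times.length = η.n ∧
  0 ≤ η.time 0 ∧ (∀ i, i + 1 < η.n → η.time i < η.time (i+1)) ∧
  PEdge.src (η.edge 0) = B.start ∧
  (∀ i, i < η.n → η.edge i ∈ B.trans) ∧
  (∀ i, i + 1 < η.n → PEdge.src (η.edge (i+1)) = PEdge.dst (η.edge i)) ∧
  (∀ i, i < η.n → ∀ q ∈ PEdge.guard (η.edge i),
    ClkC.holds toR (η.mu i q.1 + (η.time i - η.tprev i)) q.2)

/-- An accepting run: ends in a final state. -/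
def IsAccRun (toR : α → ℝ) (B : PTA α) (η : PRun α) : Prop :=
  η.IsRun toR B ∧ PEdge.dst (η.edge (η.n - 1)) ∈ B.final

/-- The duration `len(η) = tₙ` of a run. -/
def len (η : PRun α) : ℝ := η.time (η.n - 1)

/-- All transition times are `< N`. -/
def BoundedBy (η : PRun α) (N : ℝ) : Prop := ∀ i, i < η.n → η.time i < N

/-- Membership in `Runs(B)` (if `bd = none`) resp. its bounded variant. -/
def InSem (toR : α → ℝ) (B : PTA α) (bd : Option ℝ) (η : PRun α) : Prop :=
  η.IsAccRun toR B ∧ ∀ N, bd = some N → η.BoundedBy N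

/-- `t ∈ η`: `t` is one of the transition (event) times of `η`. -/
def EvtTime (η : PRun α) (t : ℝ) : Prop := ∃ i, i < η.n ∧ η.time i = t

/-- `η'` is an extension of `η` from time `t`: they agree on all transitions at
times `≤ t`, and all later transitions (of either run) occur after `t`. -/
def ExtendsFrom (η' η : PRun α) (t : ℝ) : Prop :=
  ∃ i, i ≤ η.n ∧ i ≤ η'.n ∧
    η'.edges.take i = η.edges.take i ∧ η'.times.take i = η.times.take i ∧
    (∀ j, j < i → η.time j ≤ t) ∧
    (∀ j, i ≤ j → j < η.n → t < η.time j) ∧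
    (∀ j, i ≤ j → j < η'.n → t < η'.time j)

end PRun

/-! ### HCMTL* point-based semantics -/

/-- The point-based satisfaction relation `Γ, t, † ⊨_B φ` (with `bd = none`),
resp. its time-bounded variant (with `bd = some N`). `V` is the current set of
path variables (the domain of the environment `Γ`); temporal operators range only
over event points of the runs in `Γ`. -/
def PSat {α : Type} (toR : α → ℝ) (B : PTA α) (bd : Option ℝ) :
    HF α → Finset ℕ → (ℕ → PRun α) → ℝ → Option ℕ → Prop
  | .pos p π, _, Γ, t, _ =>
      ∃ i, i < (Γ π).n ∧ (Γ π).time i = t ∧ p ∈ PEdge.event ((Γ π).edge i)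
  | .neg p π, _, Γ, t, _ =>
      ∃ i, i < (Γ π).n ∧ (Γ π).time i = t ∧ p ∉ PEdge.event ((Γ π).edge i)
  | .disj a b, V, Γ, t, d => PSat toR B bd a V Γ t d ∨ PSat toR B bd b V Γ t d
  | .conj a b, V, Γ, t, d => PSat toR B bd a V Γ t d ∧ PSat toR B bd b V Γ t d
  | .fut I a, V, Γ, t, d => ∃ t', t < t' ∧ inBd bd t' ∧ FIvl.Mem toR t t' I ∧
      (∃ π ∈ V, PRun.EvtTime (Γ π) t') ∧ PSat toR B bd a V Γ t' d
  | .glob I a, V, Γ, t, d => ∀ t', t < t' → inBd bd t' → FIvl.Mem toR t t' I →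
      (∃ π ∈ V, PRun.EvtTime (Γ π) t') → PSat toR B bd a V Γ t' d
  | .untl I a b, V, Γ, t, d => ∃ t', t < t' ∧ inBd bd t' ∧ FIvl.Mem toR t t' I ∧
      (∃ π ∈ V, PRun.EvtTime (Γ π) t') ∧ PSat toR B bd b V Γ t' d ∧
      (∀ t'', t < t'' → t'' < t' → (∃ π ∈ V, PRun.EvtTime (Γ π) t'') →
        PSat toR B bd a V Γ t'' d)
  | .ex π a, V, Γ, t, d => ∃ η, PRun.InSem toR B bd η ∧
      ((d = none ∧ t = 0) ∨
        ∃ d₀, d = some d₀ ∧ t ≤ PRun.len (Γ d₀) ∧ PRun.ExtendsFrom η (Γ d₀) t) ∧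
      PSat toR B bd a (insert π V) (Function.update Γ π η) t (some π)
  | .all π a, V, Γ, t, d => ∀ η, PRun.InSem toR B bd η →
      ((d = none ∧ t = 0) ∨
        ∃ d₀, d = some d₀ ∧ t ≤ PRun.len (Γ d₀) ∧ PRun.ExtendsFrom η (Γ d₀) t) →
      PSat toR B bd a (insert π V) (Function.update Γ π η) t (some π)

/-! ### Concrete injective encodings of syntax into ℕ -/

def encList {α : Type} (f : α → ℕ) : List α → ℕ
  | [] => 0
  | a :: l => Nat.pair (f a) (encList f l) + 1

def encClkC : ClkC ℕ → ℕ
  | .atom c k => Nat.pair 0 (Nat.pair c.code k)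
  | .disj a b => Nat.pair 1 (Nat.pair (encClkC a) (encClkC b))
  | .conj a b => Nat.pair 2 (Nat.pair (encClkC a) (encClkC b))

def encGuard (g : List (ℕ × ClkC ℕ)) : ℕ := encList (fun q => Nat.pair q.1 (encClkC q.2)) g

def encIEdge (e : IEdge ℕ) : ℕ :=
  Nat.pair e.1 (Nat.pair e.2.1 (Nat.pair (encGuard e.2.2.1) (encList id e.2.2.2)))

/-- Injective encoding of timed automata as natural numbers. -/
def encTA (A : TA ℕ) : ℕ :=
  Nat.pair (encList id A.states) <| Nat.pair (encList id A.init) <|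
  Nat.pair (encList id A.props) <| Nat.pair (encList id A.clocks) <|
  Nat.pair (encList (fun q => Nat.pair q.1 (encList id q.2)) A.label) <|
  Nat.pair (encList (fun q => Nat.pair (Nat.pair q.1.1 q.1.2) (encClkC q.2)) A.beta) <|
  Nat.pair (encList encIEdge A.edges) (encList id A.final)

def encFIvl (I : FIvl ℕ) : ℕ :=
  Nat.pair I.lo <| Nat.pair (match I.hi with | none => 0 | some h => h + 1) <|
  Nat.pair I.loC.toNat I.hiC.toNat

/-- Injective encoding of HCMTL* formulas as natural numbers. -/
def encHF : HF ℕ → ℕ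
  | .pos p π => Nat.pair 0 (Nat.pair p π)
  | .neg p π => Nat.pair 1 (Nat.pair p π)
  | .disj a b => Nat.pair 2 (Nat.pair (encHF a) (encHF b))
  | .conj a b => Nat.pair 3 (Nat.pair (encHF a) (encHF b))
  | .fut I a => Nat.pair 4 (Nat.pair (encFIvl I) (encHF a))
  | .glob I a => Nat.pair 5 (Nat.pair (encFIvl I) (encHF a))
  | .untl I a b => Nat.pair 6 (Nat.pair (encFIvl I) (Nat.pair (encHF a) (encHF b)))
  | .ex π a => Nat.pair 7 (Nat.pair π (encHF a))
  | .all π a => Nat.pair 8 (Nat.pair π (encHF a))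

def encPEdge (e : PEdge ℕ) : ℕ :=
  Nat.pair (PEdge.src e) <| Nat.pair (encList id (PEdge.event e)) <|
  Nat.pair (encGuard (PEdge.guard e)) <| Nat.pair (encList id (PEdge.rst e)) (PEdge.dst e)

/-- Injective encoding of point-based timed automata as natural numbers. -/
def encPTA (B : PTA ℕ) : ℕ :=
  Nat.pair (encList id B.states) <| Nat.pair B.start <| Nat.pair (encList id B.props) <|
  Nat.pair (encList id B.clocks) <| Nat.pair (encList encPEdge B.trans) (encList id B.final)

/-- Injective encoding of MSO(<,+1) formulas as natural numbers. -/
def encMSO : MSO ℕ → ℕ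
  | .lt x y => Nat.pair 0 (Nat.pair x y)
  | .succ x y => Nat.pair 1 (Nat.pair x y)
  | .app P x => Nat.pair 2 (Nat.pair P x)
  | .disj a b => Nat.pair 3 (Nat.pair (encMSO a) (encMSO b))
  | .neg a => Nat.pair 4 (encMSO a)
  | .exFO x a => Nat.pair 5 (Nat.pair x (encMSO a))
  | .exSO P a => Nat.pair 6 (Nat.pair P (encMSO a))

/-! ### The interval-based automaton ⟦B⟧ associated to a point-based automaton B -/

/-- Code of an original state of `B` as a state of `⟦B⟧`. -/
def stCode (s : ℕ) : ℕ := 2 * s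
/-- Code of a transition of `B` as a (transition-)state of `⟦B⟧`. -/
def edCode (e : PEdge ℕ) : ℕ := 2 * encPEdge e + 1
/-- The fresh proposition `#` marking transition-states. -/
def hashProp : ℕ := 0
/-- Code of an original proposition of `B` as a proposition of `⟦B⟧`. -/
def propCode (p : ℕ) : ℕ := 2 * p + 1
/-- Code of a state of `B` as a proposition of `⟦B⟧` (over `P ∪ S ∪ {#}`). -/
def stPropCode (s : ℕ) : ℕ := 2 * s + 2
/-- Code of an original clock of `B` as a clock of `⟦B⟧`. -/
def clkCode (x : ℕ) : ℕ := x + 1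
/-- The fresh clock `x_sing` forcing transition-states to be singular. -/
def xsing : ℕ := 0

/-- The interval-based timed automaton `⟦B⟧` over `P ∪ S ∪ {#}`: its states are the
states of `B` together with the transitions of `B`; transition-states are labeled by
their event together with `#`, carry the guard constraints and the constraint
`x_sing = 0`; edges alternate between states and transition-states, resetting `x_sing`
on entry to a transition-state and the transition's resets on exit. -/
def ibOf (B : PTA ℕ) : TA ℕ where
  states := B.states.map stCode ++ B.trans.map edCode
  init := stCode B.start :: (B.trans.filter (fun e => PEdge.src e == B.start)).map edCode
  props := hashProp :: (B.props.map propCode ++ B.states.map stPropCode)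
  clocks := xsing :: B.clocks.map clkCode
  label := B.states.map (fun s => (stCode s, [stPropCode s])) ++
    B.trans.map (fun e => (edCode e, hashProp :: (PEdge.event e).map propCode))
  beta := B.trans.map (fun e => ((edCode e, xsing), ClkC.atom Cmp.eq 0)) ++
    B.trans.flatMap (fun e => B.clocks.filterMap (fun x =>
      match (PEdge.guard e).filter (fun q => q.1 == x) with
      | [] => none
      | q :: rest =>
          some ((edCode e, clkCode x), rest.foldl (fun acc r => ClkC.conj acc r.2) q.2)))
  edges := B.trans.flatMap (fun e =>
    [(stCode (PEdge.src e), edCode e, [], [xsing]),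
     (edCode e, stCode (PEdge.dst e), [], (PEdge.rst e).map clkCode)])
  final := (B.trans.filter (fun e => B.final.contains (PEdge.dst e))).map edCode

/-- The map `χ` sending a run `(s₀,μ₀) →^{e₁,t₁} ⋯ →^{eₙ,tₙ} (sₙ,μₙ)` of `B` to the
execution `(s₀,[0,t₁)), (e₁,[t₁,t₁]), (s₁,(t₁,t₂)), …, (eₙ,[tₙ,tₙ])` of `⟦B⟧`
(starting at `(e₁,[0,0])` if `t₁ = 0`). -/
noncomputable def chi (η : PRun ℕ) : RawExec ℕ :=
  let n := η.n
  let sts := η.edges.flatMap (fun e => [stCode (PEdge.src e), edCode e])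
  let ivls := (List.range n).flatMap (fun i =>
    [⟨η.tprev i, η.time i, decide (i = 0), false⟩, ⟨η.time i, η.time i, true, true⟩])
  let gds : List (List (ℕ × ClkC ℕ)) := List.replicate (2 * n - 1) []
  let rsts := ((List.range n).flatMap
    (fun i => [[xsing], (PEdge.rst (η.edge i)).map clkCode])).take (2 * n - 1)
  if η.time 0 = 0 then ⟨sts.tail, ivls.tail, gds.tail, rsts.tail⟩
  else ⟨sts, ivls, gds, rsts⟩

end HyTime

namespace HyTime

/-! ### Ehrenfeucht–Fraïssé types of piecewise constant signals -/

/-- `X` is piecewise constant on the open interval `(a, b)`. -/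
def PC {D : Type} (X : ℝ → D) (a b : ℝ) : Prop :=
  ∃ F : Finset ℝ, ∀ t u, a < t → t ≤ u → u < b → (∀ v ∈ F, ¬ (t ≤ v ∧ v ≤ u)) → X t = X u

namespace PC
variable {D E : Type} {X : ℝ → D} {Y : ℝ → E} {a b c : ℝ}

theorem mono (h : PC X a c) {a' c' : ℝ} (ha : a ≤ a') (hc : c' ≤ c) : PC X a' c' := by
  obtain ⟨F, hF⟩ := h
  exact ⟨F, fun t u h1 h2 h3 h4 => hF t u (by linarith) h2 (by linarith) h4⟩

theorem congr (h : PC X a b) {X' : ℝ → D} (he : ∀ t, a < t → t < b → X' t = X t) :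
    PC X' a b := by
  obtain ⟨F, hF⟩ := h
  refine ⟨F, fun t u h1 h2 h3 h4 => ?_⟩
  rw [he t h1 (by linarith), he u (by linarith) h3, hF t u h1 h2 h3 h4]

theorem comp (h : PC X a b) (g : D → E) : PC (fun t => g (X t)) a b := by
  obtain ⟨F, hF⟩ := h
  exact ⟨F, fun t u h1 h2 h3 h4 => congrArg g (hF t u h1 h2 h3 h4)⟩

theorem pi {ι : Type} [Fintype ι] {E : ι → Type} {X : ∀ i, ℝ → E i}
    (h : ∀ i, PC (X i) a b) : PC (fun t i => X i t) a b := by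
  classical
  choose F hF using h
  refine ⟨Finset.univ.biUnion F, fun t u h1 h2 h3 h4 => funext fun i => ?_⟩
  exact hF i t u h1 h2 h3 fun v hv =>
    h4 v (Finset.mem_biUnion.2 ⟨i, Finset.mem_univ _, hv⟩)

theorem glue (h : PC X a b) (h' : PC X b c) : PC X a c := by
  obtain ⟨F, hF⟩ := h
  obtain ⟨F', hF'⟩ := h'
  refine ⟨insert b (F ∪ F'), fun t u h1 h2 h3 h4 => ?_⟩
  have hb := h4 b (Finset.mem_insert_self _ _)
  rcases lt_or_ge b t with h | h
  · exact hF' t u h h2 h3 fun v hv => h4 v (by simp [hv])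
  · exact hF t u h1 h2 (by by_contra! h'; exact hb ⟨h, h'⟩) fun v hv => h4 v (by simp [hv])

theorem affine (h : PC X a b) {k m a' b' : ℝ} (hk : 0 < k) (ha : k * a' + m = a)
    (hb : k * b' + m = b) : PC (fun t => X (k * t + m)) a' b' := by
  classical
  obtain ⟨F, hF⟩ := h
  refine ⟨F.image fun v => (v - m) / k, fun t u h1 h2 h3 h4 => ?_⟩
  have e1 := mul_lt_mul_of_pos_left h1 hk
  have e2 := mul_le_mul_of_nonneg_left h2 hk.le
  have e3 := mul_lt_mul_of_pos_left h3 hk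
  refine hF _ _ (by linarith) (by linarith) (by linarith) fun v hv hh => ?_
  refine h4 _ (Finset.mem_image_of_mem _ hv) ⟨?_, ?_⟩
  · rw [le_div_iff₀ hk]; linarith
  · rw [div_le_iff₀ hk]; linarith

theorem of_const (h : ∀ t u, a < t → t < b → a < u → u < b → X t = X u) : PC X a b :=
  ⟨∅, fun t u h1 h2 h3 _ => h t u h1 (by linarith) (by linarith) h3⟩

end PC

/-- The colours and the ordered pairs of colours occurring in `(a, b)`. -/
def info {C : Type} (f : ℝ → C) (a b : ℝ) : Set C × Set (C × C) :=
  ({c | ∃ t, a < t ∧ t < b ∧ f t = c},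
    {p | ∃ t u, a < t ∧ t < u ∧ u < b ∧ f t = p.1 ∧ f u = p.2})

def infoMul {C : Type} (s : Set C × Set (C × C)) (c : C) (s' : Set C × Set (C × C)) :
    Set C × Set (C × C) :=
  ({x | x ∈ s.1 ∨ x = c ∨ x ∈ s'.1},
    {p | p ∈ s.2 ∨ p ∈ s'.2 ∨ (p.1 ∈ s.1 ∧ p.2 = c) ∨ (p.1 = c ∧ p.2 ∈ s'.1) ∨
      (p.1 ∈ s.1 ∧ p.2 ∈ s'.1)})

theorem info_split {C : Type} (f : ℝ → C) {a b c : ℝ} (hab : a < b) (hbc : b < c) :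
    info f a c = infoMul (info f a b) (f b) (info f b c) := by
  refine Prod.ext (Set.ext fun x => ?_) (Set.ext fun ⟨x, y⟩ => ?_)
  · constructor
    · rintro ⟨t, h1, h2, rfl⟩
      rcases lt_trichotomy t b with h | rfl | h
      · exact Or.inl ⟨t, h1, h, rfl⟩
      · exact Or.inr (Or.inl rfl)
      · exact Or.inr (Or.inr ⟨t, h, h2, rfl⟩)
    · rintro (⟨t, h1, h2, rfl⟩ | rfl | ⟨t, h1, h2, rfl⟩)
      · exact ⟨t, h1, by linarith, rfl⟩
      · exact ⟨b, hab, hbc, rfl⟩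
      · exact ⟨t, by linarith, h2, rfl⟩
  · constructor
    · rintro ⟨t, u, h1, h2, h3, rfl, rfl⟩
      rcases lt_trichotomy t b with h | rfl | h
      · rcases lt_trichotomy u b with h' | rfl | h'
        · exact Or.inl ⟨t, u, h1, h2, h', rfl, rfl⟩
        · exact Or.inr (Or.inr (Or.inl ⟨⟨t, h1, h, rfl⟩, rfl⟩))
        · exact Or.inr (Or.inr (Or.inr (Or.inr ⟨⟨t, h1, h, rfl⟩, ⟨u, h', h3, rfl⟩⟩)))
      · exact Or.inr (Or.inr (Or.inr (Or.inl ⟨rfl, ⟨u, h2, h3, rfl⟩⟩)))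
      · exact Or.inr (Or.inl ⟨t, u, h, h2, h3, rfl, rfl⟩)
    · rintro (⟨t, u, h1, h2, h3, h4, h5⟩ | ⟨t, u, h1, h2, h3, h4, h5⟩ | ⟨⟨t, h1, h2, h4⟩, h5⟩ |
        ⟨h4, ⟨u, h2, h3, h5⟩⟩ | ⟨⟨t, h1, h2, h4⟩, ⟨u, h3, h6, h5⟩⟩)
      · exact ⟨t, u, h1, h2, by linarith, h4, h5⟩
      · exact ⟨t, u, by linarith, h2, h3, h4, h5⟩
      · exact ⟨t, b, h1, h2, hbc, h4, h5.symm⟩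
      · exact ⟨b, u, hab, h2, h3, h4.symm, h5⟩
      · exact ⟨t, u, h1, by linarith, h6, h4, h5⟩

/-- Types of quantifier rank `r` of `C`-coloured intervals, where each round adds a
`D`-coloured signal. -/
def Ty (D : Type) : ℕ → Type → Type
  | 0, C => Set C × Set (C × C)
  | r + 1, C => (Set C × Set (C × C)) × Set (Ty D r (C × D))

def ty {D : Type} : (r : ℕ) → {C : Type} → (ℝ → C) → ℝ → ℝ → Ty D r C
  | 0, _, f, a, b => info f a b
  | r + 1, _, f, a, b =>
    (info f a b, {τ | ∃ X : ℝ → D, PC X a b ∧ τ = ty r (fun t => (f t, X t)) a b})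

def tyMul {D : Type} : (r : ℕ) → {C : Type} → Ty D r C → C → Ty D r C → Ty D r C
  | 0, _, s, c, s' => infoMul s c s'
  | r + 1, _, s, c, s' =>
    (infoMul s.1 c s'.1, {τ | ∃ τ₁ ∈ s.2, ∃ d, ∃ τ₂ ∈ s'.2, τ = tyMul r τ₁ (c, d) τ₂})

section
variable {D : Type}

theorem info_congr {C : Type} {f g : ℝ → C} {a b : ℝ} (h : ∀ t, a < t → t < b → f t = g t) :
    info f a b = info g a b := by
  refine Prod.ext (Set.ext fun x => ?_) (Set.ext fun ⟨x, y⟩ => ?_)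
  · exact exists_congr fun t => and_congr_right fun h1 => and_congr_right fun h2 => by rw [h t h1 h2]
  · refine exists_congr fun t => exists_congr fun u => and_congr_right fun h1 =>
      and_congr_right fun h2 => and_congr_right fun h3 => ?_
    rw [h t h1 (by linarith), h u (by linarith) h3]

theorem ty_congr (r : ℕ) {C : Type} {f g : ℝ → C} {a b : ℝ}
    (h : ∀ t, a < t → t < b → f t = g t) : (ty r f a b : Ty D r C) = ty r g a b := by
  induction r generalizing C with
  | zero => exact info_congr h
  | succ r ih =>
    refine Prod.ext (info_congr h) (Set.ext fun τ => exists_congr fun X => ?_)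
    refine and_congr_right fun _ => ?_
    rw [ih fun t h1 h2 => by rw [h t h1 h2]]

theorem ty_split (r : ℕ) {C : Type} (f : ℝ → C) {a b c : ℝ} (hab : a < b) (hbc : b < c) :
    (ty r f a c : Ty D r C) = tyMul r (ty r f a b) (f b) (ty r f b c) := by
  induction r generalizing C with
  | zero => exact info_split f hab hbc
  | succ r ih =>
    refine Prod.ext (info_split f hab hbc) (Set.ext fun τ => ?_)
    constructor
    · rintro ⟨X, hX, rfl⟩
      exact ⟨_, ⟨X, hX.mono le_rfl hbc.le, rfl⟩, X b, _, ⟨X, hX.mono hab.le le_rfl, rfl⟩, ih _⟩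
    · rintro ⟨_, ⟨X, hX, rfl⟩, d, _, ⟨Y, hY, rfl⟩, rfl⟩
      have e1 : ∀ t, a < t → t < b → (if t < b then X t else if t = b then d else Y t) = X t :=
        fun t _ h => if_pos h
      have e2 : ∀ t, b < t → t < c → (if t < b then X t else if t = b then d else Y t) = Y t :=
        fun t h _ => by rw [if_neg (by linarith), if_neg (by linarith)]
      refine ⟨fun t => if t < b then X t else if t = b then d else Y t,
        (hX.congr e1).glue (hY.congr e2), ?_⟩
      rw [ih]
      congr 1
      · exact ty_congr r fun t h1 h2 => by simp only [e1 t h1 h2]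
      · simp
      · exact ty_congr r fun t h1 h2 => by simp only [e2 t h1 h2]

theorem info_affine {C : Type} (f : ℝ → C) {k m a b : ℝ} (hk : 0 < k) :
    info (fun t => f (k * t + m)) a b = info f (k * a + m) (k * b + m) := by
  have key : ∀ t, k * ((t - m) / k) + m = t := fun t => by field_simp; ring
  have l1 : ∀ s t, s < t → k * s + m < k * t + m := fun s t h => by
    have := mul_lt_mul_of_pos_left h hk; linarith
  have l2 : ∀ s t, k * s + m < k * t + m → s < t := fun s t h =>
    lt_of_mul_lt_mul_left (by linarith) hk.le
  refine Prod.ext (Set.ext fun x => ?_) (Set.ext fun ⟨x, y⟩ => ?_)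
  · constructor
    · rintro ⟨t, h1, h2, h3⟩
      exact ⟨_, l1 _ _ h1, l1 _ _ h2, h3⟩
    · rintro ⟨t, h1, h2, h3⟩
      exact ⟨(t - m) / k, l2 _ _ (by rwa [key]), l2 _ _ (by rwa [key]), by simpa only [key]⟩
  · constructor
    · rintro ⟨t, u, h1, h2, h3, h4, h5⟩
      exact ⟨_, _, l1 _ _ h1, l1 _ _ h2, l1 _ _ h3, h4, h5⟩
    · rintro ⟨t, u, h1, h2, h3, h4, h5⟩
      exact ⟨(t - m) / k, (u - m) / k, l2 _ _ (by rwa [key]), l2 _ _ (by rwa [key, key]),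
        l2 _ _ (by rwa [key]), by simpa only [key], by simpa only [key]⟩

theorem ty_affine (r : ℕ) {C : Type} (f : ℝ → C) {k m a b : ℝ} (hk : 0 < k) :
    (ty r (fun t => f (k * t + m)) a b : Ty D r C) = ty r f (k * a + m) (k * b + m) := by
  induction r generalizing C with
  | zero => exact info_affine f hk
  | succ r ih =>
    refine Prod.ext (info_affine f hk) (Set.ext fun τ => ?_)
    have key : ∀ t, k⁻¹ * (k * t + m) + -(m / k) = t := fun t => by field_simp; ring
    constructor
    · rintro ⟨X, hX, rfl⟩
      refine ⟨fun t => X (k⁻¹ * t + -(m / k)), hX.affine (inv_pos.2 hk) (key a) (key b), ?_⟩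
      rw [← ih (fun t => (f t, X (k⁻¹ * t + -(m / k))))]
      simp only [key]
    · rintro ⟨X, hX, rfl⟩
      exact ⟨fun t => X (k * t + m), hX.affine hk rfl rfl, (ih (fun t => (f t, X t))).symm⟩

theorem ty_const (r : ℕ) {C : Type} {f : ℝ → C} {c : C} {a b : ℝ} (hab : a < b)
    (h : ∀ t, a < t → t < b → f t = c) : (ty r f a b : Ty D r C) = ty r (fun _ => c) 0 1 := by
  rw [ty_congr r h]
  have := ty_affine (D := D) r (fun _ : ℝ => c) (k := b - a) (m := a) (a := 0) (b := 1) (by linarith)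
  simpa using this.symm

/-- Types of signals over a constant background `c` with at most `n` discontinuities. -/
def chainTy (D : Type) (r : ℕ) {C : Type} (c : C) : ℕ → Set (Ty D r (C × D))
  | 0 => {τ | ∃ d, τ = ty r (fun _ => (c, d)) 0 1}
  | n + 1 => {τ | ∃ σ ∈ chainTy D r c n, ∃ d e, τ = tyMul r σ (c, d) (ty r (fun _ => (c, e)) 0 1)}

theorem ty_mem_chainTy (r : ℕ) {C : Type} {f : ℝ → C} {c : C} {X : ℝ → D} {a b : ℝ} (hab : a < b)
    (hf : ∀ t, a < t → t < b → f t = c) (hX : PC X a b) :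
    ∃ n, ty r (fun t => (f t, X t)) a b ∈ chainTy D r c n := by
  obtain ⟨F, hF⟩ := hX
  induction hn : F.card using Nat.strong_induction_on generalizing F b with
  | _ n ih =>
    have hmid : a < (a + b) / 2 ∧ (a + b) / 2 < b := ⟨by linarith, by linarith⟩
    by_cases hne : (F.filter fun v => a < v ∧ v < b).Nonempty
    · set v := (F.filter fun v => a < v ∧ v < b).max' hne with hv
      have hvm := (F.filter fun v => a < v ∧ v < b).max'_mem hne
      rw [← hv, Finset.mem_filter] at hvm
      obtain ⟨hvF, hav, hvb⟩ := hvm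
      have hmax : ∀ w ∈ F, v < w → ¬ w < b := fun w hw h1 h2 => by
        have := (F.filter fun v => a < v ∧ v < b).le_max' w
          (Finset.mem_filter.2 ⟨hw, by linarith, h2⟩)
        rw [← hv] at this
        linarith
      have hc : ∀ t, v < t → t < b → X t = X ((v + b) / 2) := by
        have : ∀ t u, v < t → t ≤ u → u < b → X t = X u := fun t u h1 h2 h3 =>
          hF t u (by linarith) h2 h3 fun w hw hh =>
            hmax w hw (by linarith [hh.1]) (by linarith [hh.2])
        intro t h1 h2
        rcases le_total t ((v + b) / 2) with h | h
        · exact this _ _ h1 h (by linarith)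
        · exact (this _ _ (by linarith) h h2).symm
      obtain ⟨m, hm⟩ := ih (F.erase v).card
        (by rw [← hn]; exact Finset.card_erase_lt_of_mem hvF) hav
        (fun t h1 h2 => hf t h1 (by linarith)) (F.erase v)
        (fun t u h1 h2 h3 h4 => hF t u h1 h2 (by linarith) fun w hw hh => by
          rcases eq_or_ne w v with rfl | hne
          · linarith [hh.2]
          · exact h4 w (Finset.mem_erase.2 ⟨hne, hw⟩) hh) rfl
      refine ⟨m + 1, _, hm, X v, X ((v + b) / 2), ?_⟩
      rw [ty_split r _ hav hvb, hf v hav hvb]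
      congr 1
      exact ty_const r hvb fun t h1 h2 => by rw [hf t (by linarith) h2, hc t h1 h2]
    · refine ⟨0, X ((a + b) / 2), ty_const r hab fun t h1 h2 => ?_⟩
      have : ∀ t u, a < t → t ≤ u → u < b → X t = X u := fun t u h1 h2 h3 =>
        hF t u h1 h2 h3 fun w hw hh => hne ⟨w, Finset.mem_filter.2
          ⟨hw, by linarith [hh.1], by linarith [hh.2]⟩⟩
      rw [hf t h1 h2]
      rcases le_total t ((a + b) / 2) with h | h
      · rw [this _ _ h1 h hmid.2]
      · rw [this _ _ hmid.1 h h2]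

theorem chainTy_succ_subset (r : ℕ) {C : Type} (c : C) (n : ℕ) :
    chainTy D r c n ⊆ chainTy D r c (n + 1) := by
  induction n with
  | zero =>
    rintro _ ⟨d, rfl⟩
    refine ⟨_, ⟨d, rfl⟩, d, d, ?_⟩
    conv_lhs => rw [ty_split r (fun _ => (c, d)) (b := 1 / 2) (by norm_num) (by norm_num)]
    rw [ty_const r (c := (c, d)) (a := 0) (b := 1 / 2) (by norm_num) fun _ _ _ => rfl,
      ty_const r (c := (c, d)) (a := 1 / 2) (b := 1) (by norm_num) fun _ _ _ => rfl]
  | succ n ih =>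
    rintro _ ⟨σ, hσ, d, e, rfl⟩
    exact ⟨σ, ih hσ, d, e, rfl⟩

theorem chainTy_subset (r : ℕ) {C : Type} (c : C) [Finite (Ty D r (C × D))] [Nonempty D] {B : ℕ}
    (hB : Nat.card (Ty D r (C × D)) ≤ B) (n : ℕ) : chainTy D r c n ⊆ chainTy D r c B := by
  have mono : Monotone (chainTy D r c) := monotone_nat_of_le_succ (chainTy_succ_subset r c)
  have stab : ∃ m ≤ B, chainTy D r c (m + 1) ⊆ chainTy D r c m := by
    by_contra! h
    have : ∀ m, m ≤ B + 1 → m + 1 ≤ (chainTy D r c m).ncard := by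
      intro m
      induction m with
      | zero =>
        intro _
        obtain ⟨d⟩ := ‹Nonempty D›
        exact (Set.ncard_pos (Set.toFinite _)).2 ⟨_, d, rfl⟩
      | succ m ih =>
        intro hm
        have := Set.ncard_lt_ncard (s := chainTy D r c m) (t := chainTy D r c (m + 1))
          ⟨chainTy_succ_subset r c m, h m (by omega)⟩ (Set.toFinite _)
        have := ih (by omega)
        omega
    have h1 := this (B + 1) le_rfl
    have h2 := Set.ncard_le_card (chainTy D r c (B + 1))
    omega
  obtain ⟨m, hm, hs⟩ := stab
  have : ∀ j, chainTy D r c (m + j) ⊆ chainTy D r c m := by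
    intro j
    induction j with
    | zero => exact subset_rfl
    | succ j ih =>
      rintro _ ⟨σ, hσ, d, e, rfl⟩
      exact hs ⟨σ, ih hσ, d, e, rfl⟩
  rcases le_total n m with h | h
  · exact (mono h).trans (mono hm)
  · have := this (n - m)
    rw [Nat.add_sub_cancel' h] at this
    exact this.trans (mono hm)

theorem chainTy_realize (r : ℕ) {C : Type} (c : C) (n : ℕ) {τ : Ty D r (C × D)}
    (hτ : τ ∈ chainTy D r c n) {x : ℕ → ℝ} (hx : StrictMono x) :
    ∃ X : ℝ → D, (∀ i ≤ n, ∀ t u, x i < t → t < x (i + 1) → x i < u → u < x (i + 1) → X t = X u) ∧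
      ty r (fun t => (c, X t)) (x 0) (x (n + 1)) = τ := by
  induction n generalizing τ with
  | zero =>
    obtain ⟨d, rfl⟩ := hτ
    exact ⟨fun _ => d, fun _ _ _ _ _ _ _ _ => rfl,
      ty_const r (hx (by norm_num)) fun _ _ _ => rfl⟩
  | succ n ih =>
    obtain ⟨σ, hσ, d, e, rfl⟩ := hτ
    obtain ⟨X, hX, hX'⟩ := ih hσ
    refine ⟨fun t => if t < x (n + 1) then X t else if t = x (n + 1) then d else e, ?_, ?_⟩
    · intro i hi t u h1 h2 h3 h4
      rcases Nat.lt_or_ge n i with h | h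
      · obtain rfl : i = n + 1 := by omega
        simp [not_lt.2 h1.le, not_lt.2 h3.le, h1.ne', h3.ne']
      · have : x (i + 1) ≤ x (n + 1) := hx.monotone (by omega)
        simp [h2.trans_le this, h4.trans_le this, hX i h t u h1 h2 h3 h4]
    · rw [ty_split r _ (hx (show 0 < n + 1 by omega)) (hx (show n + 1 < n + 1 + 1 by omega))]
      congr 1
      · rw [← hX']
        exact ty_congr r fun t h1 h2 => by simp [h2]
      · simp
      · exact ty_const r (hx (by omega)) fun t h1 h2 => by simp [not_lt.2 h1.le, h1.ne']

/-- `f` is constant on every open segment of the grid `1 / G` of the unit interval. -/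
def aligned {C : Type} (G : ℕ) (f : ℝ → C) : Prop :=
  ∀ i < G, ∀ t u : ℝ, (i : ℝ) / G < t → t < (i + 1 : ℝ) / G → (i : ℝ) / G < u →
    u < (i + 1 : ℝ) / G → f t = f u

theorem aligned.mul {C : Type} {G : ℕ} {f : ℝ → C} (h : aligned G f) {B : ℕ} (hB : 0 < B)
    (hG : 0 < G) : aligned (G * B) f := by
  intro i hi t u h1 h2 h3 h4
  have hB' : (0 : ℝ) < B := by exact_mod_cast hB
  have hG' : (0 : ℝ) < G := by exact_mod_cast hG
  have hd : i / B < G := Nat.div_lt_of_lt_mul (by rwa [mul_comm])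
  have e1 : ((i / B : ℕ) : ℝ) / G ≤ (i : ℝ) / (G * B : ℕ) := by
    have : ((i / B : ℕ) : ℝ) * B ≤ i := by exact_mod_cast Nat.div_mul_le_self i B
    push_cast
    rw [div_le_div_iff₀ hG' (by positivity)]
    nlinarith
  have e2 : (i + 1 : ℝ) / (G * B : ℕ) ≤ (((i / B : ℕ) : ℝ) + 1) / G := by
    have : (i + 1 : ℝ) ≤ (((i / B : ℕ) : ℝ) + 1) * B := by
      exact_mod_cast Nat.lt_div_mul_add hB |>.trans_eq (by ring)
    push_cast
    rw [div_le_div_iff₀ (by positivity) hG']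
    nlinarith
  exact h (i / B) hd t u (by linarith) (by linarith) (by linarith) (by linarith)

theorem aligned.pc {C : Type} {G : ℕ} {f : ℝ → C} (h : aligned G f) (hG : 0 < G) : PC f 0 1 := by
  have hG' : (0 : ℝ) < G := by exact_mod_cast hG
  have : ∀ i ≤ G, PC f 0 ((i : ℝ) / G) := by
    intro i
    induction i with
    | zero => exact fun _ => PC.of_const fun t u h1 h2 => by simp at h2; linarith
    | succ i ih =>
      intro hi
      refine (ih (by omega)).glue (PC.of_const fun t u h1 h2 h3 h4 => ?_)
      push_cast at h2 h4
      exact h i (by omega) t u h1 h2 h3 h4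
  simpa [hG'.ne'] using this G le_rfl

theorem descend (r : ℕ) {C : Type} [Nonempty D] [Finite (Ty D r (C × D))] {G B : ℕ} (hG : 0 < G)
    {f : ℝ → C} (hf : aligned G f) {X : ℝ → D} (hX : PC X 0 1)
    (hB : Nat.card (Ty D r (C × D)) < B) :
    ∃ Y : ℝ → D, aligned (G * B) Y ∧ Y 0 = X 0 ∧
      (ty r (fun t => (f t, X t)) 0 1 : Ty D r (C × D)) = ty r (fun t => (f t, Y t)) 0 1 := by
  have hG' : (0 : ℝ) < G := by exact_mod_cast hG
  have hB0 : 0 < B := by omega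
  have hB' : (0 : ℝ) < B := by exact_mod_cast hB0
  have seg : ∀ i : ℕ, ∃ Z : ℝ → D, i < G → (∀ j < B, ∀ t u : ℝ,
      ((i * B + j : ℕ) : ℝ) / (G * B : ℕ) < t → t < ((i * B + j : ℕ) + 1 : ℝ) / (G * B : ℕ) →
      ((i * B + j : ℕ) : ℝ) / (G * B : ℕ) < u → u < ((i * B + j : ℕ) + 1 : ℝ) / (G * B : ℕ) →
      Z t = Z u) ∧
      (ty r (fun t => (f t, X t)) (i / G) ((i + 1 : ℝ) / G) : Ty D r (C × D)) =
        ty r (fun t => (f t, Z t)) (i / G) ((i + 1 : ℝ) / G) := by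
    intro i
    by_cases hi : i < G
    swap
    · exact ⟨X, fun h => absurd h hi⟩
    have hlt : (i : ℝ) / G < (i + 1 : ℝ) / G := by gcongr; linarith
    have hle : (i + 1 : ℝ) / G ≤ 1 := by rw [div_le_one hG']; exact_mod_cast hi
    have hconst : ∀ t, (i : ℝ) / G < t → t < (i + 1 : ℝ) / G →
        f t = f (((i : ℝ) / G + (i + 1 : ℝ) / G) / 2) := fun t h1 h2 =>
      hf i hi _ _ h1 h2 (by linarith) (by linarith)
    obtain ⟨n, hn⟩ := ty_mem_chainTy r hlt hconst (hX.mono (by positivity) hle)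
    have hn' := chainTy_subset r _ (show Nat.card (Ty D r (C × D)) ≤ B - 1 by omega) n hn
    have hx : StrictMono fun j : ℕ => ((i * B + j : ℕ) : ℝ) / (G * B : ℕ) := by
      intro j j' hj
      have : (j : ℝ) < j' := by exact_mod_cast hj
      simp only
      push_cast
      gcongr
    obtain ⟨Z, hZ, hZ'⟩ := chainTy_realize r _ (B - 1) hn' hx
    refine ⟨Z, fun _ => ⟨fun j hj t u h1 h2 h3 h4 => hZ j (by omega) t u h1 ?_ h3 ?_, ?_⟩⟩
    · push_cast at h2 ⊢; rwa [← add_assoc]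
    · push_cast at h4 ⊢; rwa [← add_assoc]
    · rw [← hZ', Nat.sub_add_cancel hB0]
      have e1 : ((i * B + 0 : ℕ) : ℝ) / (G * B : ℕ) = (i : ℝ) / G := by
        push_cast; field_simp; ring
      have e2 : ((i * B + B : ℕ) : ℝ) / (G * B : ℕ) = (i + 1 : ℝ) / G := by
        push_cast; field_simp
      rw [e1, e2]
      exact ty_congr r fun t h1 h2 => by rw [hconst t h1 h2]
  choose Z hZ using seg
  let Y : ℝ → D := fun t => if t * G = ⌊t * G⌋₊ then X t else Z ⌊t * G⌋₊ t
  have hYseg : ∀ i : ℕ, ∀ t : ℝ, (i : ℝ) / G < t → t < (i + 1 : ℝ) / G → Y t = Z i t := by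
    intro i t h1 h2
    rw [div_lt_iff₀ hG'] at h1
    rw [lt_div_iff₀ hG'] at h2
    have : ⌊t * G⌋₊ = i := (Nat.floor_eq_iff (by linarith [(Nat.cast_nonneg i : (0 : ℝ) ≤ i)])).2 ⟨h1.le, h2⟩
    simp only [Y, this]
    rw [if_neg h1.ne']
  have hYpt : ∀ i : ℕ, Y ((i : ℝ) / G) = X ((i : ℝ) / G) := by
    intro i
    have : (i : ℝ) / G * G = i := by field_simp
    simp [Y, this]
  refine ⟨Y, ?_, by simpa using hYpt 0, ?_⟩
  · intro q hq t u h1 h2 h3 h4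
    have hd : q / B < G := Nat.div_lt_of_lt_mul (by rwa [mul_comm])
    have hqe : q / B * B + q % B = q := Nat.div_add_mod' q B
    have hm : q % B < B := Nat.mod_lt _ hB0
    have e1 : ((q / B : ℕ) : ℝ) / G ≤ (q : ℝ) / (G * B : ℕ) := by
      have : ((q / B : ℕ) : ℝ) * B ≤ q := by exact_mod_cast Nat.div_mul_le_self q B
      push_cast
      rw [div_le_div_iff₀ hG' (by positivity)]
      nlinarith
    have e2 : (q + 1 : ℝ) / (G * B : ℕ) ≤ (((q / B : ℕ) : ℝ) + 1) / G := by
      have : (q + 1 : ℝ) ≤ (((q / B : ℕ) : ℝ) + 1) * B := by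
        exact_mod_cast Nat.lt_div_mul_add hB0 |>.trans_eq (by ring)
      push_cast
      rw [div_le_div_iff₀ (by positivity) hG']
      nlinarith
    rw [hYseg _ t (by linarith) (by linarith), hYseg _ u (by linarith) (by linarith)]
    have := (hZ (q / B) hd).1 (q % B) hm t u
    rw [hqe] at this
    exact this h1 h2 h3 h4
  · have segeq : ∀ i < G, (ty r (fun t => (f t, X t)) (i / G) ((i + 1 : ℝ) / G) : Ty D r (C × D)) =
        ty r (fun t => (f t, Y t)) (i / G) ((i + 1 : ℝ) / G) := fun i hi => by
      rw [(hZ i hi).2]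
      exact ty_congr r fun t h1 h2 => by rw [hYseg i t h1 h2]
    have : ∀ i : ℕ, i + 1 ≤ G → (ty r (fun t => (f t, X t)) 0 ((i + 1 : ℝ) / G) : Ty D r (C × D)) =
        ty r (fun t => (f t, Y t)) 0 ((i + 1 : ℝ) / G) := by
      intro i
      induction i with
      | zero => intro h; simpa using segeq 0 (by omega)
      | succ i ih =>
        intro h
        have hs := segeq (i + 1) (by omega)
        have hp := hYpt (i + 1)
        push_cast at hs hp ⊢
        have l1 : (0 : ℝ) < (i + 1 : ℝ) / G := by positivity
        have l2 : (i + 1 : ℝ) / G < (i + 1 + 1 : ℝ) / G := by gcongr; linarith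
        rw [ty_split r _ l1 l2, ty_split r (fun t => (f t, Y t)) l1 l2, ih (by omega), hs, hp]
    have h1 := this (G - 1) (by omega)
    rw [Nat.cast_sub (by omega)] at h1
    simpa [hG'.ne'] using h1

end

/-! ### Counting types -/

def tower (Q : ℕ) : ℕ → ℕ
  | 0 => Q
  | s + 1 => Q * 2 ^ tower Q s

theorem tower_mono {Q : ℕ} : Monotone (tower Q) := by
  refine monotone_nat_of_le_succ fun n => ?_
  rcases Nat.eq_zero_or_pos Q with rfl | hQ
  · cases n <;> simp [tower]
  · exact (Nat.lt_two_pow_self.le).trans (Nat.le_mul_of_pos_left _ hQ)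

instance finite_ty (D : Type) [Finite D] (r : ℕ) (C : Type) [Finite C] : Finite (Ty D r C) := by
  induction r generalizing C with
  | zero => exact inferInstanceAs (Finite (Set C × Set (C × C)))
  | succ r ih =>
    have := ih (C × D)
    exact inferInstanceAs (Finite ((Set C × Set (C × C)) × Set (Ty D r (C × D))))

theorem card_set (α : Type) [Finite α] : Nat.card (Set α) = 2 ^ Nat.card α := by
  have := Fintype.ofFinite α
  classical
  simp [Nat.card_eq_fintype_card]

theorem card_ty_le {D : Type} [Finite D] [Nonempty D] {Q : ℕ} (r : ℕ) (C : Type) [Finite C]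
    {m : ℕ} (hm : Nat.card C * Nat.card D ^ r ≤ m) (hQ : 2 ^ (m + m * m) ≤ Q) :
    Nat.card (Ty D r C) ≤ tower Q r := by
  have hD : 0 < Nat.card D := Nat.card_pos
  have base : ∀ (C : Type) [Finite C], Nat.card C ≤ m → Nat.card (Set C × Set (C × C)) ≤ Q := by
    intro C _ h
    rw [Nat.card_prod, card_set, card_set, Nat.card_prod, ← pow_add]
    refine le_trans (Nat.pow_le_pow_right (by norm_num) ?_) hQ
    gcongr
  induction r generalizing C with
  | zero => exact base C (by simpa using hm)
  | succ r ih =>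
    change Nat.card ((Set C × Set (C × C)) × Set (Ty D r (C × D))) ≤ _
    rw [Nat.card_prod, card_set (Ty D r (C × D)), tower]
    refine Nat.mul_le_mul (base C ?_) (Nat.pow_le_pow_right (by norm_num) (ih (C × D) ?_))
    · exact (Nat.le_mul_of_pos_right _ (by positivity)).trans hm
    · rw [Nat.card_prod]
      refine le_trans (le_of_eq ?_) hm
      ring

end HyTime

namespace HyTime

/-! ### Back-and-forth equivalence of tuples of signals and time points -/

/-- Push a value onto a de Bruijn environment. -/
def push {α : Type} (a : α) (f : ℕ → α) : ℕ → α
  | 0 => a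
  | n + 1 => f n

@[simp] theorem push_zero {α : Type} (a : α) (f : ℕ → α) : push a f 0 = a := rfl
@[simp] theorem push_succ {α : Type} (a : α) (f : ℕ → α) (n : ℕ) : push a f (n + 1) = f n := rfl

def tyF {C D : Type} (r : ℕ) (f : ℝ → C) : C × Ty D r C := (f 0, ty r f 0 1)

def tyInfo {D : Type} : (r : ℕ) → {C : Type} → Ty D r C → Set C × Set (C × C)
  | 0, _, s => s
  | _ + 1, _, s => s.1

theorem tyInfo_ty {C D : Type} (r : ℕ) (f : ℝ → C) (a b : ℝ) :
    tyInfo r (ty r f a b : Ty D r C) = info f a b := by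
  cases r <;> rfl

section
variable {C D : Type} {r : ℕ} {f g : ℝ → C}

theorem tyF_occ (h : (tyF r f : C × Ty D r C) = tyF r g) {x : ℝ} (h0 : 0 ≤ x) (h1 : x < 1) :
    ∃ y, 0 ≤ y ∧ y < 1 ∧ g y = f x := by
  obtain ⟨e0, e1⟩ := Prod.ext_iff.1 h
  have hi : info f 0 1 = info g 0 1 := by
    rw [← tyInfo_ty (D := D) r f, ← tyInfo_ty (D := D) r g]; exact congrArg _ e1
  rcases h0.eq_or_lt with rfl | h0
  · exact ⟨0, le_rfl, one_pos, e0.symm⟩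
  · have : f x ∈ (info f 0 1).1 := ⟨x, h0, h1, rfl⟩
    rw [hi] at this
    obtain ⟨y, hy0, hy1, hy⟩ := this
    exact ⟨y, hy0.le, hy1, hy⟩

theorem tyF_prec (h : (tyF r f : C × Ty D r C) = tyF r g) {x y : ℝ} (h0 : 0 ≤ x) (hxy : x < y)
    (h1 : y < 1) : ∃ x' y', 0 ≤ x' ∧ x' < y' ∧ y' < 1 ∧ g x' = f x ∧ g y' = f y := by
  obtain ⟨e0, e1⟩ := Prod.ext_iff.1 h
  have hi : info f 0 1 = info g 0 1 := by
    rw [← tyInfo_ty (D := D) r f, ← tyInfo_ty (D := D) r g]; exact congrArg _ e1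
  rcases h0.eq_or_lt with rfl | h0
  · have : f y ∈ (info f 0 1).1 := ⟨y, hxy, h1, rfl⟩
    rw [hi] at this
    obtain ⟨y', hy0, hy1, hy⟩ := this
    exact ⟨0, y', le_rfl, hy0, hy1, e0.symm, hy⟩
  · have : (f x, f y) ∈ (info f 0 1).2 := ⟨x, y, h0, hxy, h1, rfl, rfl⟩
    rw [hi] at this
    obtain ⟨x', y', a1, a2, a3, a4, a5⟩ := this
    exact ⟨x', y', a1.le, a2, a3, a4, a5⟩

theorem exists_tyF_of_tyF_succ (h : (tyF (r + 1) f : C × Ty D (r + 1) C) = tyF (r + 1) g)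
    {X : ℝ → D} (hX : PC X 0 1) : ∃ Y : ℝ → D, PC Y 0 1 ∧
      (tyF r (fun t => (f t, X t)) : (C × D) × Ty D r (C × D)) = tyF r fun t => (g t, Y t) := by
  obtain ⟨e0, e1⟩ := Prod.ext_iff.1 h
  have : ty r (fun t => (f t, X t)) 0 1 ∈ (ty (r + 1) f 0 1 : Ty D (r + 1) C).2 := ⟨X, hX, rfl⟩
  rw [show (ty (r + 1) f 0 1 : Ty D (r + 1) C) = ty (r + 1) g 0 1 from e1] at this
  obtain ⟨Y, hY, hXY⟩ := this
  have hne : ∀ t : ℝ, 0 < t → t < 1 → (if t = 0 then X 0 else Y t) = Y t :=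
    fun t h _ => if_neg h.ne'
  refine ⟨fun t => if t = 0 then X 0 else Y t, hY.congr hne, Prod.ext ?_ ?_⟩
  · simp only [tyF, if_true]
    rw [show f 0 = g 0 from e0]
  · change ty r (fun t => (f t, X t)) 0 1 = _
    rw [hXY]
    exact ty_congr r fun t h1 h2 => by simp only [hne t h1 h2]

end

section
variable {Λ : Type} {N : ℕ}

/-- One period worth of stacked letters and time markers. -/
abbrev Layer (Λ : Type) (N : ℕ) : Type := Fin N → Λ × Bool

/-- The colouring `f` of `[0, 1)` encodes the signals `S` and the times `τ` on `[0, N)`. -/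
structure Reads {C : Type} (f : ℝ → C) (rs : ℕ → C → Fin N → Λ) (rt : ℕ → C → Fin N → Bool)
    (S : ℕ → ℝ → Λ) (τ : ℕ → ℝ) : Prop where
  sig : ∀ i x, 0 ≤ x → x < 1 → ∀ j : Fin N, rs i (f x) j = S i (j + x)
  time : ∀ i x, 0 ≤ x → x < 1 → ∀ j : Fin N, rt i (f x) j = true ↔ τ i = j + x
  nonneg : ∀ i, 0 ≤ τ i
  lt : ∀ i, τ i < N

theorem exists_split {t : ℝ} (h0 : 0 ≤ t) (h1 : t < N) :
    ∃ (j : Fin N) (x : ℝ), 0 ≤ x ∧ x < 1 ∧ t = j + x := by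
  have hj : ⌊t⌋₊ < N := (Nat.floor_lt h0).2 h1
  refine ⟨⟨⌊t⌋₊, hj⟩, t - ⌊t⌋₊, ?_, ?_, by simp⟩
  · linarith [Nat.floor_le h0]
  · linarith [Nat.lt_floor_add_one t]

theorem split_unique {i j : Fin N} {x y : ℝ} (hx0 : 0 ≤ x) (hx1 : x < 1) (hy0 : 0 ≤ y) (hy1 : y < 1)
    (h : (i : ℝ) + x = j + y) : i = j ∧ x = y := by
  have e : (i : ℕ) = j := by
    have h1 : ((i : ℕ) : ℝ) < ((j : ℕ) : ℝ) + 1 := by linarith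
    have h2 : ((j : ℕ) : ℝ) < ((i : ℕ) : ℝ) + 1 := by linarith
    have h1' : (i : ℕ) < j + 1 := by exact_mod_cast h1
    have h2' : (j : ℕ) < i + 1 := by exact_mod_cast h2
    omega
  obtain rfl : i = j := Fin.ext e
  exact ⟨rfl, by linarith⟩

/-- Rank `r` equivalence of signal and time tuples. -/
def BF (N r : ℕ) (S : ℕ → ℝ → Λ) (τ : ℕ → ℝ) (S' : ℕ → ℝ → Λ) (τ' : ℕ → ℝ) : Prop :=
  ∃ (C : Type) (_ : Finite C) (f g : ℝ → C) (rs : ℕ → C → Fin N → Λ) (rt : ℕ → C → Fin N → Bool),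
    (tyF r f : C × Ty (Layer Λ N) r C) = tyF r g ∧ Reads f rs rt S τ ∧ Reads g rs rt S' τ'

theorem Reads.relayout {C : Type} {f : ℝ → C} {rs : ℕ → C → Fin N → Λ} {rt : ℕ → C → Fin N → Bool}
    {S : ℕ → ℝ → Λ} {τ : ℕ → ℝ} (h : Reads f rs rt S τ) (v w : ℕ → ℕ) :
    Reads f (fun i => rs (v i)) (fun i => rt (w i)) (fun i => S (v i)) (fun i => τ (w i)) :=
  ⟨fun i => h.sig (v i), fun i => h.time (w i), fun i => h.nonneg (w i), fun i => h.lt (w i)⟩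

theorem time_extract {C : Type} {r : ℕ} {f g : ℝ → C} {X Y : ℝ → Layer Λ N} {t : ℝ}
    (h : (tyF r (fun x => (f x, X x)) : _ × Ty (Layer Λ N) r _) = tyF r fun x => (g x, Y x))
    (h0 : 0 ≤ t) (h1 : t < N)
    (hX : ∀ x, 0 ≤ x → x < 1 → ∀ j, (X x j).2 = true ↔ t = j + x) :
    ∃ t' : ℝ, 0 ≤ t' ∧ t' < N ∧ ∀ x, 0 ≤ x → x < 1 → ∀ j, (Y x j).2 = true ↔ t' = j + x := by
  obtain ⟨j, x, hx0, hx1, rfl⟩ := exists_split h0 h1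
  obtain ⟨x', hx0', hx1', hx'⟩ := tyF_occ h hx0 hx1
  simp only [Prod.mk.injEq] at hx'
  have hj : ((j : ℕ) : ℝ) + 1 ≤ N := by exact_mod_cast j.2
  refine ⟨j + x', by positivity, by linarith, fun y hy0 hy1 l => ⟨fun hl => ?_, fun hl => ?_⟩⟩
  · obtain ⟨y₀, hy₀0, hy₀1, hy₀⟩ := tyF_occ h.symm hy0 hy1
    simp only [Prod.mk.injEq] at hy₀
    rw [← hy₀.2, hX y₀ hy₀0 hy₀1] at hl
    obtain ⟨rfl, rfl⟩ := split_unique hx0 hx1 hy₀0 hy₀1 hl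
    have key : ∀ u v, 0 ≤ u → u < v → v < 1 → (g u, Y u) = (f x, X x) →
        (g v, Y v) = (f x, X x) → False := by
      intro u v hu huv hv eu ev
      obtain ⟨u', v', b1, b2, b3, b4, b5⟩ := tyF_prec h.symm hu huv hv
      simp only [eu, ev, Prod.mk.injEq] at b4 b5
      have c := (hX x hx0 hx1 j).2 rfl
      have c1 := (hX u' b1 (by linarith) j).1 (by rw [b4.2]; exact c)
      have c2 := (hX v' (by linarith) b3 j).1 (by rw [b5.2]; exact c)
      linarith
    have e1 : (g y, Y y) = (f x, X x) := by rw [hy₀.1, hy₀.2]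
    have e2 : (g x', Y x') = (f x, X x) := by rw [hx'.1, hx'.2]
    rcases lt_trichotomy x' y with h' | h' | h'
    · exact (key _ _ hx0' h' hy1 e2 e1).elim
    · rw [h']
    · exact (key _ _ hy0 h' hx1' e1 e2).elim
  · obtain ⟨rfl, rfl⟩ := split_unique hx0' hx1' hy0 hy1 hl
    rw [hx'.2]
    exact (hX x hx0 hx1 j).2 rfl

/-- The marker layer of a time point. -/
noncomputable def mark [Inhabited Λ] (N : ℕ) (t : ℝ) (x : ℝ) : Layer Λ N :=
  fun j => (default, @decide (t = j + x) (Classical.propDecidable _))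

/-- The layer of a signal. -/
def layer (N : ℕ) (s : ℝ → Λ) (x : ℝ) : Layer Λ N := fun j => (s (j + x), false)

/-- The signal stored in a layer. -/
noncomputable def unlayer [Inhabited Λ] (Y : ℝ → Layer Λ N) (t : ℝ) : Λ :=
  if h : ⌊t⌋₊ < N then (Y (t - ⌊t⌋₊) ⟨⌊t⌋₊, h⟩).1 else default

theorem unlayer_apply [Inhabited Λ] (Y : ℝ → Layer Λ N) (j : Fin N) {x : ℝ} (h0 : 0 ≤ x)
    (h1 : x < 1) : unlayer Y (j + x) = (Y x j).1 := by
  have : ⌊(j : ℝ) + x⌋₊ = j :=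
    (Nat.floor_eq_iff (by positivity)).2 ⟨by linarith, by linarith⟩
  simp [unlayer, this]

theorem mark_iff [Inhabited Λ] {t x : ℝ} (j : Fin N) :
    (mark (Λ := Λ) N t x j).2 = true ↔ t = j + x := by
  simp [mark]

/-- Finite variability on `[0, N)`. -/
def FV (N : ℕ) (s : ℝ → Λ) : Prop := ∀ j < N, PC (fun x => s (j + x)) 0 1

theorem pc_layer {s : ℝ → Λ} (h : FV N s) : PC (layer N s) 0 1 :=
  PC.pi fun j : Fin N => (h j j.2).comp fun l => (l, false)

theorem pc_mark [Inhabited Λ] (t : ℝ) : PC (mark (Λ := Λ) N t) 0 1 := by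
  classical
  refine ⟨Finset.univ.image fun j : Fin N => t - j, fun x y h1 h2 h3 h4 => funext fun j => ?_⟩
  have := h4 (t - j) (Finset.mem_image_of_mem _ (Finset.mem_univ _))
  have e1 : ¬ t = j + x := fun e => this ⟨by linarith, by linarith⟩
  have e2 : ¬ t = j + y := fun e => this ⟨by linarith, by linarith⟩
  simp [mark, e1, e2]

theorem fv_unlayer [Inhabited Λ] {Y : ℝ → Layer Λ N} (h : PC Y 0 1) : FV N (unlayer Y) := by
  intro j hj
  refine (h.comp fun y => (y ⟨j, hj⟩).1).congr fun t h1 h2 => ?_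
  exact unlayer_apply Y ⟨j, hj⟩ h1.le h2

theorem Reads.push_time {C : Type} {f : ℝ → C} {rs : ℕ → C → Fin N → Λ} {rt : ℕ → C → Fin N → Bool}
    {S : ℕ → ℝ → Λ} {τ : ℕ → ℝ} (h : Reads f rs rt S τ) {Y : ℝ → Layer Λ N} {t : ℝ}
    (h0 : 0 ≤ t) (h1 : t < N) (hY : ∀ x, 0 ≤ x → x < 1 → ∀ j, (Y x j).2 = true ↔ t = j + x) :
    Reads (fun x => (f x, Y x)) (fun i p => rs i p.1)
      (push (fun p j => (p.2 j).2) fun i p => rt i p.1) S (push t τ) where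
  sig i x hx0 hx1 j := h.sig i x hx0 hx1 j
  time i x hx0 hx1 j := by
    cases i with
    | zero => exact hY x hx0 hx1 j
    | succ i => exact h.time i x hx0 hx1 j
  nonneg i := by
    cases i with
    | zero => exact h0
    | succ i => exact h.nonneg i
  lt i := by
    cases i with
    | zero => exact h1
    | succ i => exact h.lt i

theorem Reads.push_sig {C : Type} {f : ℝ → C} {rs : ℕ → C → Fin N → Λ} {rt : ℕ → C → Fin N → Bool}
    {S : ℕ → ℝ → Λ} {τ : ℕ → ℝ} (h : Reads f rs rt S τ) {Y : ℝ → Layer Λ N} {s : ℝ → Λ}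
    (hY : ∀ x, 0 ≤ x → x < 1 → ∀ j, (Y x j).1 = s (j + x)) :
    Reads (fun x => (f x, Y x)) (push (fun p j => (p.2 j).1) fun i p => rs i p.1)
      (fun i p => rt i p.1) (push s S) τ where
  sig i x hx0 hx1 j := by
    cases i with
    | zero => exact hY x hx0 hx1 j
    | succ i => exact h.sig i x hx0 hx1 j
  time i x hx0 hx1 j := h.time i x hx0 hx1 j
  nonneg i := h.nonneg i
  lt i := h.lt i

namespace BF
variable {r : ℕ} {S S' : ℕ → ℝ → Λ} {τ τ' : ℕ → ℝ}

theorem symm (h : BF N r S τ S' τ') : BF N r S' τ' S τ := by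
  obtain ⟨C, hC, f, g, rs, rt, h1, h2, h3⟩ := h
  exact ⟨C, hC, g, f, rs, rt, h1.symm, h3, h2⟩

theorem relayout (h : BF N r S τ S' τ') (v w : ℕ → ℕ) :
    BF N r (fun i => S (v i)) (fun i => τ (w i)) (fun i => S' (v i)) (fun i => τ' (w i)) := by
  obtain ⟨C, hC, f, g, rs, rt, h1, h2, h3⟩ := h
  exact ⟨C, hC, f, g, _, _, h1, h2.relayout v w, h3.relayout v w⟩

theorem nonneg (h : BF N r S τ S' τ') (i : ℕ) : 0 ≤ τ i := by
  obtain ⟨C, hC, f, g, rs, rt, h1, h2, h3⟩ := h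
  exact h2.nonneg i

theorem lt (h : BF N r S τ S' τ') (i : ℕ) : τ i < N := by
  obtain ⟨C, hC, f, g, rs, rt, h1, h2, h3⟩ := h
  exact h2.lt i

theorem letter (h : BF N r S τ S' τ') (i k : ℕ) : S i (τ k) = S' i (τ' k) := by
  obtain ⟨C, hC, f, g, rs, rt, h1, h2, h3⟩ := h
  obtain ⟨j, x, hx0, hx1, hx⟩ := exists_split (h2.nonneg k) (h2.lt k)
  obtain ⟨y, hy0, hy1, hy⟩ := tyF_occ h1 hx0 hx1
  have := (h2.time k x hx0 hx1 j).2 hx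
  rw [← hy, h3.time k y hy0 hy1 j] at this
  rw [this, hx, ← h2.sig i x hx0 hx1, ← h3.sig i y hy0 hy1, hy]

theorem diff_le (h : BF N r S τ S' τ') (i k : ℕ) (z : ℤ) (hz : τ i - τ k ≤ z) :
    τ' i - τ' k ≤ z := by
  obtain ⟨C, hC, f, g, rs, rt, h1, h2, h3⟩ := h
  obtain ⟨j, x, hx0, hx1, hx⟩ := exists_split (h2.nonneg i) (h2.lt i)
  obtain ⟨l, y, hy0, hy1, hy⟩ := exists_split (h2.nonneg k) (h2.lt k)
  have ti := (h2.time i x hx0 hx1 j).2 hx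
  have tk := (h2.time k y hy0 hy1 l).2 hy
  rw [hx, hy] at hz
  have tr : ∀ x' y', 0 ≤ x' → x' < 1 → 0 ≤ y' → y' < 1 → g x' = f x → g y' = f y →
      τ' i = j + x' ∧ τ' k = l + y' := fun x' y' a1 a2 a3 a4 a5 a6 =>
    ⟨(h3.time i x' a1 a2 j).1 (by rw [a5]; exact ti),
      (h3.time k y' a3 a4 l).1 (by rw [a6]; exact tk)⟩
  rcases lt_trichotomy x y with hxy | rfl | hxy
  · obtain ⟨x', y', b1, b2, b3, b4, b5⟩ := tyF_prec h1 hx0 hxy hy1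
    obtain ⟨c1, c2⟩ := tr x' y' b1 (by linarith) (by linarith) b3 b4 b5
    have : ((j : ℕ) : ℝ) < (l : ℕ) + z + 1 := by linarith
    have h' : ((j : ℕ) : ℤ) < (l : ℕ) + z + 1 := by exact_mod_cast this
    have h' : ((j : ℕ) : ℤ) ≤ (l : ℕ) + z := by omega
    have : ((j : ℕ) : ℝ) ≤ (l : ℕ) + z := by exact_mod_cast h'
    rw [c1, c2]
    linarith
  · obtain ⟨x', b1, b2, b3⟩ := tyF_occ h1 hx0 hx1
    obtain ⟨c1, c2⟩ := tr x' x' b1 b2 b1 b2 b3 b3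
    rw [c1, c2]
    linarith
  · obtain ⟨y', x', b1, b2, b3, b4, b5⟩ := tyF_prec h1 hy0 hxy hx1
    obtain ⟨c1, c2⟩ := tr x' y' (by linarith) b3 b1 (by linarith) b5 b4
    have : ((j : ℕ) : ℝ) < (l : ℕ) + z := by linarith
    have h' : ((j : ℕ) : ℤ) < (l : ℕ) + z := by exact_mod_cast this
    have h' : ((j : ℕ) : ℤ) + 1 ≤ (l : ℕ) + z := by omega
    have : ((j : ℕ) : ℝ) + 1 ≤ (l : ℕ) + z := by exact_mod_cast h'
    rw [c1, c2]
    linarith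

theorem diff_le_iff (h : BF N r S τ S' τ') (i k : ℕ) (z : ℤ) :
    τ i - τ k ≤ z ↔ τ' i - τ' k ≤ z :=
  ⟨h.diff_le i k z, h.symm.diff_le i k z⟩

theorem eq_zero (h : BF N r S τ S' τ') (i : ℕ) (hi : τ i = 0) : τ' i = 0 := by
  obtain ⟨C, hC, f, g, rs, rt, h1, h2, h3⟩ := h
  have hN : 0 < N := by
    have := (h2.nonneg i).trans_lt (h2.lt i)
    exact_mod_cast this
  have e0 := (h2.time i 0 le_rfl one_pos ⟨0, hN⟩).2 (by simpa using hi)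
  rw [show f 0 = g 0 from congrArg Prod.fst h1] at e0
  simpa using (h3.time i 0 le_rfl one_pos ⟨0, hN⟩).1 e0

theorem eq_zero_iff (h : BF N r S τ S' τ') (i : ℕ) : τ i = 0 ↔ τ' i = 0 :=
  ⟨h.eq_zero i, h.symm.eq_zero i⟩

theorem step_time [Finite Λ] [Inhabited Λ] (h : BF N (r + 1) S τ S' τ') {t : ℝ} (h0 : 0 ≤ t)
    (ht : t < N) : ∃ t' : ℝ, 0 ≤ t' ∧ t' < N ∧ BF N r S (push t τ) S' (push t' τ') := by
  obtain ⟨C, hC, f, g, rs, rt, h1, h2, h3⟩ := h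
  obtain ⟨Y, hY, hXY⟩ := exists_tyF_of_tyF_succ h1 (pc_mark t)
  have hm : ∀ x, 0 ≤ x → x < 1 → ∀ j, (mark (Λ := Λ) N t x j).2 = true ↔ t = j + x :=
    fun x _ _ j => mark_iff j
  obtain ⟨t', h0', ht', hY'⟩ := time_extract hXY h0 ht hm
  exact ⟨t', h0', ht', _, inferInstance, _, _, _, _, hXY, h2.push_time h0 ht hm,
    h3.push_time h0' ht' hY'⟩

theorem step_sig [Finite Λ] [Inhabited Λ] (h : BF N (r + 1) S τ S' τ') {s : ℝ → Λ} (hs : FV N s) :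
    ∃ s', FV N s' ∧ BF N r (push s S) τ (push s' S') τ' := by
  obtain ⟨C, hC, f, g, rs, rt, h1, h2, h3⟩ := h
  obtain ⟨Y, hY, hXY⟩ := exists_tyF_of_tyF_succ h1 (pc_layer hs)
  exact ⟨unlayer Y, fv_unlayer hY, _, inferInstance, _, _, _, _, hXY,
    h2.push_sig fun _ _ _ _ => rfl,
    h3.push_sig fun x hx0 hx1 j => (unlayer_apply Y j hx0 hx1).symm⟩

end BF

/-! ### Grid configurations -/

/-- `B` exceeds the number of relevant types over at most `K` layers. -/
def Fine (Λ : Type) (N K B : ℕ) : Prop :=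
  ∀ (r : ℕ) (C : Type) [Finite C], r ≤ K →
    Nat.card C * Nat.card (Layer Λ N) ^ r ≤ Nat.card (Layer Λ N) ^ (K + 1) →
      Nat.card (Ty (Layer Λ N) r C) < B

/-- The signals and times are aligned to the grid of level `k`. -/
def Cfg (N B k : ℕ) (S : ℕ → ℝ → Λ) (τ : ℕ → ℝ) : Prop :=
  ∃ (C : Type) (_ : Finite C) (f : ℝ → C) (rs : ℕ → C → Fin N → Λ) (rt : ℕ → C → Fin N → Bool),
    Nat.card C ≤ Nat.card (Layer Λ N) ^ (k + 1) ∧ aligned (B ^ k) f ∧ Reads f rs rt S τ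

namespace Cfg
variable {K B k r : ℕ} {S : ℕ → ℝ → Λ} {τ : ℕ → ℝ}

theorem relayout (h : Cfg N B k S τ) (v w : ℕ → ℕ) :
    Cfg N B k (fun i => S (v i)) (fun i => τ (w i)) := by
  obtain ⟨C, hC, f, rs, rt, h1, h2, h3⟩ := h
  exact ⟨C, hC, f, _, _, h1, h2, h3.relayout v w⟩

theorem nonneg (h : Cfg N B k S τ) (i : ℕ) : 0 ≤ τ i := by
  obtain ⟨C, hC, f, rs, rt, h1, h2, h3⟩ := h
  exact h3.nonneg i

theorem lt (h : Cfg N B k S τ) (i : ℕ) : τ i < N := by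
  obtain ⟨C, hC, f, rs, rt, h1, h2, h3⟩ := h
  exact h3.lt i

theorem aligned_pair {C D : Type} {f : ℝ → C} {g : ℝ → D} {G : ℕ} (hf : aligned G f)
    (hg : aligned G g) : aligned G fun x => (f x, g x) :=
  fun i hi t u h1 h2 h3 h4 => by
    simp only [hf i hi t u h1 h2 h3 h4, hg i hi t u h1 h2 h3 h4]

theorem card_prod_le [Finite Λ] [Nonempty Λ] {C : Type} [Finite C]
    (h : Nat.card C ≤ Nat.card (Layer Λ N) ^ (k + 1)) :
    Nat.card (C × Layer Λ N) ≤ Nat.card (Layer Λ N) ^ (k + 1 + 1) := by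
  rw [Nat.card_prod, pow_succ _ (k + 1)]
  gcongr

theorem fine_prod [Finite Λ] [Nonempty Λ] (hB : Fine Λ N K B) (hrk : r + k < K) {C : Type} [Finite C]
    (h : Nat.card C ≤ Nat.card (Layer Λ N) ^ (k + 1)) :
    Nat.card (Ty (Layer Λ N) r (C × Layer Λ N)) < B := by
  refine hB r _ (by omega) ?_
  calc Nat.card (C × Layer Λ N) * Nat.card (Layer Λ N) ^ r
      ≤ Nat.card (Layer Λ N) ^ (k + 1 + 1) * Nat.card (Layer Λ N) ^ r := by
        gcongr; exact card_prod_le h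
    _ = Nat.card (Layer Λ N) ^ (k + 1 + 1 + r) := (pow_add _ _ _).symm
    _ ≤ _ := Nat.pow_le_pow_right Nat.card_pos (by omega)

theorem exists_aligned [Finite Λ] [Nonempty Λ] (hB : Fine Λ N K B) (hrk : r + k < K) {C : Type}
    [Finite C] (h : Nat.card C ≤ Nat.card (Layer Λ N) ^ (k + 1)) {f : ℝ → C}
    (hf : aligned (B ^ k) f) {X : ℝ → Layer Λ N} (hX : PC X 0 1) :
    ∃ Y : ℝ → Layer Λ N, aligned (B ^ (k + 1)) (fun x => (f x, Y x)) ∧ aligned (B ^ (k + 1)) Y ∧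
      (tyF r (fun x => (f x, X x)) : _ × Ty (Layer Λ N) r _) = tyF r fun x => (f x, Y x) := by
  have hlt := fine_prod hB hrk h
  have hB0 : 0 < B := by omega
  obtain ⟨Y, hY, hY0, hXY⟩ := descend r (by positivity) hf hX hlt
  exact ⟨Y, aligned_pair (hf.mul hB0 (by positivity)) hY, hY, Prod.ext (by simp [tyF, hY0]) hXY⟩

theorem time_down [Finite Λ] [Inhabited Λ] (h : Cfg N B k S τ) (hB : Fine Λ N K B) (hrk : r + k < K)
    {t : ℝ} (h0 : 0 ≤ t) (ht : t < N) :
    ∃ t', Cfg N B (k + 1) S (push t' τ) ∧ BF N r S (push t τ) S (push t' τ) := by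
  obtain ⟨C, hC, f, rs, rt, h1, h2, h3⟩ := h
  obtain ⟨Y, hY, -, hXY⟩ := exists_aligned hB hrk h1 h2 (pc_mark t)
  have hm : ∀ x, 0 ≤ x → x < 1 → ∀ j, (mark (Λ := Λ) N t x j).2 = true ↔ t = j + x :=
    fun x _ _ j => mark_iff j
  obtain ⟨t', h0', ht', hY'⟩ := time_extract hXY h0 ht hm
  exact ⟨t', ⟨_, inferInstance, _, _, _, card_prod_le h1, hY, h3.push_time h0' ht' hY'⟩,
    _, inferInstance, _, _, _, _, hXY, h3.push_time h0 ht hm, h3.push_time h0' ht' hY'⟩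

theorem sig_down [Finite Λ] [Inhabited Λ] (h : Cfg N B k S τ) (hB : Fine Λ N K B) (hrk : r + k < K)
    {s : ℝ → Λ} (hs : FV N s) :
    ∃ s', FV N s' ∧ Cfg N B (k + 1) (push s' S) τ ∧ BF N r (push s S) τ (push s' S) τ := by
  obtain ⟨C, hC, f, rs, rt, h1, h2, h3⟩ := h
  have hB0 : 0 < B := (Nat.zero_le _).trans_lt (fine_prod hB hrk h1)
  obtain ⟨Y, hY, hY', hXY⟩ := exists_aligned hB hrk h1 h2 (pc_layer hs)
  have hr := h3.push_sig fun x hx0 hx1 j => (unlayer_apply Y j hx0 hx1).symm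
  exact ⟨unlayer Y, fv_unlayer (hY'.pc (by positivity)),
    ⟨_, inferInstance, _, _, _, card_prod_le h1, hY, hr⟩,
    _, inferInstance, _, _, _, _, hXY, h3.push_sig fun _ _ _ _ => rfl, hr⟩

theorem time_push [Finite Λ] [Inhabited Λ] (h : Cfg N B k S τ) (hB0 : 0 < B) {t : ℝ} (h0 : 0 ≤ t)
    (ht : t < N) {q : ℕ} (hq : t * (B : ℝ) ^ (k + 1) = q) : Cfg N B (k + 1) S (push t τ) := by
  obtain ⟨C, hC, f, rs, rt, h1, h2, h3⟩ := h
  have hal : aligned (B ^ (k + 1)) (mark (Λ := Λ) N t) := by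
    intro i hi x y hx1 hx2 hy1 hy2
    have hB' : (0 : ℝ) < (B : ℝ) ^ (k + 1) := by positivity
    push_cast at hx1 hx2 hy1 hy2
    have key : ∀ z : ℝ, (i : ℝ) / (B : ℝ) ^ (k + 1) < z → z < (i + 1 : ℝ) / (B : ℝ) ^ (k + 1) →
        ∀ j : Fin N, ¬ t = j + z := by
      intro z hz1 hz2 j e
      rw [div_lt_iff₀ hB'] at hz1
      rw [lt_div_iff₀ hB'] at hz2
      rw [e, add_mul] at hq
      have e1 : ((i + j * B ^ (k + 1) : ℕ) : ℝ) < q := by push_cast; linarith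
      have e2 : (q : ℝ) < ((i + j * B ^ (k + 1) + 1 : ℕ) : ℝ) := by push_cast; linarith
      rw [Nat.cast_lt] at e1 e2
      omega
    funext j
    simp [mark, key x hx1 hx2 j, key y hy1 hy2 j]
  exact ⟨_, inferInstance, _, _, _, card_prod_le h1,
    aligned_pair (h2.mul hB0 (by positivity)) hal, h3.push_time h0 ht fun x _ _ j => mark_iff j⟩

theorem sig_push [Finite Λ] [Inhabited Λ] (h : Cfg N B k S τ) (hB0 : 0 < B) {s : ℝ → Λ}
    (hs : ∀ j < N, aligned (B ^ (k + 1)) fun x => s (j + x)) : Cfg N B (k + 1) (push s S) τ := by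
  obtain ⟨C, hC, f, rs, rt, h1, h2, h3⟩ := h
  have hal : aligned (B ^ (k + 1)) (layer N s) := fun i hi x y a b c d =>
    funext fun j => by exact congrArg (·, false) (hs j j.2 i hi x y a b c d)
  exact ⟨_, inferInstance, _, _, _, card_prod_le h1,
    aligned_pair (h2.mul hB0 (by positivity)) hal, h3.push_sig fun _ _ _ _ => rfl⟩

theorem exists_grid (h : Cfg N B k S τ) (hB0 : 0 < B) (i : ℕ) :
    ∃ q : ℕ, τ i * (B : ℝ) ^ k = q := by
  obtain ⟨C, hC, f, rs, rt, h1, h2, h3⟩ := h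
  obtain ⟨j, x, hx0, hx1, hx⟩ := exists_split (h3.nonneg i) (h3.lt i)
  have hB' : (0 : ℝ) < (B : ℝ) ^ k := by positivity
  have hp : 0 ≤ x * (B : ℝ) ^ k := by positivity
  by_cases hg : (⌊x * (B : ℝ) ^ k⌋₊ : ℝ) = x * (B : ℝ) ^ k
  · exact ⟨j * B ^ k + ⌊x * (B : ℝ) ^ k⌋₊, by rw [hx]; push_cast; rw [hg]; ring⟩
  · exfalso
    set m := ⌊x * (B : ℝ) ^ k⌋₊ with hm
    have e1 : (m : ℝ) < x * (B : ℝ) ^ k := lt_of_le_of_ne (Nat.floor_le hp) hg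
    have e2 : x * (B : ℝ) ^ k < m + 1 := Nat.lt_floor_add_one _
    have hmB : m < B ^ k := by
      have : (m : ℝ) < (B : ℝ) ^ k := by nlinarith
      exact_mod_cast this
    have l1 : (m : ℝ) / (B : ℝ) ^ k < x := by rwa [div_lt_iff₀ hB']
    have l2 : x < (m + 1 : ℝ) / (B : ℝ) ^ k := by rwa [lt_div_iff₀ hB']
    have l0 : 0 ≤ (m : ℝ) / (B : ℝ) ^ k := by positivity
    set y := ((m : ℝ) / (B : ℝ) ^ k + x) / 2 with hy
    have := h2 m hmB x y (by push_cast; linarith) (by push_cast; linarith) (by push_cast; linarith)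
      (by push_cast; linarith)
    have ht := (h3.time i x hx0 hx1 j).2 hx
    rw [this, h3.time i y (by linarith) (by linarith) j, hx] at ht
    linarith

theorem aligned_sig (h : Cfg N B k S τ) (hB0 : 0 < B) (i j : ℕ) (hj : j < N) :
    aligned (B ^ k) fun x => S i (j + x) := by
  obtain ⟨C, hC, f, rs, rt, h1, h2, h3⟩ := h
  intro m hm x y a b c d
  have hB' : (0 : ℝ) < ((B ^ k : ℕ) : ℝ) := by positivity
  have l0 : 0 ≤ (m : ℝ) / (B ^ k : ℕ) := by positivity
  have l1 : (m + 1 : ℝ) / (B ^ k : ℕ) ≤ 1 := by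
    rw [div_le_one hB']; exact_mod_cast hm
  have e1 := h3.sig i x (by linarith) (by linarith) ⟨j, hj⟩
  have e2 := h3.sig i y (by linarith) (by linarith) ⟨j, hj⟩
  simp only at e1 e2 ⊢
  rw [← e1, ← e2, h2 m hm x y a b c d]

theorem initial [Finite Λ] [Inhabited Λ] (hN : 0 < N) (a : Λ) :
    Cfg N B 0 (fun _ _ => a) (fun _ => 0) := by
  refine ⟨Bool, inferInstance, fun x => @decide (x = 0) (Classical.propDecidable _),
    fun _ _ _ => a, fun _ b j => b && decide ((j : ℕ) = 0), ?_, ?_, ?_⟩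
  · have : Nat.card (Layer Λ N) = (Nat.card Λ * 2) ^ N := by
      rw [Nat.card_fun, Nat.card_prod]; simp
    rw [this, Nat.card_eq_fintype_card, Fintype.card_bool, zero_add, pow_one]
    calc 2 ≤ Nat.card Λ * 2 := by have : 0 < Nat.card Λ := Nat.card_pos; omega
      _ ≤ _ := Nat.le_self_pow hN.ne' _
  · intro i hi t u h1 h2 h3 h4
    have : (0 : ℝ) ≤ (i : ℝ) / (B ^ 0 : ℕ) := by positivity
    have e1 : t ≠ 0 := by linarith [this, h1] |> fun h : 0 < t => h.ne'
    have e2 : u ≠ 0 := by linarith [this, h3] |> fun h : 0 < u => h.ne'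
    simp [e1, e2]
  · refine ⟨fun _ _ _ _ _ => rfl, fun i x h0 h1 j => ?_, fun _ => le_rfl, fun _ => by
      exact_mod_cast hN⟩
    simp only [Bool.and_eq_true, decide_eq_true_eq]
    constructor
    · rintro ⟨rfl, h⟩; simp [h]
    · intro h
      have hj : (0 : ℝ) ≤ ((j : ℕ) : ℝ) := by positivity
      have : ((j : ℕ) : ℝ) = 0 := by linarith
      exact ⟨by linarith, by exact_mod_cast this⟩

end Cfg
end

theorem card_layer (b N : ℕ) : Nat.card (Layer (Fin b) N) = (b * 2) ^ N := by
  rw [Nat.card_fun, Nat.card_prod]; simp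

/-- A subdivision factor exceeding the number of relevant types. -/
def fineness (b N K : ℕ) : ℕ :=
  tower (2 ^ (((b * 2) ^ N) ^ (K + 1) + ((b * 2) ^ N) ^ (K + 1) * ((b * 2) ^ N) ^ (K + 1))) K + 1

theorem fine_fineness (b N K : ℕ) [Inhabited (Fin b)] : Fine (Fin b) N K (fineness b N K) := by
  intro r C _ hr h
  rw [card_layer] at h
  rw [fineness, Nat.lt_succ_iff]
  exact (card_ty_le r C (by rw [card_layer]; exact h) le_rfl).trans (tower_mono hr)

end HyTime

namespace HyTime

/-! ### Primitive recursive functions for `fun_prop` -/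

@[fun_prop]
def PR {α β : Type} [Primcodable α] [Primcodable β] (f : α → β) : Prop := Primrec f

/-- Bounded universal quantification. -/
def ball (n : ℕ) (f : ℕ → Bool) : Bool := Nat.rec true (fun i acc => acc && f i) n

/-- Bounded existential quantification. -/
def bex (n : ℕ) (f : ℕ → Bool) : Bool := !ball n fun i => !f i

@[simp] theorem ball_iff {n : ℕ} {f : ℕ → Bool} : ball n f = true ↔ ∀ i < n, f i = true := by
  induction n with
  | zero => simp [ball]
  | succ n ih =>
    change (ball n f && f n) = true ↔ _
    rw [Bool.and_eq_true, ih]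
    refine ⟨fun h i hi => ?_, fun h => ⟨fun i hi => h i (by omega), h n (by omega)⟩⟩
    rcases Nat.lt_succ_iff_lt_or_eq.1 hi with h' | rfl
    exacts [h.1 i h', h.2]

@[simp] theorem bex_iff {n : ℕ} {f : ℕ → Bool} : bex n f = true ↔ ∃ i < n, f i = true := by
  rw [bex, Bool.not_eq_true', ← Bool.not_eq_true, ball_iff]
  push Not
  simp

/-- The table of values of a course-of-values recursion. -/
def srecTable (g : List Bool → Bool) (n : ℕ) : List Bool :=
  Nat.rec [] (fun _ l => l ++ [g l]) n

/-- Course-of-values recursion. -/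
def srec (g : List Bool → Bool) (n : ℕ) : Bool := g (srecTable g n)

theorem srecTable_length (g : List Bool → Bool) (n : ℕ) : (srecTable g n).length = n := by
  induction n with
  | zero => rfl
  | succ n ih =>
    change (srecTable g n ++ [g (srecTable g n)]).length = n + 1
    simp [ih]

theorem srecTable_getD (g : List Bool → Bool) {n m : ℕ} (h : m < n) :
    (srecTable g n).getD m false = srec g m := by
  induction n with
  | zero => omega
  | succ n ih =>
    change (srecTable g n ++ [g (srecTable g n)]).getD m false = _
    rcases Nat.lt_succ_iff_lt_or_eq.1 h with h' | rfl
    · rw [List.getD_append _ _ _ _ (by rwa [srecTable_length]), ih h']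
    · rw [List.getD_append_right _ _ _ _ (by rw [srecTable_length])]
      simp [srecTable_length, srec]

/-- The first element of the list satisfying `p`, plus one; zero if there is none. -/
def lfind (l : List ℕ) (p : ℕ → Bool) : ℕ := l.foldr (fun a acc => bif p a then a + 1 else acc) 0

def lmem (a : ℕ) (l : List ℕ) : Bool := !Nat.beq (lfind l fun c => Nat.beq c a) 0

namespace PR
variable {α β γ : Type} [Primcodable α] [Primcodable β] [Primcodable γ]

@[fun_prop] theorem id : PR (fun x : α => x) := Primrec.id
@[fun_prop] theorem const (b : β) : PR (fun _ : α => b) := Primrec.const b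
@[fun_prop] theorem comp {f : β → γ} {g : α → β} (hf : PR f) (hg : PR g) :
    PR (fun x => f (g x)) := Primrec.comp hf hg
@[fun_prop] theorem fst {f : α → β × γ} (h : PR f) : PR (fun x => (f x).1) := Primrec.fst.comp h
@[fun_prop] theorem snd {f : α → β × γ} (h : PR f) : PR (fun x => (f x).2) := Primrec.snd.comp h
@[fun_prop] theorem mk {f : α → β} {g : α → γ} (h : PR f) (h' : PR g) :
    PR (fun x => (f x, g x)) := Primrec.pair h h'
@[fun_prop] theorem add {f g : α → ℕ} (h : PR f) (h' : PR g) : PR (fun x => f x + g x) :=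
  Primrec.nat_add.comp h h'
@[fun_prop] theorem mul {f g : α → ℕ} (h : PR f) (h' : PR g) : PR (fun x => f x * g x) :=
  Primrec.nat_mul.comp h h'
@[fun_prop] theorem sub {f g : α → ℕ} (h : PR f) (h' : PR g) : PR (fun x => f x - g x) :=
  Primrec.nat_sub.comp h h'
@[fun_prop] theorem div {f g : α → ℕ} (h : PR f) (h' : PR g) : PR (fun x => f x / g x) :=
  Primrec.nat_div.comp h h'
@[fun_prop] theorem mod {f g : α → ℕ} (h : PR f) (h' : PR g) : PR (fun x => f x % g x) :=
  Primrec.nat_mod.comp h h'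
@[fun_prop] theorem pair {f g : α → ℕ} (h : PR f) (h' : PR g) : PR (fun x => Nat.pair (f x) (g x)) :=
  Primrec₂.natPair.comp h h'
@[fun_prop] theorem unpair {f : α → ℕ} (h : PR f) : PR (fun x => Nat.unpair (f x)) :=
  Primrec.unpair.comp h
@[fun_prop] theorem nat_rec {f : α → ℕ} {g : α → β} {k : α → ℕ → β → β} (hf : PR f) (hg : PR g)
    (hk : PR fun x : α × ℕ × β => k x.1 x.2.1 x.2.2) :
    PR (fun x => Nat.rec (motive := fun _ => β) (g x) (k x) (f x)) :=
  Primrec.nat_rec' hf hg (h := fun x q => k x q.1 q.2) hk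
@[fun_prop] theorem pow {f g : α → ℕ} (h : PR f) (h' : PR g) : PR (fun x => f x ^ g x) := by
  have : PR (fun x => Nat.rec (motive := fun _ => ℕ) 1 (fun _ y => y * f x) (g x)) :=
    nat_rec (k := fun x _ y => y * f x) h' (const 1) (by fun_prop)
  refine Primrec.of_eq this fun x => ?_
  induction g x with
  | zero => simp
  | succ n ih => simpa [pow_succ] using congrArg (· * f x) ih
@[fun_prop] theorem cond {c : α → Bool} {f g : α → β} (hc : PR c) (h : PR f) (h' : PR g) :
    PR (fun x => bif c x then f x else g x) := Primrec.cond hc h h'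
@[fun_prop] theorem and {f g : α → Bool} (h : PR f) (h' : PR g) : PR (fun x => f x && g x) :=
  Primrec.and.comp h h'
@[fun_prop] theorem or {f g : α → Bool} (h : PR f) (h' : PR g) : PR (fun x => f x || g x) :=
  Primrec.or.comp h h'
@[fun_prop] theorem not {f : α → Bool} (h : PR f) : PR (fun x => !f x) := Primrec.not.comp h
@[fun_prop] theorem beq {f g : α → ℕ} (h : PR f) (h' : PR g) : PR (fun x => Nat.beq (f x) (g x)) :=
  Primrec.of_eq (Primrec.beq.comp h h') fun x => by
    rw [Bool.eq_iff_iff]; simp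
@[fun_prop] theorem ble {f g : α → ℕ} (h : PR f) (h' : PR g) : PR (fun x => Nat.ble (f x) (g x)) :=
  Primrec.of_eq (Primrec.nat_le.decide.comp h h') fun x => by
    rw [Bool.eq_iff_iff]; simp
@[fun_prop] theorem blt {f g : α → ℕ} (h : PR f) (h' : PR g) : PR (fun x => Nat.blt (f x) (g x)) :=
  ble (add h (const 1)) h'
@[fun_prop] theorem cons {f : α → β} {g : α → List β} (h : PR f) (h' : PR g) :
    PR (fun x => f x :: g x) := Primrec.list_cons.comp h h'
@[fun_prop] theorem append {f g : α → List β} (h : PR f) (h' : PR g) :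
    PR (fun x => f x ++ g x) := Primrec.list_append.comp h h'
@[fun_prop] theorem length {f : α → List β} (h : PR f) : PR (fun x => (f x).length) :=
  Primrec.list_length.comp h
@[fun_prop] theorem getD {f : α → List β} {g : α → ℕ} {d : β} (h : PR f) (h' : PR g) :
    PR (fun x => (f x).getD (g x) d) := (Primrec.list_getD d).comp h h'
@[fun_prop] theorem decodeList {f : α → ℕ} (h : PR f) :
    PR (fun x => Denumerable.ofNat (List ℕ) (f x)) := (Primrec.ofNat (List ℕ)).comp h
@[fun_prop] theorem ball {n : α → ℕ} {f : α → ℕ → Bool} (h : PR n)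
    (h' : PR (fun x : α × ℕ => f x.1 x.2)) : PR (fun x => ball (n x) (f x)) :=
  nat_rec (k := fun x i acc => acc && f x i) h (const true)
    (and (by fun_prop) (comp (f := fun x : α × ℕ => f x.1 x.2) (g := fun x : α × ℕ × Bool =>
      (x.1, x.2.1)) h' (by fun_prop)))
@[fun_prop] theorem bex {n : α → ℕ} {f : α → ℕ → Bool} (h : PR n)
    (h' : PR (fun x : α × ℕ => f x.1 x.2)) : PR (fun x => bex (n x) (f x)) :=
  not (ball (f := fun x i => !f x i) h (not h'))
@[fun_prop] theorem lfind {l : α → List ℕ} {p : α → ℕ → Bool} (h : PR l)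
    (h' : PR (fun x : α × ℕ => p x.1 x.2)) : PR (fun x => lfind (l x) (p x)) := by
  refine Primrec.list_foldr (f := l) (g := fun _ => 0)
    (h := fun x (q : ℕ × ℕ) => bif p x q.1 then q.1 + 1 else q.2) h (const 0) ?_
  have : PR (fun x : α × ℕ × ℕ => p x.1 x.2.1) :=
    comp (f := fun x : α × ℕ => p x.1 x.2) (g := fun x : α × ℕ × ℕ => (x.1, x.2.1)) h' (by fun_prop)
  exact cond this (by fun_prop) (by fun_prop)
@[fun_prop] theorem lmem {a : α → ℕ} {l : α → List ℕ} (h : PR a) (h' : PR l) :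
    PR (fun x => lmem (a x) (l x)) := by
  have : PR (fun x => !Nat.beq (HyTime.lfind (l x) (fun c => Nat.beq c (a x))) 0) := by fun_prop
  exact this
@[fun_prop] theorem srec {n : α → ℕ} {g : α → List Bool → Bool} (h : PR n)
    (h' : PR (fun x : α × List Bool => g x.1 x.2)) : PR (fun x => srec (g x) (n x)) := by
  have h3 : PR (fun x : α × ℕ × List Bool => g x.1 x.2.2) :=
    comp (f := fun x : α × List Bool => g x.1 x.2) (g := fun x : α × ℕ × List Bool => (x.1, x.2.2))
      h' (by fun_prop)
  have ht : PR (fun x => srecTable (g x) (n x)) :=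
    nat_rec (k := fun x _ l => l ++ [g x l]) h (const []) (append (by fun_prop) (cons h3 (const [])))
  exact comp (f := fun x : α × List Bool => g x.1 x.2) (g := fun x => (x, srecTable (g x) (n x)))
    h' (by fun_prop)

end PR

theorem lfind_eq_zero {l : List ℕ} {p : ℕ → Bool} : lfind l p = 0 ↔ ∀ a ∈ l, p a = false := by
  induction l with
  | nil => simp [lfind]
  | cons a l ih =>
    change (bif p a then a + 1 else lfind l p) = 0 ↔ _
    cases h : p a <;> simp [h, ih]

@[simp] theorem lmem_iff {a : ℕ} {l : List ℕ} : lmem a l = true ↔ a ∈ l := by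
  rw [lmem, Bool.not_eq_true', ← Bool.not_eq_true, Nat.beq_eq, lfind_eq_zero]
  push Not
  constructor
  · rintro ⟨c, hc, h⟩
    have : c = a := by simpa using h
    exact this ▸ hc
  · exact fun h => ⟨a, h, by simp⟩

theorem lfind_eq {l : List ℕ} {p : ℕ → Bool} :
    lfind l p = match l.find? p with | none => 0 | some a => a + 1 := by
  induction l with
  | nil => simp [lfind]
  | cons a l ih =>
    change (bif p a then a + 1 else lfind l p) = _
    cases h : p a <;> simp [h, ih]

theorem ofNat_encList (l : List ℕ) : Denumerable.ofNat (List ℕ) (encList id l) = l := by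
  have : encList id l = Encodable.encode l := by
    induction l with
    | nil => rfl
    | cons a l ih => simp [encList, ih]
  rw [this, Denumerable.ofNat_encode]

theorem encList_map {α : Type} (f : α → ℕ) (l : List α) : encList f l = encList id (l.map f) := by
  induction l with
  | nil => rfl
  | cons a l ih => simp [encList, ih]

theorem ofNat_encList_map {α : Type} (f : α → ℕ) (l : List α) :
    Denumerable.ofNat (List ℕ) (encList f l) = l.map f := by
  rw [encList_map, ofNat_encList]

end HyTime

namespace HyTime

/-! ### Decoding clock constraints -/

theorem unpair_snd_lt {n : ℕ} (h : n.unpair.1 ≠ 0) : n.unpair.2 < n := by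
  obtain ⟨a, b, rfl⟩ : ∃ a b, n = Nat.pair a b := ⟨_, _, (Nat.pair_unpair n).symm⟩
  rw [Nat.unpair_pair] at h ⊢
  simp only at h ⊢
  have := Nat.add_le_pair a b
  omega

theorem unpair_snd_fst_lt {n : ℕ} (h : n.unpair.1 ≠ 0) : n.unpair.2.unpair.1 < n :=
  (Nat.unpair_left_le _).trans_lt (unpair_snd_lt h)

theorem unpair_snd_snd_lt {n : ℕ} (h : n.unpair.1 ≠ 0) : n.unpair.2.unpair.2 < n :=
  (Nat.unpair_right_le _).trans_lt (unpair_snd_lt h)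

def decCmp : ℕ → Cmp
  | 0 => .lt
  | 1 => .le
  | 2 => .eq
  | 3 => .ge
  | _ => .gt

/-- Total decoding of clock constraints. -/
def decClk (n : ℕ) : ClkC ℕ :=
  if h : n.unpair.1 = 0 then .atom (decCmp n.unpair.2.unpair.1) n.unpair.2.unpair.2
  else
    have := unpair_snd_fst_lt h
    have := unpair_snd_snd_lt h
    if n.unpair.1 = 1 then .disj (decClk n.unpair.2.unpair.1) (decClk n.unpair.2.unpair.2)
    else .conj (decClk n.unpair.2.unpair.1) (decClk n.unpair.2.unpair.2)

theorem decClk_enc (g : ClkC ℕ) : decClk (encClkC g) = g := by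
  induction g with
  | atom c k =>
    rw [encClkC, decClk]
    simp only [Nat.unpair_pair, dite_true]
    cases c <;> rfl
  | disj a b iha ihb =>
    rw [encClkC, decClk]
    simp [iha, ihb]
  | conj a b iha ihb =>
    rw [encClkC, decClk]
    simp [iha, ihb]

def clkStep (G w : ℕ) (l : List Bool) : Bool :=
  bif Nat.beq l.length.unpair.1 0 then
    bif Nat.beq l.length.unpair.2.unpair.1 0 then Nat.blt w (l.length.unpair.2.unpair.2 * G)
    else bif Nat.beq l.length.unpair.2.unpair.1 1 then Nat.ble w (l.length.unpair.2.unpair.2 * G)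
    else bif Nat.beq l.length.unpair.2.unpair.1 2 then Nat.beq w (l.length.unpair.2.unpair.2 * G)
    else bif Nat.beq l.length.unpair.2.unpair.1 3 then Nat.ble (l.length.unpair.2.unpair.2 * G) w
    else Nat.blt (l.length.unpair.2.unpair.2 * G) w
  else bif Nat.beq l.length.unpair.1 1 then
    l.getD l.length.unpair.2.unpair.1 false || l.getD l.length.unpair.2.unpair.2 false
  else l.getD l.length.unpair.2.unpair.1 false && l.getD l.length.unpair.2.unpair.2 false

/-- Evaluation of a coded clock constraint at the value `w / G`. -/
def clkN (G w code : ℕ) : Bool := srec (clkStep G w) code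

@[fun_prop] theorem PR.clkN {α : Type} [Primcodable α] {G w c : α → ℕ} (hG : PR G) (hw : PR w)
    (hc : PR c) : PR fun x => clkN (G x) (w x) (c x) := by
  have : PR fun x : α × List Bool => clkStep (G x.1) (w x.1) x.2 := by
    unfold clkStep
    fun_prop
  unfold HyTime.clkN
  fun_prop

theorem clkN_iff {G : ℕ} (hG : 0 < G) (w n : ℕ) :
    clkN G w n = true ↔ (decClk n).holds natR ((w : ℝ) / G) := by
  have hG' : (0 : ℝ) < G := by exact_mod_cast hG
  induction n using Nat.strong_induction_on with
  | _ n ih =>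
    rw [clkN, srec, clkStep, srecTable_length, decClk]
    by_cases h0 : n.unpair.1 = 0
    · rw [dif_pos h0, h0]
      simp only [Nat.beq_refl, cond_true]
      generalize n.unpair.2.unpair.2 = k
      have e1 : ((w : ℝ) / G < (k : ℝ)) ↔ w < k * G := by
        rw [div_lt_iff₀ hG']; exact_mod_cast Iff.rfl
      have e2 : ((w : ℝ) / G ≤ (k : ℝ)) ↔ w ≤ k * G := by
        rw [div_le_iff₀ hG']; exact_mod_cast Iff.rfl
      have e3 : ((w : ℝ) / G = (k : ℝ)) ↔ w = k * G := by
        rw [div_eq_iff hG'.ne']; exact_mod_cast Iff.rfl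
      have e4 : ((k : ℝ) ≤ (w : ℝ) / G) ↔ k * G ≤ w := by
        rw [le_div_iff₀ hG']; exact_mod_cast Iff.rfl
      have e5 : ((k : ℝ) < (w : ℝ) / G) ↔ k * G < w := by
        rw [lt_div_iff₀ hG']; exact_mod_cast Iff.rfl
      rcases n.unpair.2.unpair.1 with _ | _ | _ | _ | m
      · simp [decCmp, ClkC.holds, Cmp.denote, natR, e1, Nat.blt]
      · simp [decCmp, ClkC.holds, Cmp.denote, natR, e2]
      · simp [decCmp, ClkC.holds, Cmp.denote, natR, e3]
      · simp [decCmp, ClkC.holds, Cmp.denote, natR, e4]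
      · simp [decCmp, ClkC.holds, Cmp.denote, natR, e5, Nat.blt]
    · rw [dif_neg h0, srecTable_getD _ (unpair_snd_fst_lt h0),
        srecTable_getD _ (unpair_snd_snd_lt h0)]
      have i1 := ih _ (unpair_snd_fst_lt h0)
      have i2 := ih _ (unpair_snd_snd_lt h0)
      rw [clkN] at i1 i2
      have e0 : Nat.beq n.unpair.1 0 = false := by
        rw [← Bool.not_eq_true, Nat.beq_eq]; exact h0
      rw [e0, cond_false]
      by_cases h1 : n.unpair.1 = 1
      · rw [if_pos h1, h1]
        simp [ClkC.holds, i1, i2]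
      · have e1 : Nat.beq n.unpair.1 1 = false := by
          rw [← Bool.not_eq_true, Nat.beq_eq]; exact h1
        rw [if_neg h1, e1]
        simp [ClkC.holds, i1, i2]

theorem holds_congr {v v' : ℝ} (h : ∀ z : ℤ, v ≤ z ↔ v' ≤ z) (h' : ∀ z : ℤ, z ≤ v ↔ z ≤ v')
    (g : ClkC ℕ) : g.holds natR v ↔ g.holds natR v' := by
  induction g with
  | atom c k =>
    have h1 := h k
    have h2 := h' k
    push_cast at h1 h2
    cases c <;> simp only [ClkC.holds, Cmp.denote, natR]
    · rw [← not_le, ← not_le, h2]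
    · exact h1
    · rw [le_antisymm_iff, le_antisymm_iff, h1, h2]
    · exact h2
    · rw [← not_le, ← not_le, h1]
  | disj a b iha ihb => simp only [ClkC.holds, iha, ihb]
  | conj a b iha ihb => simp only [ClkC.holds, iha, ihb]

/-! ### First-order formulas over signals -/

/-- First-order formulas over a tuple of signals with de Bruijn time variables. The parameter
is a triple consisting of the code of an automaton, a clock and the code of a constraint. -/
inductive Fo : Type
  | rel (Q : ℕ × ℕ × ℕ → ℕ → ℕ → Bool)
      (hQ : PR fun x : (ℕ × ℕ × ℕ) × ℕ × ℕ => Q x.1 x.2.1 x.2.2) (a i b j : ℕ)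
  | lt (i j : ℕ)
  | zero (i : ℕ)
  | clk (i j : ℕ)
  | neg (F : Fo)
  | imp (F G : Fo)
  | all (F : Fo)

namespace Fo

def rank : Fo → ℕ
  | rel _ _ _ _ _ _ => 0
  | lt _ _ => 0
  | zero _ => 0
  | clk _ _ => 0
  | neg F => F.rank
  | imp F G => max F.rank G.rank
  | all F => F.rank + 1

/-- Semantics over the reals in `[0, N)`. -/
def evalR (N : ℕ) (p : ℕ × ℕ × ℕ) (S : ℕ → ℝ → ℕ) : Fo → (ℕ → ℝ) → Prop
  | rel Q _ a i b j, τ => Q p (S a (τ i)) (S b (τ j)) = true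
  | lt i j, τ => τ i < τ j
  | zero i, τ => τ i = 0
  | clk i j, τ => τ j ≤ τ i ∧ (decClk p.2.2).holds natR (τ i - τ j)
  | neg F, τ => ¬ evalR N p S F τ
  | imp F G, τ => evalR N p S F τ → evalR N p S G τ
  | all F, τ => ∀ t : ℝ, 0 ≤ t → t < N → evalR N p S F (push t τ)

/-- Semantics over the grid, where the variables quantified at level `k` range over
multiples of `B ^ (K - (k + 1))`. -/
def evalN (N B K : ℕ) (p : ℕ × ℕ × ℕ) (rd : ℕ → ℕ → ℕ) : Fo → ℕ → List ℕ → Bool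
  | rel Q _ a i b j, _, l => Q p (rd a (l.getD i 0)) (rd b (l.getD j 0))
  | lt i j, _, l => Nat.blt (l.getD i 0) (l.getD j 0)
  | zero i, _, l => Nat.beq (l.getD i 0) 0
  | clk i j, _, l => Nat.ble (l.getD j 0) (l.getD i 0) &&
      clkN (B ^ K) (l.getD i 0 - l.getD j 0) p.2.2
  | neg F, k, l => !evalN N B K p rd F k l
  | imp F G, k, l => !evalN N B K p rd F k l || evalN N B K p rd G k l
  | all F, k, l => ball (N * B ^ K) fun q =>
      !Nat.beq (q % B ^ (K - (k + 1))) 0 || evalN N B K p rd F (k + 1) (q :: l)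

@[fun_prop]
theorem pr_evalN (F : Fo) {α : Type} [Primcodable α] {N B K k : α → ℕ} {p : α → ℕ × ℕ × ℕ}
    {rd : α → ℕ → ℕ → ℕ} {l : α → List ℕ} (hN : PR N) (hB : PR B) (hK : PR K) (hp : PR p)
    (hrd : PR fun x : α × ℕ × ℕ => rd x.1 x.2.1 x.2.2) (hk : PR k) (hl : PR l) :
    PR fun x => evalN (N x) (B x) (K x) (p x) (rd x) F (k x) (l x) := by
  induction F generalizing α with
  | rel Q hQ a i b j =>
    have h1 : ∀ a i, PR fun x => rd x a ((l x).getD i 0) := fun a i =>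
      PR.comp (f := fun x : α × ℕ × ℕ => rd x.1 x.2.1 x.2.2)
        (g := fun x => (x, a, (l x).getD i 0)) hrd (by fun_prop)
    exact PR.comp (f := fun x : (ℕ × ℕ × ℕ) × ℕ × ℕ => Q x.1 x.2.1 x.2.2)
      (g := fun x => (p x, rd x a ((l x).getD i 0), rd x b ((l x).getD j 0))) hQ
      (hp.mk ((h1 a i).mk (h1 b j)))
  | lt i j => unfold evalN; fun_prop
  | zero i => unfold evalN; fun_prop
  | clk i j => unfold evalN; fun_prop
  | neg F ih => exact (ih hN hB hK hp hrd hk hl).not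
  | imp F G ih ih' => exact (ih hN hB hK hp hrd hk hl).not.or (ih' hN hB hK hp hrd hk hl)
  | all F ih =>
    have := ih (α := α × ℕ) (N := fun x => N x.1) (B := fun x => B x.1) (K := fun x => K x.1)
      (p := fun x => p x.1) (rd := fun x => rd x.1) (k := fun x => k x.1 + 1)
      (l := fun x => x.2 :: l x.1) (by fun_prop) (by fun_prop) (by fun_prop) (by fun_prop)
      (PR.comp (f := fun x : α × ℕ × ℕ => rd x.1 x.2.1 x.2.2)
        (g := fun x : (α × ℕ) × ℕ × ℕ => (x.1.1, x.2.1, x.2.2)) hrd (by fun_prop))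
      (by fun_prop) (by fun_prop)
    unfold evalN
    exact PR.ball (f := fun x q => !Nat.beq (q % B x ^ (K x - (k x + 1))) 0 ||
      evalN (N x) (B x) (K x) (p x) (rd x) F (k x + 1) (q :: l x)) (by fun_prop)
      (PR.or (by fun_prop) this)

variable {b N B K : ℕ}

theorem evalR_congr [Inhabited (Fin b)] {p : ℕ × ℕ × ℕ} (F : Fo) {r : ℕ} (hr : F.rank ≤ r)
    {S S' : ℕ → ℝ → Fin b} {τ τ' : ℕ → ℝ} (h : BF N r S τ S' τ') :
    evalR N p (fun i t => S i t) F τ ↔ evalR N p (fun i t => S' i t) F τ' := by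
  induction F generalizing r τ τ' with
  | rel Q hQ a i b j => simp only [evalR, h.letter]
  | lt i j =>
    have := h.diff_le_iff j i 0
    simp only [Int.cast_zero, sub_nonpos] at this
    simp only [evalR]
    rw [← not_le, ← not_le, this]
  | zero i => exact h.eq_zero_iff i
  | clk i j =>
    have h1 := h.diff_le_iff j i 0
    simp only [Int.cast_zero, sub_nonpos] at h1
    simp only [evalR]
    rw [h1]
    refine and_congr_right fun _ => holds_congr (fun z => h.diff_le_iff i j z) (fun z => ?_) _
    have := h.diff_le_iff j i (-z)
    push_cast at this
    constructor
    · intro hz; linarith [this.1 (by linarith)]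
    · intro hz; linarith [this.2 (by linarith)]
  | neg F ih => exact not_congr (ih hr h)
  | imp F G ih ih' =>
    rw [rank, max_le_iff] at hr
    exact imp_congr (ih hr.1 h) (ih' hr.2 h)
  | all F ih =>
    cases r with
    | zero => simp [rank] at hr
    | succ r =>
      rw [rank, Nat.succ_le_succ_iff] at hr
      constructor
      · intro hh t h0 ht
        obtain ⟨t', h0', ht', hbf⟩ := h.symm.step_time h0 ht
        exact (ih hr hbf.symm).1 (hh t' h0' ht')
      · intro hh t h0 ht
        obtain ⟨t', h0', ht', hbf⟩ := h.step_time h0 ht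
        exact (ih hr hbf).2 (hh t' h0' ht')

theorem evalR_iff_evalN [Inhabited (Fin b)] (hB : Fine (Fin b) N K B) (hB0 : 0 < B)
    {p : ℕ × ℕ × ℕ} (F : Fo) {k : ℕ} (hk : k + F.rank ≤ K) {S : ℕ → ℝ → Fin b} {τ : ℕ → ℝ}
    {l : List ℕ} {rd : ℕ → ℕ → ℕ} (hl : ∀ i, τ i * (B : ℝ) ^ K = l.getD i 0)
    (hrd : ∀ i q, q < N * B ^ K → rd i q = S i ((q : ℝ) / (B : ℝ) ^ K)) (h : Cfg N B k S τ) :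
    evalR N p (fun i t => S i t) F τ ↔ evalN N B K p rd F k l = true := by
  have hBR : (0 : ℝ) < (B : ℝ) ^ K := by positivity
  have hτ : ∀ {τ : ℕ → ℝ} {l : List ℕ}, (∀ i, τ i * (B : ℝ) ^ K = l.getD i 0) →
      ∀ i, τ i = (l.getD i 0 : ℝ) / (B : ℝ) ^ K := fun h i => by
    rw [eq_div_iff hBR.ne', h]
  induction F generalizing k τ l with
  | rel Q hQ a i b j =>
    have hlt : ∀ i, l.getD i 0 < N * B ^ K := fun i => by
      have h1 := mul_lt_mul_of_pos_right (h.lt i) hBR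
      rw [hl] at h1
      exact_mod_cast h1
    simp only [evalR, evalN]
    rw [hrd a _ (hlt i), hrd b _ (hlt j), hτ hl i, hτ hl j]
  | lt i j =>
    simp only [evalR, evalN]
    rw [hτ hl i, hτ hl j, div_lt_div_iff_of_pos_right hBR, Nat.cast_lt, Nat.blt_eq]
  | zero i =>
    simp only [evalR, evalN]
    rw [hτ hl i, Nat.beq_eq, div_eq_zero_iff, or_iff_left hBR.ne', Nat.cast_eq_zero]
  | clk i j =>
    simp only [evalR, evalN]
    rw [hτ hl i, hτ hl j, div_le_div_iff_of_pos_right hBR, Nat.cast_le, Bool.and_eq_true,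
      Nat.ble_eq, clkN_iff (by positivity)]
    refine and_congr_right fun hle => ?_
    rw [Nat.cast_sub hle, sub_div, Nat.cast_pow]
  | neg F ih =>
    simp only [evalR, evalN, Bool.not_eq_true', ← Bool.not_eq_true]
    exact not_congr (ih hk hl h)
  | imp F G ih ih' =>
    rw [rank] at hk
    simp only [evalR, evalN, Bool.or_eq_true, Bool.not_eq_true', ← Bool.not_eq_true,
      ← ih (k := k) (by omega) hl h, ← ih' (k := k) (by omega) hl h]
    tauto
  | all F ih =>
    rw [rank] at hk
    have hpow : (B : ℝ) ^ K = (B : ℝ) ^ (k + 1) * (B : ℝ) ^ (K - (k + 1)) := by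
      rw [← pow_add]; congr 1; omega
    have hpush : ∀ {t : ℝ} {q : ℕ}, t * (B : ℝ) ^ K = q →
        ∀ i, push t τ i * (B : ℝ) ^ K = (q :: l).getD i 0 := fun ht i => by
      cases i with
      | zero => exact ht
      | succ i => exact hl i
    simp only [evalR, evalN, ball_iff, Bool.or_eq_true, Bool.not_eq_true', ← Bool.not_eq_true,
      Nat.beq_eq]
    constructor
    · intro hh q hq
      rw [← imp_iff_not_or]
      intro hd
      obtain ⟨m, hm⟩ := Nat.dvd_of_mod_eq_zero hd
      have hq0 : (q : ℝ) / (B : ℝ) ^ K * (B : ℝ) ^ K = q := by field_simp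
      have h0 : 0 ≤ (q : ℝ) / (B : ℝ) ^ K := by positivity
      have h1 : (q : ℝ) / (B : ℝ) ^ K < N := by
        rw [div_lt_iff₀ hBR]; exact_mod_cast hq
      refine (ih (k := k + 1) (by omega) (hpush hq0) (h.time_push hB0 h0 h1 (q := m) ?_)).1
        (hh _ h0 h1)
      rw [hm, hpow]
      push_cast
      field_simp
    · intro hh t h0 ht
      obtain ⟨t', hc, hbf⟩ := h.time_down hB (r := F.rank) (by omega) h0 ht
      rw [evalR_congr F le_rfl hbf]
      obtain ⟨m, hm⟩ := hc.exists_grid hB0 0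
      rw [push_zero] at hm
      have hq : t' * (B : ℝ) ^ K = (m * B ^ (K - (k + 1)) : ℕ) := by
        rw [hpow, ← mul_assoc, hm]; push_cast; rfl
      refine (ih (k := k + 1) (by omega) (hpush hq) hc).2 ?_
      have hlt : m * B ^ (K - (k + 1)) < N * B ^ K := by
        have := mul_lt_mul_of_pos_right (hc.lt 0) hBR
        rw [push_zero, hq] at this
        exact_mod_cast this
      exact (hh _ hlt).resolve_left (not_not.2 (Nat.mul_mod_left _ _))

end Fo

end HyTime

namespace HyTime

/-! ### Codes of automata and letters -/

def initC (a v : ℕ) : Bool := lmem v (Denumerable.ofNat (List ℕ) a.unpair.2.unpair.1)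
def clocksC (a x : ℕ) : Bool :=
  lmem x (Denumerable.ofNat (List ℕ) a.unpair.2.unpair.2.unpair.2.unpair.1)
def labelC (a p v : ℕ) : Bool :=
  lmem p (Denumerable.ofNat (List ℕ) (lfind (Denumerable.ofNat (List ℕ)
    a.unpair.2.unpair.2.unpair.2.unpair.2.unpair.1) (fun q => Nat.beq q.unpair.1 v) - 1).unpair.2)
def betaFind (a v x : ℕ) : ℕ := lfind (Denumerable.ofNat (List ℕ)
    a.unpair.2.unpair.2.unpair.2.unpair.2.unpair.2.unpair.1)
    (fun q => Nat.beq q.unpair.1 (Nat.pair v x))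
def betaC (a v x g : ℕ) : Bool := !Nat.beq (betaFind a v x) 0 &&
  Nat.beq (betaFind a v x - 1).unpair.2 g
def edgeC (a k : ℕ) : Bool := lmem (k - 1) (Denumerable.ofNat (List ℕ)
  a.unpair.2.unpair.2.unpair.2.unpair.2.unpair.2.unpair.2.unpair.1)
def finalC (a v : ℕ) : Bool := lmem v (Denumerable.ofNat (List ℕ)
  a.unpair.2.unpair.2.unpair.2.unpair.2.unpair.2.unpair.2.unpair.2)
def srcC (k : ℕ) : ℕ := (k - 1).unpair.1
def dstC (k : ℕ) : ℕ := (k - 1).unpair.2.unpair.1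
def guardC (x g k : ℕ) : Bool :=
  lmem (Nat.pair x g) (Denumerable.ofNat (List ℕ) (k - 1).unpair.2.unpair.2.unpair.1)
def resetC (x k : ℕ) : Bool :=
  !Nat.beq k 0 && lmem x (Denumerable.ofNat (List ℕ) (k - 1).unpair.2.unpair.2.unpair.2)

/-- The letter of a living time point: its state, and the edges that are taken immediately
before and after it. -/
def mkL (v i o : ℕ) : ℕ := Nat.pair v (Nat.pair i o) + 1
def stL (l : ℕ) : ℕ := (l - 1).unpair.1
def evL (b : Bool) (l : ℕ) : ℕ := bif b then (l - 1).unpair.2.unpair.2 else (l - 1).unpair.2.unpair.1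

@[simp] theorem stL_mkL (v i o : ℕ) : stL (mkL v i o) = v := by simp [stL, mkL]
@[simp] theorem evL_mkL (b : Bool) (v i o : ℕ) : evL b (mkL v i o) = bif b then o else i := by
  simp [evL, mkL]
@[simp] theorem evL_zero (b : Bool) : evL b 0 = 0 := by cases b <;> simp [evL]

section
variable {α : Type} [Primcodable α] {a v x g k : α → ℕ}

@[fun_prop] theorem PR.initC (ha : PR a) (hv : PR v) : PR fun y => initC (a y) (v y) := by
  unfold HyTime.initC; fun_prop
@[fun_prop] theorem PR.clocksC (ha : PR a) (hv : PR v) : PR fun y => clocksC (a y) (v y) := by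
  unfold HyTime.clocksC; fun_prop
@[fun_prop] theorem PR.labelC (ha : PR a) (hx : PR x) (hv : PR v) :
    PR fun y => labelC (a y) (x y) (v y) := by
  unfold HyTime.labelC; fun_prop
@[fun_prop] theorem PR.betaFind (ha : PR a) (hv : PR v) (hx : PR x) :
    PR fun y => betaFind (a y) (v y) (x y) := by
  unfold HyTime.betaFind; fun_prop
@[fun_prop] theorem PR.betaC (ha : PR a) (hv : PR v) (hx : PR x) (hg : PR g) :
    PR fun y => betaC (a y) (v y) (x y) (g y) := by
  unfold HyTime.betaC; fun_prop
@[fun_prop] theorem PR.edgeC (ha : PR a) (hk : PR k) : PR fun y => edgeC (a y) (k y) := by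
  unfold HyTime.edgeC; fun_prop
@[fun_prop] theorem PR.finalC (ha : PR a) (hk : PR k) : PR fun y => finalC (a y) (k y) := by
  unfold HyTime.finalC; fun_prop
@[fun_prop] theorem PR.srcC (hk : PR k) : PR fun y => srcC (k y) := by
  unfold HyTime.srcC; fun_prop
@[fun_prop] theorem PR.dstC (hk : PR k) : PR fun y => dstC (k y) := by
  unfold HyTime.dstC; fun_prop
@[fun_prop] theorem PR.guardC (hx : PR x) (hg : PR g) (hk : PR k) :
    PR fun y => guardC (x y) (g y) (k y) := by
  unfold HyTime.guardC; fun_prop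
@[fun_prop] theorem PR.resetC (hx : PR x) (hk : PR k) : PR fun y => resetC (x y) (k y) := by
  unfold HyTime.resetC; fun_prop
@[fun_prop] theorem PR.stL (hk : PR k) : PR fun y => stL (k y) := by
  unfold HyTime.stL; fun_prop
@[fun_prop] theorem PR.evL {b : Bool} (hk : PR k) : PR fun y => evL b (k y) := by
  unfold HyTime.evL; fun_prop

end

theorem succ_beq_zero (n : ℕ) : (n + 1).beq 0 = false := rfl

theorem encClkC_injective : Function.Injective encClkC :=
  Function.LeftInverse.injective decClk_enc

theorem encList_injective {α : Type} {f : α → ℕ} (hf : Function.Injective f) :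
    Function.Injective (encList f) := fun l l' h => by
  have := congrArg (Denumerable.ofNat (List ℕ)) h
  rw [ofNat_encList_map, ofNat_encList_map] at this
  exact List.map_injective_iff.2 hf this

theorem pair_encClkC_injective :
    Function.Injective fun q : ℕ × ClkC ℕ => Nat.pair q.1 (encClkC q.2) := fun q q' h => by
  obtain ⟨h1, h2⟩ := Nat.pair_eq_pair.1 h
  exact Prod.ext h1 (encClkC_injective h2)

theorem encIEdge_injective : Function.Injective encIEdge := fun e e' h => by
  obtain ⟨e1, e2, e3, e4⟩ := e
  obtain ⟨f1, f2, f3, f4⟩ := e'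
  simp only [encIEdge, Nat.pair_eq_pair] at h
  obtain ⟨rfl, rfl, h3, h4⟩ := h
  rw [encList_injective pair_encClkC_injective h3,
    encList_injective Function.injective_id h4]

section
variable (A : TA ℕ) (v x k p : ℕ) (g : ℕ) (c : ClkC ℕ) (e : IEdge ℕ)

@[simp] theorem initC_enc : initC (encTA A) v = true ↔ v ∈ A.init := by
  simp [initC, encTA, ofNat_encList]
@[simp] theorem clocksC_enc : clocksC (encTA A) v = true ↔ v ∈ A.clocks := by
  simp [clocksC, encTA, ofNat_encList]
@[simp] theorem finalC_enc : finalC (encTA A) v = true ↔ v ∈ A.final := by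
  simp [finalC, encTA, ofNat_encList]
@[simp] theorem edgeC_enc : edgeC (encTA A) (k + 1) = true ↔ ∃ e ∈ A.edges, encIEdge e = k := by
  simp [edgeC, encTA, ofNat_encList_map, -Prod.exists]
@[simp] theorem srcC_enc : srcC (encIEdge e + 1) = e.1 := by simp [srcC, encIEdge]
@[simp] theorem dstC_enc : dstC (encIEdge e + 1) = e.2.1 := by simp [dstC, encIEdge]
@[simp] theorem guardC_enc :
    guardC x g (encIEdge e + 1) = true ↔ ∃ c, (x, c) ∈ e.2.2.1 ∧ encClkC c = g := by
  simp only [guardC, encIEdge, encGuard, Nat.add_sub_cancel, Nat.unpair_pair,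
    ofNat_encList_map, lmem_iff, List.mem_map, Nat.pair_eq_pair]
  constructor
  · rintro ⟨⟨y, c⟩, h, rfl, rfl⟩; exact ⟨c, h, rfl⟩
  · rintro ⟨c, h, rfl⟩; exact ⟨(x, c), h, rfl, rfl⟩
@[simp] theorem resetC_enc : resetC x (encIEdge e + 1) = true ↔ x ∈ e.2.2.2 := by
  simp [resetC, encIEdge, ofNat_encList, succ_beq_zero]
@[simp] theorem resetC_zero : resetC x 0 = false := by simp [resetC]

theorem lookup_eq_find {β : Type} (l : List (ℕ × β)) (v : ℕ) :
    l.lookup v = (l.find? fun q => Nat.beq q.1 v).map (·.2) := by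
  induction l with
  | nil => rfl
  | cons q l ih =>
    obtain ⟨w, y⟩ := q
    rw [List.lookup_cons, List.find?_cons]
    by_cases h : v = w
    · subst h; simp
    · have h1 : (v == w) = false := by simpa using h
      have h2 : Nat.beq w v = false := by
        rw [← Bool.not_eq_true, Nat.beq_eq]; exact fun h' => h h'.symm
      simp only [h1, h2, ih]

@[simp] theorem labelC_enc : labelC (encTA A) p v = true ↔ p ∈ A.labelOf v := by
  simp only [labelC, encTA, Nat.unpair_pair, ofNat_encList_map, lfind_eq, List.find?_map,
    lmem_iff, TA.labelOf, lookup_eq_find, Function.comp_def]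
  cases (A.label.find? fun q => Nat.beq q.1 v) with
  | none => simp
  | some q => simp [ofNat_encList]

theorem betaC_enc : betaC (encTA A) v x g = true ↔ ∃ c, A.betaOf v x = some c ∧ encClkC c = g := by
  have : (fun q : (ℕ × ℕ) × ClkC ℕ => (q.1.1 == v && q.1.2 == x)) =
      fun q => Nat.beq (Nat.pair q.1.1 q.1.2) (Nat.pair v x) := by
    funext q
    rw [Bool.eq_iff_iff]
    simp
  simp only [betaC, betaFind, encTA, Nat.unpair_pair, ofNat_encList_map, lfind_eq, List.find?_map,
    TA.betaOf, Function.comp_def, this]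
  cases (A.beta.find? fun q => Nat.beq (Nat.pair q.1.1 q.1.2) (Nat.pair v x)) with
  | none => simp
  | some q => simp [succ_beq_zero]

end

theorem lt_encList {α : Type} {f : α → ℕ} {l : List α} {a : α} (h : a ∈ l) :
    f a < encList f l := by
  induction l with
  | nil => simp at h
  | cons b l ih =>
    rw [encList]
    rcases List.mem_cons.1 h with rfl | h
    · exact Nat.lt_succ_of_le (Nat.left_le_pair _ _)
    · exact Nat.lt_succ_of_le ((ih h).le.trans (Nat.right_le_pair _ _))

theorem encTA_bounds (A : TA ℕ) : (∀ v ∈ A.init, v < encTA A) ∧ (∀ v ∈ A.clocks, v < encTA A) ∧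
    (∀ q ∈ A.beta, encClkC q.2 < encTA A) ∧ (∀ e ∈ A.edges, encIEdge e < encTA A) := by
  have h1 : ∀ {a b c : ℕ}, a < b → a < Nat.pair b c := fun h =>
    h.trans_le (Nat.left_le_pair _ _)
  have h2 : ∀ {a b c : ℕ}, a < c → a < Nat.pair b c := fun h =>
    h.trans_le (Nat.right_le_pair _ _)
  refine ⟨fun v hv => h2 (h1 (lt_encList (f := id) hv)),
    fun v hv => h2 (h2 (h2 (h1 (lt_encList (f := id) hv)))), fun q hq => ?_, fun e he => ?_⟩
  · refine h2 (h2 (h2 (h2 (h2 (h1 (lt_of_le_of_lt ?_ (lt_encList hq)))))))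
    exact Nat.right_le_pair _ _
  · exact h2 (h2 (h2 (h2 (h2 (h2 (h1 (lt_encList he)))))))

theorem encIEdge_bounds (e : IEdge ℕ) : e.1 ≤ encIEdge e ∧ e.2.1 ≤ encIEdge e ∧
    ∀ q ∈ e.2.2.1, q.1 < encIEdge e ∧ encClkC q.2 < encIEdge e := by
  refine ⟨Nat.left_le_pair _ _, (Nat.left_le_pair _ _).trans (Nat.right_le_pair _ _),
    fun q hq => ?_⟩
  have h : Nat.pair q.1 (encClkC q.2) < encIEdge e :=
    (lt_encList (f := fun q : ℕ × ClkC ℕ => Nat.pair q.1 (encClkC q.2)) hq).trans_le (((Nat.left_le_pair _ _).trans (Nat.right_le_pair _ _)).trans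
      (Nat.right_le_pair _ _))
  exact ⟨(Nat.left_le_pair _ _).trans_lt h, (Nat.right_le_pair _ _).trans_lt h⟩

end HyTime

namespace HyTime

/-- Cuts of the time line: `(t, false)` is immediately before and `(t, true)` immediately
after the point `t`. -/
abbrev Cut := ℝ ×ₗ Bool

def cut (t : ℝ) (b : Bool) : Cut := toLex (t, b)

theorem cut_lt {t u : ℝ} {b c : Bool} : cut t b < cut u c ↔ t < u ∨ t = u ∧ b < c :=
  Prod.Lex.toLex_lt_toLex

/-- The code of the edge taken at a cut, plus one. -/
def ev (s : ℝ → ℕ) (c : Cut) : ℕ := evL (ofLex c).2 (s (ofLex c).1)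

theorem ev_cut (s : ℝ → ℕ) (t : ℝ) (b : Bool) : ev s (cut t b) = evL b (s t) := rfl

/-- The clock `x` is reset at the cut `(t, b)`. -/
def Rst (x : ℕ) (s : ℝ → ℕ) (t : ℝ) (b : Bool) : Prop :=
  (b = false ∧ t = 0) ∨ resetC x (ev s (cut t b)) = true

/-- The last reset of the clock `x` before the cut `c` is at the cut `(r, b)`. -/
def LR (N x : ℕ) (s : ℝ → ℕ) (r : ℝ) (b : Bool) (c : Cut) : Prop :=
  Rst x s r b ∧ cut r b < c ∧ ∀ u : ℝ, 0 ≤ u → u < N → ∀ d : Bool,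
    Rst x s u d → cut u d < c → ¬ cut r b < cut u d

/-- The signal `s` on `[0, N)` is the trace of an accepting execution of the automaton with
code `a`, as far as the constraint with code `g` for the clock `x` is concerned. -/
structure TV (a x g N : ℕ) (s : ℝ → ℕ) : Prop where
  init : ∀ t : ℝ, 0 ≤ t → t < N → t = 0 →
    s t ≠ 0 ∧ initC a (stL (s t)) = true ∧ ev s (cut t false) = 0
  down : ∀ t : ℝ, 0 ≤ t → t < N → ∀ u : ℝ, 0 ≤ u → u < N → t < u → s u ≠ 0 → s t ≠ 0
  state : ∀ t : ℝ, 0 ≤ t → t < N → ∀ u : ℝ, 0 ≤ u → u < N → t < u → s u ≠ 0 →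
    (∀ r : ℝ, 0 ≤ r → r < N → ∀ b : Bool, cut t false < cut r b → ¬ cut u false < cut r b →
      ev s (cut r b) = 0) → stL (s t) = stL (s u)
  edge : ∀ t : ℝ, 0 ≤ t → t < N → ∀ b : Bool, ev s (cut t b) ≠ 0 →
    s t ≠ 0 ∧ edgeC a (ev s (cut t b)) = true
  alive : ∀ t : ℝ, 0 ≤ t → t < N → ev s (cut t true) ≠ 0 →
    ∃ u : ℝ, 0 ≤ u ∧ u < N ∧ t < u ∧ s u ≠ 0
  src : ∀ t : ℝ, 0 ≤ t → t < N → ∀ b : Bool, ev s (cut t b) ≠ 0 → ∀ u : ℝ, 0 ≤ u → u < N →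
    cut u false < cut t b → (∀ r : ℝ, 0 ≤ r → r < N → ∀ d : Bool, cut u false < cut r d →
      cut r d < cut t b → ev s (cut r d) = 0) → stL (s u) = srcC (ev s (cut t b))
  dst : ∀ t : ℝ, 0 ≤ t → t < N → ∀ b : Bool, ev s (cut t b) ≠ 0 → ∀ u : ℝ, 0 ≤ u → u < N →
    ¬ cut u false < cut t b → s u ≠ 0 → (∀ r : ℝ, 0 ≤ r → r < N → ∀ d : Bool,
      cut t b < cut r d → ¬ cut u false < cut r d → ev s (cut r d) = 0) →
    stL (s u) = dstC (ev s (cut t b))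
  guard : ∀ t : ℝ, 0 ≤ t → t < N → ∀ b : Bool, ev s (cut t b) ≠ 0 →
    guardC x g (ev s (cut t b)) = true → ∀ r : ℝ, 0 ≤ r → r < N → ∀ d : Bool,
    LR N x s r d (cut t b) → (decClk g).holds natR (t - r)
  final : ∀ t : ℝ, 0 ≤ t → t < N → s t ≠ 0 → (∀ r : ℝ, 0 ≤ r → r < N → ∀ d : Bool,
    cut t false < cut r d → ev s (cut r d) = 0) → finalC a (stL (s t)) = true
  sep : ∀ t : ℝ, 0 ≤ t → t < N → ∀ u : ℝ, 0 ≤ u → u < N → t < u →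
    ∃ r : ℝ, 0 ≤ r ∧ r < N ∧ t < r ∧ r < u ∧ ev s (cut r false) = 0 ∧ ev s (cut r true) = 0
  inv : ∀ t : ℝ, 0 ≤ t → t < N → s t ≠ 0 → clocksC a x = true → betaC a (stL (s t)) x g = true →
    ∀ r : ℝ, 0 ≤ r → r < N → ∀ d : Bool, LR N x s r d (cut t true) →
    (decClk g).holds natR (t - r)

namespace Fo

def and (F G : Fo) : Fo := neg (imp F (neg G))
def or (F G : Fo) : Fo := imp (neg F) G
def ex (F : Fo) : Fo := neg (all (neg F))
/-- Quantification over both cuts at a time point. -/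
def allC (F : Bool → Fo) : Fo := all (and (F false) (F true))
def un (Q : ℕ × ℕ × ℕ → ℕ → Bool) (hQ : PR fun x : (ℕ × ℕ × ℕ) × ℕ => Q x.1 x.2) (i : ℕ) : Fo :=
  rel (fun p l _ => Q p l) (PR.comp (f := fun x : (ℕ × ℕ × ℕ) × ℕ => Q x.1 x.2)
    (g := fun x : (ℕ × ℕ × ℕ) × ℕ × ℕ => (x.1, x.2.1)) hQ (by fun_prop)) 0 i 0 i
def bin (Q : ℕ × ℕ × ℕ → ℕ → ℕ → Bool)
    (hQ : PR fun x : (ℕ × ℕ × ℕ) × ℕ × ℕ => Q x.1 x.2.1 x.2.2) (i j : ℕ) : Fo := rel Q hQ 0 i 0 j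
def ltc (i : ℕ) (b : Bool) (j : ℕ) (c : Bool) : Fo := bif !b && c then neg (lt j i) else lt i j
def alv (i : ℕ) : Fo := un (fun _ l => !Nat.beq l 0) (by fun_prop) i
def nev (i : ℕ) (b : Bool) : Fo := un (fun _ l => Nat.beq (evL b l) 0) (by fun_prop) i
def rst (i : ℕ) (b : Bool) : Fo :=
  or (bif b then neg (imp (zero i) (zero i)) else zero i)
    (un (fun p l => resetC p.2.1 (evL b l)) (by fun_prop) i)
def lastReset (i : ℕ) (b : Bool) (j : ℕ) (c : Bool) : Fo :=
  and (rst i b) (and (ltc i b j c) (allC fun d => imp (rst 0 d) (imp (ltc 0 d (j + 1) c)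
    (neg (ltc (i + 1) b 0 d)))))

variable {N : ℕ} {p : ℕ × ℕ × ℕ} {S : ℕ → ℝ → ℕ} {τ : ℕ → ℝ}

@[simp] theorem evalR_and {F G : Fo} :
    evalR N p S (and F G) τ ↔ evalR N p S F τ ∧ evalR N p S G τ := by simp [and, evalR]
@[simp] theorem evalR_or {F G : Fo} :
    evalR N p S (or F G) τ ↔ evalR N p S F τ ∨ evalR N p S G τ := by
  simp only [or, evalR]; tauto
@[simp] theorem evalR_imp {F G : Fo} :
    evalR N p S (imp F G) τ ↔ (evalR N p S F τ → evalR N p S G τ) := Iff.rfl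
@[simp] theorem evalR_neg {F : Fo} : evalR N p S (neg F) τ ↔ ¬ evalR N p S F τ := Iff.rfl
@[simp] theorem evalR_lt {i j : ℕ} : evalR N p S (lt i j) τ ↔ τ i < τ j := Iff.rfl
@[simp] theorem evalR_zero {i : ℕ} : evalR N p S (zero i) τ ↔ τ i = 0 := Iff.rfl
@[simp] theorem evalR_clk {i j : ℕ} : evalR N p S (clk i j) τ ↔
    τ j ≤ τ i ∧ (decClk p.2.2).holds natR (τ i - τ j) := Iff.rfl
@[simp] theorem evalR_all {F : Fo} : evalR N p S (all F) τ ↔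
    ∀ t : ℝ, 0 ≤ t → t < N → evalR N p S F (push t τ) := Iff.rfl
@[simp] theorem evalR_ex {F : Fo} : evalR N p S (ex F) τ ↔
    ∃ t : ℝ, 0 ≤ t ∧ t < N ∧ evalR N p S F (push t τ) := by
  simp only [ex, evalR_neg, evalR_all]; push Not; rfl
@[simp] theorem evalR_allC {F : Bool → Fo} : evalR N p S (allC F) τ ↔
    ∀ t : ℝ, 0 ≤ t → t < N → ∀ b, evalR N p S (F b) (push t τ) := by
  simp [allC]
@[simp] theorem evalR_un {Q : ℕ × ℕ × ℕ → ℕ → Bool} {hQ} {i : ℕ} :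
    evalR N p S (un Q hQ i) τ ↔ Q p (S 0 (τ i)) = true := Iff.rfl
@[simp] theorem evalR_bin {Q : ℕ × ℕ × ℕ → ℕ → ℕ → Bool} {hQ} {i j : ℕ} :
    evalR N p S (bin Q hQ i j) τ ↔ Q p (S 0 (τ i)) (S 0 (τ j)) = true := Iff.rfl
@[simp] theorem evalR_ltc {i j : ℕ} {b c : Bool} :
    evalR N p S (ltc i b j c) τ ↔ cut (τ i) b < cut (τ j) c := by
  rw [cut_lt]
  cases b <;> cases c <;> simp [ltc, le_iff_lt_or_eq]
@[simp] theorem evalR_alv {i : ℕ} : evalR N p S (alv i) τ ↔ S 0 (τ i) ≠ 0 := by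
  simp [alv, ← Bool.not_eq_true]
@[simp] theorem evalR_nev {i : ℕ} {b : Bool} :
    evalR N p S (nev i b) τ ↔ ev (S 0) (cut (τ i) b) = 0 := by
  simp [nev, ev_cut]
@[simp] theorem evalR_rst {i : ℕ} {b : Bool} :
    evalR N p S (rst i b) τ ↔ Rst p.2.1 (S 0) (τ i) b := by
  cases b <;> simp [rst, Rst, ev_cut]

@[simp] theorem push_one {α : Type} (a : α) (f : ℕ → α) : push a f 1 = f 0 := rfl
@[simp] theorem push_two {α : Type} (a : α) (f : ℕ → α) : push a f 2 = f 1 := rfl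

@[simp] theorem evalR_lastReset {i j : ℕ} {b c : Bool} :
    evalR N p S (lastReset i b j c) τ ↔ LR N p.2.1 (S 0) (τ i) b (cut (τ j) c) := by
  simp [lastReset, LR]

def fInit : Fo := all (imp (zero 0) (and (alv 0) (and
  (un (fun p l => initC p.1 (stL l)) (by fun_prop) 0) (nev 0 false))))
def fDown : Fo := all (all (imp (lt 1 0) (imp (alv 0) (alv 1))))
def fState : Fo := all (all (imp (lt 1 0) (imp (alv 0) (imp
  (allC fun b => imp (ltc 2 false 0 b) (imp (neg (ltc 1 false 0 b)) (nev 0 b)))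
  (bin (fun _ l m => Nat.beq (stL l) (stL m)) (by fun_prop) 1 0)))))
def fEdge : Fo := allC fun b => imp (neg (nev 0 b)) (and (alv 0)
  (un (fun p l => edgeC p.1 (evL b l)) (by fun_prop) 0))
def fAlive : Fo := all (imp (neg (nev 0 true)) (ex (and (lt 1 0) (alv 0))))
def fSrc : Fo := allC fun b => imp (neg (nev 0 b)) (all (imp (ltc 0 false 1 b) (imp
  (allC fun d => imp (ltc 1 false 0 d) (imp (ltc 0 d 2 b) (nev 0 d)))
  (bin (fun _ l m => Nat.beq (stL l) (srcC (evL b m))) (by fun_prop) 0 1))))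
def fDst : Fo := allC fun b => imp (neg (nev 0 b)) (all (imp (neg (ltc 0 false 1 b)) (imp (alv 0)
  (imp (allC fun d => imp (ltc 2 b 0 d) (imp (neg (ltc 1 false 0 d)) (nev 0 d)))
  (bin (fun _ l m => Nat.beq (stL l) (dstC (evL b m))) (by fun_prop) 0 1)))))
def fGuard : Fo := allC fun b => imp (neg (nev 0 b)) (imp
  (un (fun p l => guardC p.2.1 p.2.2 (evL b l)) (by fun_prop) 0)
  (allC fun d => imp (lastReset 0 d 1 b) (clk 1 0)))
def fFinal : Fo := all (imp (alv 0) (imp (allC fun d => imp (ltc 1 false 0 d) (nev 0 d))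
  (un (fun p l => finalC p.1 (stL l)) (by fun_prop) 0)))
def fSep : Fo := all (all (imp (lt 1 0)
  (ex (and (lt 2 0) (and (lt 0 1) (and (nev 0 false) (nev 0 true)))))))
def fInv : Fo := all (imp (alv 0) (imp (un (fun p _ => clocksC p.1 p.2.1) (by fun_prop) 0) (imp
  (un (fun p l => betaC p.1 (stL l) p.2.1 p.2.2) (by fun_prop) 0)
  (allC fun d => imp (lastReset 0 d 1 true) (clk 1 0)))))

/-- The formula defining the traces of accepting executions. -/
def valid : Fo := and fInit (and fDown (and fState (and fEdge (and fAlive (and fSrc (and fDst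
  (and fGuard (and fFinal (and fSep fInv)))))))))

theorem rank_valid : valid.rank ≤ 3 := by decide

theorem cut_lt_le {r t : ℝ} {d b : Bool} (h : cut r d < cut t b) : r ≤ t := by
  rcases cut_lt.1 h with h | h
  exacts [h.le, h.1.le]

theorem evalR_valid : evalR N p S valid τ ↔ TV p.1 p.2.1 p.2.2 N (S 0) := by
  have hclk : ∀ {r t : ℝ} {d b : Bool}, LR N p.2.1 (S 0) r d (cut t b) → r ≤ t := fun h =>
    cut_lt_le h.2.1
  simp only [valid, fInit, fDown, fState, fEdge, fAlive, fSrc, fDst, fGuard, fFinal, fSep, fInv,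
    evalR_and, evalR_all, evalR_imp, evalR_neg, evalR_ex, evalR_allC, evalR_un, evalR_bin,
    evalR_lt, evalR_zero, evalR_clk, evalR_ltc, evalR_alv, evalR_nev, evalR_lastReset,
    push_zero, push_one, push_two, Nat.beq_eq]
  constructor
  · rintro ⟨g1, g2, g3, g4, g5, g6, g7, g8, g9, g10, g11⟩
    exact ⟨g1, g2, g3, g4, g5, g6, g7,
      fun t h0 h1 b hb hg r hr hr' d hl => (g8 t h0 h1 b hb hg r hr hr' d hl).2, g9, g10,
      fun t h0 h1 ha hx hb r hr hr' d hl => (g11 t h0 h1 ha hx hb r hr hr' d hl).2⟩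
  · intro h
    exact ⟨h.init, h.down, h.state, h.edge, h.alive, h.src, h.dst,
      fun t h0 h1 b hb hg r hr hr' d hl => ⟨hclk hl, h.guard t h0 h1 b hb hg r hr hr' d hl⟩,
      h.final, h.sep,
      fun t h0 h1 ha hx hb r hr hr' d hl => ⟨hclk hl, h.inv t h0 h1 ha hx hb r hr hr' d hl⟩⟩

/-- The traces `S 0` and `S 1` agree up to the time `τ 0`, at which they are both alive. -/
def agree : Fo := all (imp (neg (lt 1 0)) (and
  (rel (fun _ l m => !Nat.beq l 0 && !Nat.beq m 0 && Nat.beq (stL l) (stL m) &&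
    Nat.beq (evL false l) (evL false m)) (by fun_prop) 0 0 1 0)
  (imp (lt 0 1) (rel (fun _ l m => Nat.beq (evL true l) (evL true m)) (by fun_prop) 0 0 1 0))))

theorem rank_agree : agree.rank ≤ 3 := by decide

end Fo

def Agree (N : ℕ) (s s' : ℝ → ℕ) (t : ℝ) : Prop := ∀ u : ℝ, 0 ≤ u → u < N → u ≤ t →
  (s u ≠ 0 ∧ s' u ≠ 0 ∧ stL (s u) = stL (s' u) ∧ evL false (s u) = evL false (s' u)) ∧
  (u < t → evL true (s u) = evL true (s' u))

theorem Fo.evalR_agree {N : ℕ} {p : ℕ × ℕ × ℕ} {S : ℕ → ℝ → ℕ} {τ : ℕ → ℝ} :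
    evalR N p S agree τ ↔ Agree N (S 0) (S 1) (τ 0) := by
  simp [agree, evalR, Agree, ← Bool.not_eq_true, and_assoc]

/-- The signal is the trace of an accepting execution. -/
def Valid (A : TA ℕ) (N : ℕ) (s : ℝ → ℕ) : Prop :=
  ∀ x ≤ encTA A, ∀ g ≤ encTA A, TV (encTA A) x g N s

end HyTime

namespace HyTime

/-! ### Schedules: executions described by their cuts -/

structure Sched where
  n : ℕ
  C : ℕ → Cut
  v : ℕ → ℕ
  gd : ℕ → List (ℕ × ClkC ℕ)
  rs : ℕ → List ℕ

def time (c : Cut) : ℝ := (ofLex c).1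

@[simp] theorem time_cut (t : ℝ) (b : Bool) : time (cut t b) = t := rfl

theorem exists_cut (c : Cut) : ∃ t b, c = cut t b := ⟨(ofLex c).1, (ofLex c).2, rfl⟩

theorem cut_le {t u : ℝ} {b c : Bool} : cut t b ≤ cut u c ↔ t < u ∨ t = u ∧ b ≤ c :=
  Prod.Lex.toLex_le_toLex

@[simp] theorem cut_inj {t u : ℝ} {b c : Bool} : cut t b = cut u c ↔ t = u ∧ b = c := by
  rw [cut, cut, toLex_inj, Prod.mk.injEq]

theorem time_mono {c d : Cut} (h : c ≤ d) : time c ≤ time d := by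
  obtain ⟨t, b, rfl⟩ := exists_cut c
  obtain ⟨u, e, rfl⟩ := exists_cut d
  rcases cut_le.1 h with h | h
  exacts [h.le, h.1.le]

theorem false_cut_le (t : ℝ) (b : Bool) : cut t false ≤ cut t b := by simp [cut_le]

theorem lt_cut_false {c : Cut} {N : ℝ} (h : c < cut N false) : time c < N := by
  obtain ⟨t, b, rfl⟩ := exists_cut c
  rcases cut_lt.1 h with h | ⟨-, h⟩
  · exact h
  · exact absurd h (by cases b <;> decide)

theorem cut_true_le {t : ℝ} {c : Cut} : cut t true ≤ c ↔ cut t false < c := by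
  obtain ⟨u, b, rfl⟩ := exists_cut c
  cases b <;> simp [cut_le, cut_lt]

theorem lt_cut_true {t : ℝ} {c : Cut} : c < cut t true ↔ c ≤ cut t false := by
  rw [← not_le, cut_true_le, not_lt]

theorem exists_point {c d : Cut} (h : c < d) : ∃ t, c ≤ cut t false ∧ cut t false < d := by
  obtain ⟨t, b, rfl⟩ := exists_cut c
  obtain ⟨u, e, rfl⟩ := exists_cut d
  cases b with
  | false => exact ⟨t, le_rfl, h⟩
  | true =>
    have : t < u := by
      rcases cut_lt.1 h with h | ⟨-, h⟩
      · exact h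
      · exact absurd h (by cases e <;> decide)
    exact ⟨(t + u) / 2, cut_le.2 (Or.inl (by linarith)), cut_lt.2 (Or.inl (by linarith))⟩

namespace Sched

def e (D : Sched) (i : ℕ) : IEdge ℕ := (D.v i, D.v (i + 1), D.gd i, D.rs i)

noncomputable def mu (D : Sched) : ℕ → ℕ → ℝ
  | 0, _ => 0
  | i + 1, x => if x ∈ D.rs i then 0 else D.mu i x + (time (D.C (i + 1)) - time (D.C i))

/-- The cuts of the schedule are increasing and bounded by `N`. -/
structure Good (N : ℕ) (D : Sched) : Prop where
  pos : 0 < D.n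
  start : D.C 0 = cut 0 false
  mono : ∀ i < D.n, D.C i < D.C (i + 1)
  bdd : D.C D.n ≤ cut N false

/-- The schedule is an accepting execution. -/
structure Cond (A : TA ℕ) (D : Sched) : Prop where
  init : D.v 0 ∈ A.init
  edges : ∀ i, i + 1 < D.n → D.e i ∈ A.edges
  inv : ∀ i < D.n, ∀ x ∈ A.clocks, ∀ t, D.C i ≤ cut t false → cut t false < D.C (i + 1) →
    ClkC.holdsOpt natR (D.mu i x + t - time (D.C i)) (A.betaOf (D.v i) x)
  guard : ∀ i, i + 1 < D.n → ∀ q ∈ D.gd i,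
    ClkC.holds natR (D.mu i q.1 + time (D.C (i + 1)) - time (D.C i)) q.2
  final : D.v (D.n - 1) ∈ A.final

/-- The signal `s` is the trace of the schedule on `[0, N)`. -/
structure Rep (N : ℕ) (D : Sched) (s : ℝ → ℕ) : Prop where
  alive : ∀ t : ℝ, 0 ≤ t → t < N → (s t ≠ 0 ↔ cut t false < D.C D.n)
  state : ∀ t : ℝ, ∀ i < D.n, D.C i ≤ cut t false → cut t false < D.C (i + 1) → stL (s t) = D.v i
  event : ∀ i, i + 1 < D.n → ev s (D.C (i + 1)) = encIEdge (D.e i) + 1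
  noev : ∀ t : ℝ, 0 ≤ t → t < N → ∀ b, ev s (cut t b) ≠ 0 → ∃ i, i + 1 < D.n ∧ cut t b = D.C (i + 1)

namespace Good
variable {N : ℕ} {D : Sched} (h : D.Good N)
include h

theorem lt {i j : ℕ} (hij : i < j) (hj : j ≤ D.n) : D.C i < D.C j := by
  induction j with
  | zero => omega
  | succ j ih =>
    rcases Nat.lt_succ_iff_lt_or_eq.1 hij with h' | rfl
    · exact (ih h' (by omega)).trans (h.mono j hj)
    · exact h.mono i hj

theorem le {i j : ℕ} (hij : i ≤ j) (hj : j ≤ D.n) : D.C i ≤ D.C j := by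
  rcases hij.lt_or_eq with h' | rfl
  exacts [(h.lt h' hj).le, le_rfl]

theorem lt_iff {i j : ℕ} (hi : i ≤ D.n) (hj : j ≤ D.n) : D.C i < D.C j ↔ i < j :=
  ⟨fun hc => by
    by_contra hij
    exact absurd (h.le (not_lt.1 hij) hi) (not_le.2 hc), fun hij => h.lt hij hj⟩

theorem inj {i j : ℕ} (hi : i ≤ D.n) (hj : j ≤ D.n) (hc : D.C i = D.C j) : i = j := by
  rcases lt_trichotomy i j with h' | h' | h'
  · exact absurd hc (h.lt h' hj).ne
  · exact h'
  · exact absurd hc (h.lt h' hi).ne'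

omit h in
theorem exists_idx {c : Cut} (h0 : D.C 0 ≤ c) (h1 : c < D.C D.n) :
    ∃ i < D.n, D.C i ≤ c ∧ c < D.C (i + 1) := by
  have : ∀ m ≤ D.n, c < D.C m → ∃ i < D.n, D.C i ≤ c ∧ c < D.C (i + 1) := by
    intro m
    induction m with
    | zero => exact fun _ hc => absurd hc (not_lt.2 h0)
    | succ m ih =>
      intro hm hc
      by_cases hc' : c < D.C m
      · exact ih (by omega) hc'
      · exact ⟨m, hm, not_lt.1 hc', hc⟩
  exact this D.n le_rfl h1

theorem idx_unique {c : Cut} {i j : ℕ} (hi : i < D.n) (hj : j < D.n) (h1 : D.C i ≤ c)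
    (h2 : c < D.C (i + 1)) (h3 : D.C j ≤ c) (h4 : c < D.C (j + 1)) : i = j := by
  have h5 := (h.lt_iff (by omega) (by omega)).1 (h1.trans_lt h4)
  have h6 := (h.lt_iff (by omega) (by omega)).1 (h3.trans_lt h2)
  omega

theorem point {t : ℝ} (h0 : 0 ≤ t) : D.C 0 ≤ cut t false := by
  rw [h.start, cut_le]; simpa using h0.lt_or_eq

theorem nonneg {t : ℝ} {b : Bool} {i : ℕ} (hi : i ≤ D.n) (hc : D.C i ≤ cut t b) : 0 ≤ t := by
  have := time_mono ((h.le (Nat.zero_le i) hi).trans hc)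
  rwa [h.start] at this

theorem lt_N {c : Cut} (hc : c < D.C D.n) : time c < N := lt_cut_false (hc.trans_le h.bdd)

theorem time_C {i : ℕ} (hi : i < D.n) : 0 ≤ time (D.C i) ∧ time (D.C i) < N := by
  refine ⟨?_, h.lt_N (h.lt hi le_rfl)⟩
  have := time_mono (h.le (Nat.zero_le i) hi.le)
  rwa [h.start] at this

end Good

theorem cut_time (c : Cut) : cut (time c) (ofLex c).2 = c := rfl

section
variable {N : ℕ} {D : Sched} {s : ℝ → ℕ} (h : D.Good N) (hr : D.Rep N s)
include h hr

theorem Rep.rst_iff {x : ℕ} {t : ℝ} {b : Bool} (h0 : 0 ≤ t) (ht : t < N) :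
    Rst x s t b ↔ cut t b = D.C 0 ∨ ∃ i, i + 1 < D.n ∧ cut t b = D.C (i + 1) ∧ x ∈ D.rs i := by
  rw [Rst, h.start, cut_inj, and_comm]
  refine or_congr Iff.rfl ⟨fun hx => ?_, ?_⟩
  · have hne : ev s (cut t b) ≠ 0 := fun h0 => by simp [h0] at hx
    obtain ⟨i, hi, hc⟩ := hr.noev t h0 ht b hne
    rw [hc, hr.event i hi, resetC_enc] at hx
    exact ⟨i, hi, hc, hx⟩
  · rintro ⟨i, hi, hc, hx⟩
    rw [hc, hr.event i hi, resetC_enc]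
    exact hx

theorem Rep.exists_last (x : ℕ) {i : ℕ} (hi : i < D.n) : ∃ r b, r = time (D.C i) - D.mu i x ∧
    0 ≤ r ∧ r < N ∧ Rst x s r b ∧ cut r b ≤ D.C i ∧ ∀ u : ℝ, 0 ≤ u → u < N → ∀ d,
      Rst x s u d → cut u d ≤ D.C i → cut u d ≤ cut r b := by
  induction i with
  | zero =>
    refine ⟨0, false, by simp [h.start, mu], le_rfl, by simpa [h.start] using (h.time_C hi).2,
      Or.inl ⟨rfl, rfl⟩, h.start.ge, fun u _ _ d _ hu => by rwa [h.start] at hu⟩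
  | succ i ih =>
    by_cases hx : x ∈ D.rs i
    · refine ⟨time (D.C (i + 1)), (ofLex (D.C (i + 1))).2, by simp [mu, hx], (h.time_C hi).1,
        (h.time_C hi).2, ?_, ?_, ?_⟩
      · rw [hr.rst_iff h (h.time_C hi).1 (h.time_C hi).2]
        exact Or.inr ⟨i, hi, cut_time _, hx⟩
      · rw [cut_time]
      · intro u _ _ d _ hu
        rwa [cut_time]
    · obtain ⟨r, b, h1, h2, h3, h4, h5, h6⟩ := ih (by omega)
      refine ⟨r, b, by simp only [mu, hx, if_false]; linarith, h2, h3, h4,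
        h5.trans (h.mono i (by omega)).le, fun u hu0 huN d hu hd => h6 u hu0 huN d hu ?_⟩
      rcases (hr.rst_iff h hu0 huN).1 hu with h7 | ⟨k, hk, h7, h8⟩
      · rw [h7]; exact h.le (by omega) (by omega)
      · rw [h7] at hd ⊢
        have : k + 1 ≤ i + 1 := by
          by_contra hc
          exact absurd hd (not_le.2 (h.lt (by omega) (by omega)))
        have hne : k ≠ i := fun hki => hx (hki ▸ h8)
        exact h.le (by omega) (by omega)

theorem Rep.exists_lr (x : ℕ) {i : ℕ} (hi : i < D.n) {c : Cut} (h1 : D.C i < c)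
    (h2 : c ≤ D.C (i + 1)) : ∃ r b, r = time (D.C i) - D.mu i x ∧ 0 ≤ r ∧ r < N ∧
      LR N x s r b c := by
  obtain ⟨r, b, h3, h4, h5, h6, h7, h8⟩ := hr.exists_last h x hi
  refine ⟨r, b, h3, h4, h5, h6, h7.trans_lt h1, fun u hu0 huN d hu hd => not_lt.2 ?_⟩
  refine h8 u hu0 huN d hu ?_
  rcases (hr.rst_iff h hu0 huN).1 hu with h9 | ⟨k, hk, h9, -⟩
  · rw [h9]; exact h.le (by omega) (by omega)
  · rw [h9] at hd ⊢
    have := (h.lt_iff (by omega) (by omega)).1 (hd.trans_le h2)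
    exact h.le (by omega) (by omega)

end

theorem lr_unique {N x : ℕ} {s : ℝ → ℕ} {r r' : ℝ} {b b' : Bool} {c : Cut} (h0 : 0 ≤ r)
    (h1 : r < N) (h0' : 0 ≤ r') (h1' : r' < N) (h : LR N x s r b c) (h' : LR N x s r' b' c) :
    r = r' := by
  have := le_antisymm (not_lt.1 (h'.2.2 r h0 h1 b h.1 h.2.1))
    (not_lt.1 (h.2.2 r' h0' h1' b' h'.1 h'.2.1))
  exact (cut_inj.1 this).1

section
variable {N : ℕ} {A : TA ℕ} {D : Sched} {s : ℝ → ℕ} (h : D.Good N) (hr : D.Rep N s)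
include h hr

theorem Rep.tv (hc : D.Cond A) (x g : ℕ) : TV (encTA A) x g N s where
  init := by
    rintro _ - ht rfl
    have h0 : cut 0 false < D.C (0 + 1) := by
      have := h.mono 0 h.pos
      rwa [h.start] at this
    refine ⟨(hr.alive 0 le_rfl ht).2 (h0.trans_le (h.le h.pos le_rfl)), ?_, ?_⟩
    · rw [hr.state 0 0 h.pos h.start.le h0, initC_enc]
      exact hc.init
    · by_contra hne
      obtain ⟨i, hi, hc⟩ := hr.noev 0 le_rfl ht false hne
      rw [← h.start] at hc
      have := h.inj (by omega) (by omega) hc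
      omega
  down := fun t h0 ht u h0' ht' htu hu => by
    rw [hr.alive t h0 ht]
    rw [hr.alive u h0' ht'] at hu
    exact (cut_lt.2 (Or.inl htu)).trans hu
  state := fun t h0 ht u h0' ht' htu hu hev => by
    rw [hr.alive u h0' ht'] at hu
    obtain ⟨i, hi, h1, h2⟩ := Good.exists_idx (h.point h0') hu
    obtain ⟨j, hj, h3, h4⟩ := Good.exists_idx (h.point h0) ((cut_lt.2 (Or.inl htu)).trans hu)
    rw [hr.state u i hi h1 h2, hr.state t j hj h3 h4]
    by_contra hne
    have hji : j < i := by
      refine lt_of_le_of_ne ?_ fun h' => hne (by rw [h'])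
      have := (h.lt_iff (by omega) (by omega)).1 (h3.trans_lt ((cut_lt.2 (Or.inl htu)).trans h2))
      omega
    have hj' : j + 1 < D.n := by omega
    have hle : D.C (j + 1) ≤ cut u false := (h.le hji hi.le).trans h1
    have := hev _ (h.time_C hj').1 (h.time_C hj').2 (ofLex (D.C (j + 1))).2
      (by rw [cut_time]; exact h4) (by rw [cut_time]; exact not_lt.2 hle)
    rw [cut_time, hr.event j hj'] at this
    omega
  edge := fun t h0 ht b hne => by
    obtain ⟨i, hi, hci⟩ := hr.noev t h0 ht b hne
    refine ⟨(hr.alive t h0 ht).2 ?_, ?_⟩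
    · exact ((false_cut_le t b).trans hci.le).trans_lt (h.lt hi le_rfl)
    · rw [hci, hr.event i hi, edgeC_enc]
      exact ⟨_, hc.edges i hi, rfl⟩
  alive := fun t h0 ht hne => by
    obtain ⟨i, hi, hci⟩ := hr.noev t h0 ht true hne
    obtain ⟨u, h1, h2⟩ := exists_point (h.lt hi le_rfl)
    rw [← hci, cut_true_le] at h1
    have htu : t < u := by simpa [cut_lt] using h1
    have hu : u < N := h.lt_N h2
    exact ⟨u, by linarith, hu, htu, (hr.alive u (by linarith) hu).2 h2⟩
  src := fun t h0 ht b hne u h0' ht' hlt hev => by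
    obtain ⟨i, hi, hci⟩ := hr.noev t h0 ht b hne
    rw [hci] at hlt hev ⊢
    rw [hr.event i hi, srcC_enc]
    refine hr.state u i (by omega) ?_ hlt
    by_contra hcc
    rw [not_le] at hcc
    rcases Nat.eq_zero_or_pos i with rfl | hpos
    · exact absurd (h.point h0') (not_le.2 hcc)
    · have hi' : i < D.n := by omega
      have := hev _ (h.time_C hi').1 (h.time_C hi').2 (ofLex (D.C i)).2
        (by rw [cut_time]; exact hcc) (by rw [cut_time]; exact h.mono i hi')
      obtain ⟨k, rfl⟩ : ∃ k, i = k + 1 := ⟨i - 1, by omega⟩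
      rw [cut_time, hr.event k hi'] at this
      omega
  dst := fun t h0 ht b hne u h0' ht' hlt hal hev => by
    obtain ⟨i, hi, hci⟩ := hr.noev t h0 ht b hne
    rw [hci] at hlt hev ⊢
    rw [hr.event i hi, dstC_enc]
    refine hr.state u (i + 1) hi (not_lt.1 hlt) ?_
    by_contra hcc
    rw [not_lt] at hcc
    rw [hr.alive u h0' ht'] at hal
    have hi' : i + 1 + 1 < D.n := by
      rcases (show i + 1 + 1 ≤ D.n from hi).lt_or_eq with h' | h'
      · exact h'
      · rw [h'] at hcc; exact absurd hal (not_lt.2 hcc)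
    have := hev _ (h.time_C hi').1 (h.time_C hi').2 (ofLex (D.C (i + 1 + 1))).2
      (by rw [cut_time]; exact h.mono _ hi) (by rw [cut_time]; exact not_lt.2 hcc)
    rw [cut_time, hr.event _ hi'] at this
    omega
  guard := fun t h0 ht b hne hg r hr0 hrN d hlr => by
    obtain ⟨i, hi, hci⟩ := hr.noev t h0 ht b hne
    rw [hci, hr.event i hi, guardC_enc] at hg
    obtain ⟨c, hmem, rfl⟩ := hg
    obtain ⟨r', b', e, h1, h2, h3⟩ := hr.exists_lr h x (by omega : i < D.n)
      (h.mono i (by omega)) le_rfl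
    rw [hci] at hlr
    rw [decClk_enc, lr_unique hr0 hrN h1 h2 hlr h3, e]
    have := hc.guard i hi _ hmem
    rw [← hci, time_cut] at this
    convert this using 1
    ring
  final := fun t h0 ht hal hev => by
    rw [hr.alive t h0 ht] at hal
    obtain ⟨i, hi, h1, h2⟩ := Good.exists_idx (h.point h0) hal
    rw [hr.state t i hi h1 h2, finalC_enc]
    rcases (show i + 1 ≤ D.n from hi).lt_or_eq with h' | h'
    · have := hev _ (h.time_C h').1 (h.time_C h').2 (ofLex (D.C (i + 1))).2
        (by rw [cut_time]; exact h2)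
      rw [cut_time, hr.event i h'] at this
      omega
    · have := hc.final
      rwa [← h', Nat.add_sub_cancel] at this
  sep := fun t h0 ht u h0' ht' htu => by
    have hfin : (Set.Ioo t u \ (fun i => time (D.C i)) '' Set.Iio (D.n + 1)).Nonempty :=
      ((Set.Ioo_infinite htu).sdiff ((Set.finite_Iio _).image _)).nonempty
    obtain ⟨r, ⟨h1, h2⟩, h3⟩ := hfin
    have : ∀ b, ev s (cut r b) = 0 := fun b => by
      by_contra hne
      obtain ⟨i, hi, hci⟩ := hr.noev r (by linarith) (by linarith) b hne
      exact h3 ⟨i + 1, by simp; omega, by simp [← hci]⟩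
    exact ⟨r, by linarith, by linarith, h1, h2, this _, this _⟩
  inv := fun t h0 ht hal hx hb r hr0 hrN d hlr => by
    rw [hr.alive t h0 ht] at hal
    obtain ⟨i, hi, h1, h2⟩ := Good.exists_idx (h.point h0) hal
    rw [hr.state t i hi h1 h2, betaC_enc] at hb
    obtain ⟨c, hbeta, rfl⟩ := hb
    rw [clocksC_enc] at hx
    obtain ⟨r', b', e, h3, h4, h5⟩ := hr.exists_lr h x hi (lt_cut_true.2 h1) (cut_true_le.2 h2)
    rw [decClk_enc, lr_unique hr0 hrN h3 h4 hlr h5, e]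
    have := hc.inv i hi x hx t h1 h2
    rw [hbeta] at this
    simp only [ClkC.holdsOpt] at this
    convert this using 1
    ring

theorem Rep.cond (hv : Valid A N s) : D.Cond A := by
  obtain ⟨b1, b2, b3, b4⟩ := encTA_bounds A
  have hN : (0 : ℝ) < N := by
    have := (h.time_C h.pos).2
    rwa [h.start] at this
  have tv := hv 0 (Nat.zero_le _) 0 (Nat.zero_le _)
  have hedge : ∀ i, i + 1 < D.n → D.e i ∈ A.edges := fun i hi => by
    have := (tv.edge _ (h.time_C hi).1 (h.time_C hi).2 (ofLex (D.C (i + 1))).2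
      (by rw [cut_time, hr.event i hi]; omega)).2
    rw [cut_time, hr.event i hi, edgeC_enc] at this
    obtain ⟨e, he, heq⟩ := this
    rwa [← encIEdge_injective heq]
  refine ⟨?_, hedge, ?_, ?_, ?_⟩
  · have := (tv.init 0 le_rfl hN rfl).2.1
    rwa [initC_enc, hr.state 0 0 h.pos h.start.le (by rw [← h.start]; exact h.mono 0 h.pos)] at this
  · intro i hi x hx t h1 h2
    cases hb : A.betaOf (D.v i) x with
    | none => trivial
    | some c =>
      have hlt : encClkC c < encTA A := by
        obtain ⟨q, hq, rfl⟩ := Option.map_eq_some_iff.1 hb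
        exact b3 q (List.mem_of_find?_eq_some hq)
      have ht0 := h.nonneg hi.le h1
      have hal : cut t false < D.C D.n := h2.trans_le (h.le hi le_rfl)
      have htN : t < N := h.lt_N hal
      obtain ⟨r, b, e, h3, h4, h5⟩ := hr.exists_lr h x hi (lt_cut_true.2 h1) (cut_true_le.2 h2)
      have := (hv x (b2 x hx).le _ hlt.le).inv t ht0 htN ((hr.alive t ht0 htN).2 hal)
        ((clocksC_enc A x).2 hx)
        ((betaC_enc A _ _ _).2 ⟨c, by rw [hr.state t i hi h1 h2, hb], rfl⟩) r h3 h4 b h5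
      rw [decClk_enc, e] at this
      simp only [ClkC.holdsOpt]
      convert this using 1
      ring
  · intro i hi q hq
    obtain ⟨-, -, b5⟩ := encIEdge_bounds (D.e i)
    have b6 := b4 _ (hedge i hi)
    obtain ⟨b7, b8⟩ := b5 q hq
    obtain ⟨r, b, e, h3, h4, h5⟩ := hr.exists_lr h q.1 (by omega : i < D.n)
      (h.mono i (by omega)) le_rfl
    have := (hv q.1 (by omega) (encClkC q.2) (by omega)).guard _ (h.time_C hi).1 (h.time_C hi).2
      (ofLex (D.C (i + 1))).2 (by rw [cut_time, hr.event i hi]; omega)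
      (by rw [cut_time, hr.event i hi, guardC_enc]; exact ⟨_, hq, rfl⟩) r h3 h4 b
      (by rw [cut_time]; exact h5)
    rw [decClk_enc, e] at this
    convert this using 1
    ring
  · obtain ⟨m, hm⟩ : ∃ m, D.n = m + 1 := ⟨D.n - 1, by have := h.pos; omega⟩
    obtain ⟨t, h1, h2⟩ := exists_point (h.mono m (by omega))
    have ht0 := h.nonneg (by omega) h1
    have hal : cut t false < D.C D.n := by rw [hm]; exact h2
    have htN : t < N := h.lt_N hal
    have := tv.final t ht0 htN ((hr.alive t ht0 htN).2 hal) fun r hr0 hrN d hlt => by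
      by_contra hne
      obtain ⟨i, hi, hci⟩ := hr.noev r hr0 hrN d hne
      rw [hci] at hlt
      have := (h.lt_iff (by omega) (by omega)).1 (h1.trans_lt hlt)
      omega
    rw [finalC_enc, hr.state t m (by omega) h1 h2] at this
    rw [hm, Nat.add_sub_cancel]
    exact this

end

end Sched
end HyTime

namespace HyTime

namespace Sched

/-! ### The trace of a schedule -/

open Classical in
noncomputable def evt (D : Sched) (c : Cut) : ℕ :=
  if h : ∃ i, i + 1 < D.n ∧ c = D.C (i + 1) then encIEdge (D.e h.choose) + 1 else 0

open Classical in
noncomputable def trace (D : Sched) (t : ℝ) : ℕ :=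
  if h : ∃ i < D.n, D.C i ≤ cut t false ∧ cut t false < D.C (i + 1) then
    mkL (D.v h.choose) (D.evt (cut t false)) (D.evt (cut t true)) else 0

variable {N : ℕ} {A : TA ℕ} {D : Sched}

theorem evt_ne_zero {c : Cut} (h : D.evt c ≠ 0) : ∃ i, i + 1 < D.n ∧ c = D.C (i + 1) := by
  by_contra hc
  exact h (dif_neg hc)

theorem evt_le (hc : D.Cond A) (c : Cut) : D.evt c ≤ encTA A := by
  rw [evt]
  split_ifs with h
  · exact (encTA_bounds A).2.2.2 _ (hc.edges _ h.choose_spec.1)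
  · exact Nat.zero_le _

theorem v_le (hc : D.Cond A) {i : ℕ} (hi : i < D.n) : D.v i ≤ encTA A := by
  cases i with
  | zero => exact ((encTA_bounds A).1 _ hc.init).le
  | succ i =>
    have h1 := (encTA_bounds A).2.2.2 _ (hc.edges i hi)
    have h2 := (encIEdge_bounds (D.e i)).2.1
    exact h2.trans h1.le

theorem pair_le_pair {a b c d : ℕ} (h1 : a ≤ c) (h2 : b ≤ d) : Nat.pair a b ≤ Nat.pair c d :=
  ((StrictMono.monotone fun _ _ h => Nat.pair_lt_pair_left b h) h1).trans
    ((StrictMono.monotone fun _ _ h => Nat.pair_lt_pair_right c h) h2)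

theorem mkL_le {v i o M : ℕ} (hv : v ≤ M) (hi : i ≤ M) (ho : o ≤ M) : mkL v i o ≤ mkL M M M :=
  Nat.succ_le_succ (pair_le_pair hv (pair_le_pair hi ho))

theorem trace_le (hc : D.Cond A) (t : ℝ) :
    D.trace t ≤ mkL (encTA A) (encTA A) (encTA A) := by
  rw [trace]
  split_ifs with h
  · exact mkL_le (v_le hc h.choose_spec.1) (evt_le hc _) (evt_le hc _)
  · exact Nat.zero_le _

theorem Good.evt_C (h : D.Good N) {i : ℕ} (hi : i + 1 < D.n) :
    D.evt (D.C (i + 1)) = encIEdge (D.e i) + 1 := by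
  have hex : ∃ j, j + 1 < D.n ∧ D.C (i + 1) = D.C (j + 1) := ⟨i, hi, rfl⟩
  rw [evt, dif_pos hex]
  have := h.inj (by omega) (by have := hex.choose_spec.1; omega) hex.choose_spec.2
  rw [← Nat.succ_injective this]

theorem Good.trace_of_mem (h : D.Good N) {i : ℕ} {t : ℝ} (hi : i < D.n) (h1 : D.C i ≤ cut t false)
    (h2 : cut t false < D.C (i + 1)) :
    D.trace t = mkL (D.v i) (D.evt (cut t false)) (D.evt (cut t true)) := by
  have hex : ∃ i < D.n, D.C i ≤ cut t false ∧ cut t false < D.C (i + 1) := ⟨i, hi, h1, h2⟩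
  rw [trace, dif_pos hex]
  have h3 := hex.choose_spec
  rw [h.idx_unique hi h3.1 h1 h2 h3.2.1 h3.2.2]

theorem trace_ne_zero {t : ℝ} (ht : D.trace t ≠ 0) :
    ∃ i < D.n, D.C i ≤ cut t false ∧ cut t false < D.C (i + 1) := by
  by_contra hc
  exact ht (dif_neg hc)

theorem Good.rep (h : D.Good N) : D.Rep N D.trace where
  alive := fun t h0 _ => by
    constructor
    · intro ht
      obtain ⟨i, hi, h1, h2⟩ := trace_ne_zero ht
      exact h2.trans_le (h.le hi le_rfl)
    · intro ht
      obtain ⟨i, hi, h1, h2⟩ := Good.exists_idx (h.point h0) ht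
      rw [h.trace_of_mem hi h1 h2]
      exact Nat.succ_ne_zero _
  state := fun t i hi h1 h2 => by rw [h.trace_of_mem hi h1 h2, stL_mkL]
  event := fun i hi => by
    obtain ⟨t, b, hc⟩ := exists_cut (D.C (i + 1))
    have h0 : 0 ≤ t := h.nonneg (by omega : i + 1 ≤ D.n) hc.le
    have h3 : cut t false < D.C D.n :=
      ((false_cut_le t b).trans hc.ge).trans_lt (h.lt hi le_rfl)
    obtain ⟨j, hj, h1, h2⟩ := Good.exists_idx (h.point h0) h3
    rw [← h.evt_C hi, hc, ev_cut, h.trace_of_mem hj h1 h2, evL_mkL]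
    cases b <;> rfl
  noev := fun t _ _ b hne => by
    have hal : D.trace t ≠ 0 := fun h0 => by rw [ev_cut, h0, evL_zero] at hne; exact hne rfl
    obtain ⟨j, hj, h1, h2⟩ := trace_ne_zero hal
    rw [ev_cut, h.trace_of_mem hj h1 h2, evL_mkL] at hne
    refine evt_ne_zero (D := D) ?_
    cases b <;> exact hne

theorem Good.trace_congr (h : D.Good N) {t u : ℝ}
    (hlt : ∀ i ≤ D.n, cut t false < D.C i ↔ cut u false < D.C i)
    (ht : ∀ i ≤ D.n, time (D.C i) ≠ t) (hu : ∀ i ≤ D.n, time (D.C i) ≠ u) :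
    D.trace t = D.trace u := by
  have he : ∀ t : ℝ, (∀ i ≤ D.n, time (D.C i) ≠ t) → ∀ b, D.evt (cut t b) = 0 := by
    intro t ht b
    by_contra hne
    obtain ⟨i, hi, hc⟩ := evt_ne_zero hne
    exact ht (i + 1) hi.le (by rw [← hc, time_cut])
  by_cases hal : D.trace t = 0
  · by_contra hne
    rw [hal] at hne
    obtain ⟨i, hi, h1, h2⟩ := trace_ne_zero (Ne.symm hne)
    rw [h.trace_of_mem hi (not_lt.1 fun hc => absurd ((hlt i hi.le).1 hc) (not_lt.2 h1))
      ((hlt (i + 1) hi).2 h2)] at hal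
    exact Nat.succ_ne_zero _ hal
  · obtain ⟨i, hi, h1, h2⟩ := trace_ne_zero hal
    rw [h.trace_of_mem hi h1 h2,
      h.trace_of_mem hi (not_lt.1 fun hc => absurd ((hlt i hi.le).2 hc) (not_lt.2 h1))
      ((hlt (i + 1) hi).1 h2), he t ht, he t ht, he u hu, he u hu]

theorem Good.fv (h : D.Good N) : FV N D.trace := by
  intro j hj
  refine ⟨(Finset.range (D.n + 1)).image fun i => time (D.C i) - j, fun t u _ htu _ hF => ?_⟩
  have hF' : ∀ i ≤ D.n, ¬ (j + t ≤ time (D.C i) ∧ time (D.C i) ≤ j + u) := fun i hi hc =>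
    hF _ (Finset.mem_image.2 ⟨i, Finset.mem_range.2 (by omega), rfl⟩)
      ⟨by linarith [hc.1], by linarith [hc.2]⟩
  refine h.trace_congr (fun i hi => ?_) (fun i hi hc => hF' i hi ⟨hc.ge, by linarith⟩)
    (fun i hi hc => hF' i hi ⟨by linarith, hc.le⟩)
  obtain ⟨r, b, hr⟩ := exists_cut (D.C i)
  have h1 := hF' i hi
  rw [hr, time_cut] at h1
  rw [hr, cut_lt, cut_lt]
  have h2 : j + t ≠ r := fun hc => h1 ⟨hc.le, by linarith⟩
  have h3 : j + u ≠ r := fun hc => h1 ⟨by linarith, hc.ge⟩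
  simp only [h2, h3, false_and, or_false]
  constructor
  · intro h4
    by_contra h5
    exact h1 ⟨h4.le, not_lt.1 h5⟩
  · intro h4
    linarith

/-! ### The schedule of a valid signal -/

theorem exists_chain {α : Type*} [LinearOrder α] (E : Finset α) (a : α) :
    ∀ b, a < b → (∀ c ∈ E, a < c ∧ c < b) → ∃ n, ∃ C : ℕ → α, 0 < n ∧ C 0 = a ∧ C n = b ∧
      (∀ i < n, C i < C (i + 1)) ∧ ∀ c, c ∈ E ↔ ∃ i, i + 1 < n ∧ c = C (i + 1) := by
  induction E using Finset.induction_on_max with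
  | empty =>
    intro b hab _
    refine ⟨1, fun i => if i = 0 then a else b, one_pos, rfl, rfl, fun i hi => ?_, fun c => ?_⟩
    · obtain rfl : i = 0 := by omega
      simpa using hab
    · simp
  | insert m E hm ih =>
    intro b hab hE
    have hmE := hE m (Finset.mem_insert_self _ _)
    obtain ⟨n, C, h0, h1, h2, h3, h4⟩ := ih m hmE.1 fun c hc =>
      ⟨(hE c (Finset.mem_insert_of_mem hc)).1, hm c hc⟩
    refine ⟨n + 1, fun i => if i ≤ n then C i else b, by omega, by simp [h1], by simp,
      fun i hi => ?_, fun c => ?_⟩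
    · rcases (Nat.lt_succ_iff.1 hi).lt_or_eq with h5 | rfl
      · simpa [h5.le, Nat.succ_le_of_lt h5] using h3 i h5
      · simpa [h2] using hmE.2
    · rw [Finset.mem_insert, h4]
      constructor
      · rintro (rfl | ⟨i, hi, rfl⟩)
        · exact ⟨n - 1, by omega, by simp only [Nat.sub_add_cancel h0, le_refl, if_true, h2]⟩
        · exact ⟨i, by omega, (if_pos hi.le).symm⟩
      · rintro ⟨i, hi, rfl⟩
        simp only [show i + 1 ≤ n by omega, if_true]
        rcases (show i + 1 ≤ n by omega).lt_or_eq with h5 | h5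
        · exact Or.inr ⟨i, h5, rfl⟩
        · exact Or.inl (h5 ▸ h2)

theorem exists_gap (F : Finset ℝ) {x y : ℝ} (hx : x ∉ F) (hxy : x < y) :
    ∃ z, x < z ∧ z < y ∧ ∀ v ∈ F, ¬ (x ≤ v ∧ v ≤ z) := by
  have h : ∀ᶠ z in nhdsWithin x (Set.Ioi x), z < y ∧ ∀ v ∈ F, ¬ (x ≤ v ∧ v ≤ z) := by
    refine (eventually_nhdsWithin_of_eventually_nhds (eventually_lt_nhds hxy)).and
      ((Finset.eventually_all F).2 fun v hv => ?_)
    rcases lt_trichotomy v x with h | rfl | h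
    · exact Filter.Eventually.of_forall fun z hz => absurd hz.1 (not_le.2 h)
    · exact absurd hv hx
    · filter_upwards [eventually_nhdsWithin_of_eventually_nhds (eventually_lt_nhds h)] with z hz hc
      exact absurd hc.2 (not_le.2 hz)
  obtain ⟨z, ⟨h1, h2⟩, h3⟩ := (h.and self_mem_nhdsWithin).exists
  exact ⟨z, h3, h1, h2⟩

end Sched

open Sched

namespace TV
variable {a x g N : ℕ} {s : ℝ → ℕ} (h : TV a x g N s)
include h

theorem finite_events (hs : FV N s) :
    {c : Cut | 0 ≤ time c ∧ time c < N ∧ ev s c ≠ 0}.Finite := by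
  choose F hF using fun j : Fin N => hs j j.2
  let T : Finset ℝ := Finset.univ.biUnion fun j : Fin N => (insert 0 (F j)).image fun v => (j : ℝ) + v
  refine ((T.finite_toSet.prod (Set.finite_univ (α := Bool))).image fun q => cut q.1 q.2).subset ?_
  intro c hc
  obtain ⟨t, b, rfl⟩ := exists_cut c
  obtain ⟨h0, hN, hne⟩ := hc
  rw [time_cut] at h0 hN
  refine ⟨(t, b), ⟨?_, Set.mem_univ _⟩, rfl⟩
  obtain ⟨j, y, hy, hy1, rfl⟩ := exists_split h0 hN
  by_contra hT
  have hyF : y ∉ insert 0 (F j) := fun hm =>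
    hT (Finset.mem_biUnion.2 ⟨j, Finset.mem_univ _, Finset.mem_image.2 ⟨y, hm, rfl⟩⟩)
  rw [Finset.mem_insert, not_or] at hyF
  obtain ⟨z, h1, h2, h3⟩ := exists_gap (F j) hyF.2 hy1
  have hj : (j : ℝ) + 1 ≤ N := by exact_mod_cast j.2
  obtain ⟨r, h4, h5, h6, h7, h8, h9⟩ := h.sep (j + y) h0 hN (j + z) (by linarith) (by linarith)
    (by linarith)
  have := hF j y (r - j) (lt_of_le_of_ne hy (Ne.symm hyF.1)) (by linarith) (by linarith)
    fun v hv hc => h3 v hv ⟨hc.1, by linarith [hc.2]⟩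
  simp only [add_sub_cancel] at this
  rw [ev_cut] at h8 h9 hne
  rw [← this] at h8 h9
  cases b
  exacts [hne h8, hne h9]

theorem exists_end (hN : 0 < N) : ∃ e, e ≤ cut N false ∧
    ∀ t : ℝ, 0 ≤ t → t < N → (s t ≠ 0 ↔ cut t false < e) := by
  let Q : Set ℝ := {t | 0 ≤ t ∧ t < N ∧ s t ≠ 0}
  have hb : BddAbove Q := ⟨N, fun t ht => ht.2.1.le⟩
  have hN' : (0 : ℝ) < N := by exact_mod_cast hN
  have hne : Q.Nonempty := ⟨0, le_rfl, hN', (h.init 0 le_rfl hN' rfl).1⟩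
  by_cases hT : sSup Q ∈ Q
  · refine ⟨cut (sSup Q) true, cut_le.2 (Or.inl hT.2.1), fun t h0 ht => ⟨fun hs => ?_, fun hs => ?_⟩⟩
    · exact cut_true_le.1 (cut_le.2 ((le_csSup hb ⟨h0, ht, hs⟩).lt_or_eq.imp_right
        fun h => ⟨h, le_rfl⟩))
    · rcases (Fo.cut_lt_le hs).lt_or_eq with h1 | h1
      · exact h.down t h0 ht _ hT.1 hT.2.1 h1 hT.2.2
      · rw [h1]; exact hT.2.2
  · refine ⟨cut (sSup Q) false, cut_le.2 ((csSup_le hne fun t ht => ht.2.1.le).lt_or_eq.imp_right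
      fun h => ⟨h, le_rfl⟩), fun t h0 ht => ⟨fun hs => ?_, fun hs => ?_⟩⟩
    · refine cut_lt.2 (Or.inl (lt_of_le_of_ne (le_csSup hb ⟨h0, ht, hs⟩) fun hc => hT ?_))
      rw [← hc]; exact ⟨h0, ht, hs⟩
    · have h1 : t < sSup Q := lt_cut_false hs
      obtain ⟨u, hu, h2⟩ := exists_lt_of_lt_csSup hne h1
      exact h.down t h0 ht u hu.1 hu.2.1 h2 hu.2.2

end TV

theorem Valid.exists_sched {A : TA ℕ} {N : ℕ} {s : ℝ → ℕ} (hN : 0 < N) (hv : Valid A N s)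
    (hs : FV N s) : ∃ D : Sched, D.Good N ∧ D.Rep N s := by
  have h := hv 0 (Nat.zero_le _) 0 (Nat.zero_le _)
  have hN' : (0 : ℝ) < N := by exact_mod_cast hN
  obtain ⟨e, he1, he2⟩ := h.exists_end hN
  have hfin := h.finite_events hs
  have h0 := h.init 0 le_rfl hN' rfl
  obtain ⟨n, C, hn, hC0, hCn, hmono, hC⟩ := exists_chain hfin.toFinset (cut 0 false) e
    ((he2 0 le_rfl hN').1 h0.1) fun c hc => by
      rw [Set.Finite.mem_toFinset] at hc
      obtain ⟨t, b, rfl⟩ := exists_cut c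
      obtain ⟨ht0, htN, hne⟩ := hc
      rw [time_cut] at ht0 htN
      refine ⟨lt_of_le_of_ne (cut_le.2 (ht0.lt_or_eq.imp_right fun h => ⟨h, by simp⟩)) ?_, ?_⟩
      · intro hc
        rw [← hc] at hne
        exact hne h0.2.2
      · cases b with
        | false => exact (he2 t ht0 htN).1 (h.edge t ht0 htN _ hne).1
        | true =>
          obtain ⟨u, h1, h2, h3, h4⟩ := h.alive t ht0 htN hne
          exact (cut_lt.2 (Or.inl h3)).trans ((he2 u h1 h2).1 h4)
  have hgood : ∀ v gd rs, Good N ⟨n, C, v, gd, rs⟩ := fun v gd rs =>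
    ⟨hn, hC0, hmono, hCn.trans_le he1⟩
  have hg := hgood (fun _ => 0) (fun _ => []) (fun _ => [])
  have hev : ∀ t : ℝ, 0 ≤ t → t < N → ∀ b, ev s (cut t b) ≠ 0 →
      ∃ i, i + 1 < n ∧ cut t b = C (i + 1) := fun t h1 h2 b h3 =>
    (hC _).1 (hfin.mem_toFinset.2 ⟨h1, h2, h3⟩)
  have hev' : ∀ i, i + 1 < n → ev s (C (i + 1)) ≠ 0 := fun i hi =>
    (hfin.mem_toFinset.1 ((hC _).2 ⟨i, hi, rfl⟩)).2.2
  have hpt : ∀ i < n, ∀ t : ℝ, C i ≤ cut t false → cut t false < C (i + 1) →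
      0 ≤ t ∧ t < N ∧ s t ≠ 0 := fun i hi t h1 h2 => by
    have h3 := hg.nonneg (i := i) hi.le h1
    have h4 : cut t false < C n := h2.trans_le (hg.le (i := i + 1) hi le_rfl)
    have h5 : t < N := hg.lt_N (c := cut t false) h4
    exact ⟨h3, h5, (he2 t h3 h5).2 (by rwa [← hCn])⟩
  have hconst : ∀ i < n, ∀ t u : ℝ, C i ≤ cut t false → cut t false < C (i + 1) →
      C i ≤ cut u false → cut u false < C (i + 1) → t < u → stL (s t) = stL (s u) := by
    intro i hi t u h1 h2 h3 h4 htu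
    obtain ⟨h5, h6, h7⟩ := hpt i hi t h1 h2
    obtain ⟨h8, h9, h10⟩ := hpt i hi u h3 h4
    refine h.state t h5 h6 u h8 h9 htu h10 fun r hr0 hrN b hlt hle => ?_
    by_contra hne
    obtain ⟨k, hk, hc⟩ := hev r hr0 hrN b hne
    rw [hc] at hlt hle
    have h11 := (hg.lt_iff (i := i) (j := k + 1) hi.le hk.le).1 (h1.trans_lt hlt)
    have h12 := (hg.lt_iff (i := k + 1) (j := i + 1) hk.le hi).1 ((not_lt.1 hle).trans_lt h4)
    omega
  have hv : ∀ i, ∃ v, i < n → ∀ t : ℝ, C i ≤ cut t false → cut t false < C (i + 1) →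
      stL (s t) = v := by
    intro i
    by_cases hi : i < n
    · obtain ⟨u, h1, h2⟩ := exists_point (hmono i hi)
      refine ⟨stL (s u), fun _ t h3 h4 => ?_⟩
      rcases lt_trichotomy t u with h5 | rfl | h5
      · exact hconst i hi t u h3 h4 h1 h2 h5
      · rfl
      · exact (hconst i hi u t h1 h2 h3 h4 h5).symm
    · exact ⟨0, fun h => absurd h hi⟩
  have hed : ∀ i, ∃ e : IEdge ℕ, i + 1 < n → ev s (C (i + 1)) = encIEdge e + 1 := by
    intro i
    by_cases hi : i + 1 < n
    · have h1 := hg.time_C (i := i + 1) hi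
      obtain ⟨-, h3⟩ := h.edge _ h1.1 h1.2 (ofLex (C (i + 1))).2
        (by rw [cut_time]; exact hev' i hi)
      rw [cut_time] at h3
      obtain ⟨k, hk⟩ := Nat.exists_eq_succ_of_ne_zero (hev' i hi)
      rw [hk, Nat.succ_eq_add_one, edgeC_enc] at h3
      obtain ⟨e, -, rfl⟩ := h3
      exact ⟨e, fun _ => hk⟩
    · exact ⟨default, fun h => absurd h hi⟩
  choose v hv using hv
  choose ed hed using hed
  have hG := hgood v (fun i => (ed i).2.2.1) (fun i => (ed i).2.2.2)
  refine ⟨_, hG, ⟨fun t h1 h2 => by rw [he2 t h1 h2, ← hCn], fun t i hi => hv i hi t,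
    fun i hi => ?_, hev⟩⟩
  simp only at hi
  obtain ⟨t, b, hc⟩ := exists_cut (C (i + 1))
  have hne := hev' i hi
  have h1 := hg.time_C (i := i + 1) hi
  simp only [hc, time_cut] at h1
  rw [hc] at hne
  have hsrc : (ed i).1 = v i := by
    obtain ⟨u, h2, h3⟩ := exists_point (hmono i (by omega))
    obtain ⟨h5, h6, h7⟩ := hpt i (by omega) u h2 h3
    rw [← hv i (by omega) u h2 h3, h.src t h1.1 h1.2 b hne u h5 h6 (by rwa [← hc]), ← hc, hed i hi,
      srcC_enc]
    intro r hr0 hrN d hlt hle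
    by_contra hne
    obtain ⟨k, hk, hc'⟩ := hev r hr0 hrN d hne
    rw [hc'] at hlt hle
    rw [← hc] at hle
    have h11 := (hg.lt_iff (i := i) (j := k + 1) (show i ≤ n by omega) hk.le).1 (h2.trans_lt hlt)
    have h12 : k + 1 < i + 1 := (hg.lt_iff (i := k + 1) (j := i + 1) hk.le hi.le).1 hle
    omega
  have hdst : (ed i).2.1 = v (i + 1) := by
    obtain ⟨u, h2, h3⟩ := exists_point (hmono (i + 1) hi)
    obtain ⟨h5, h6, h7⟩ := hpt (i + 1) hi u h2 h3
    rw [← hv (i + 1) hi u h2 h3, h.dst t h1.1 h1.2 b hne u h5 h6 (by rw [← hc]; exact not_lt.2 h2)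
      h7, ← hc, hed i hi, dstC_enc]
    intro r hr0 hrN d hlt hle
    by_contra hne
    obtain ⟨k, hk, hc'⟩ := hev r hr0 hrN d hne
    rw [hc'] at hlt hle
    rw [← hc] at hlt
    have h11 := (hg.lt_iff (i := i + 1) (j := k + 1) hi.le hk.le).1 hlt
    have h12 := (hg.lt_iff (i := k + 1) (j := i + 1 + 1) hk.le hi).1 ((not_lt.1 hle).trans_lt h3)
    omega
  rw [hed i hi, Sched.e]
  simp only [← hsrc, ← hdst]

end HyTime

namespace HyTime

open Sched

/-! ### Executions and schedules -/

def loCut (I : TIvl) : Cut := cut I.lo (!I.loC)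
def hiCut (I : TIvl) : Cut := cut I.hi I.hiC

theorem wf_iff {I : TIvl} : I.WF ↔ loCut I < hiCut I := by
  rw [TIvl.WF, loCut, hiCut, cut_lt]
  cases I.loC <;> cases I.hiC <;> simp

theorem consecutive_iff {I J : TIvl} : I.Consecutive J ↔ hiCut I = loCut J := by
  rw [TIvl.Consecutive, loCut, hiCut, cut_inj]

theorem mem_iff {t : ℝ} {I : TIvl} : TIvl.Mem t I ↔ loCut I ≤ cut t false ∧ cut t false < hiCut I := by
  rw [TIvl.Mem, loCut, hiCut, cut_lt, cut_le]
  cases I.loC <;> cases I.hiC <;> simp [le_iff_lt_or_eq]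

theorem ivl_ext {I J : TIvl} (h1 : loCut I = loCut J) (h2 : hiCut I = hiCut J) : I = J := by
  rw [loCut, loCut, cut_inj] at h1
  rw [hiCut, hiCut, cut_inj] at h2
  cases I; cases J
  simp_all

/-- The schedule describes the execution. -/
structure Match (ρ : RawExec ℕ) (D : Sched) : Prop where
  n : ρ.n = D.n
  ivls : ρ.ivls.length = D.n
  guards : ρ.guards.length = D.n - 1
  resets : ρ.resets.length = D.n - 1
  lo : ∀ i < D.n, loCut (ρ.ivl i) = D.C i
  hi : ∀ i < D.n, hiCut (ρ.ivl i) = D.C (i + 1)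
  state : ∀ i < D.n, ρ.state i = D.v i
  guard : ∀ i, i + 1 < D.n → ρ.guard i = D.gd i
  reset : ∀ i, i + 1 < D.n → ρ.reset i = D.rs i

theorem getD_map_range {β : Type} (f : ℕ → β) {n i : ℕ} (d : β) (hi : i < n) :
    ((List.range n).map f).getD i d = f i := by
  simp [List.getD_eq_getElem?_getD, hi]

theorem exists_match_of_sched (D : Sched) : ∃ ρ, Match ρ D := by
  refine ⟨⟨(List.range D.n).map D.v, (List.range D.n).map fun i => ⟨time (D.C i), time (D.C (i + 1)),
    !(ofLex (D.C i)).2, (ofLex (D.C (i + 1))).2⟩, (List.range (D.n - 1)).map D.gd,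
    (List.range (D.n - 1)).map D.rs⟩, by simp [RawExec.n], by simp, by simp, by simp,
    fun i hi => ?_, fun i hi => ?_, fun i hi => ?_, fun i hi => ?_, fun i hi => ?_⟩
  · rw [RawExec.ivl, getD_map_range _ _ hi, loCut]
    simp only [Bool.not_not]
    rfl
  · rw [RawExec.ivl, getD_map_range _ _ hi]
    rfl
  · exact getD_map_range _ _ hi
  · exact getD_map_range _ _ (by omega)
  · exact getD_map_range _ _ (by omega)

theorem exists_sched (ρ : RawExec ℕ) (h1 : ρ.ivls.length = ρ.n)
    (h2 : ρ.guards.length = ρ.n - 1) (h3 : ρ.resets.length = ρ.n - 1)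
    (hc : ∀ i, i + 1 < ρ.n → (ρ.ivl i).Consecutive (ρ.ivl (i + 1))) : ∃ D, Match ρ D := by
  refine ⟨⟨ρ.n, fun i => if i < ρ.n then loCut (ρ.ivl i) else hiCut (ρ.ivl (i - 1)), ρ.state,
    ρ.guard, ρ.reset⟩, rfl, h1, h2, h3, fun i hi => (if_pos hi).symm, fun i hi => ?_,
    fun _ _ => rfl, fun _ _ => rfl, fun _ _ => rfl⟩
  simp only at hi ⊢
  split_ifs with h
  · exact consecutive_iff.1 (hc i h)
  · rfl

namespace Match
variable {ρ : RawExec ℕ} {D : Sched} (m : Match ρ D)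
include m

theorem mem {i : ℕ} (hi : i < D.n) {t : ℝ} :
    TIvl.Mem t (ρ.ivl i) ↔ D.C i ≤ cut t false ∧ cut t false < D.C (i + 1) := by
  rw [mem_iff, m.lo i hi, m.hi i hi]

theorem time_lo {i : ℕ} (hi : i < D.n) : (ρ.ivl i).lo = time (D.C i) := by rw [← m.lo i hi]; rfl
theorem time_hi {i : ℕ} (hi : i < D.n) : (ρ.ivl i).hi = time (D.C (i + 1)) := by
  rw [← m.hi i hi]; rfl

theorem mu {i : ℕ} (hi : i < D.n) (x : ℕ) : ρ.mu i x = D.mu i x := by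
  induction i with
  | zero => rfl
  | succ i ih =>
    rw [RawExec.mu, Sched.mu, m.reset i hi, ih (by omega), m.time_hi (by omega), m.time_lo (by omega)]

theorem edge {i : ℕ} (hi : i + 1 < D.n) : ρ.edge i = D.e i := by
  rw [RawExec.edge, Sched.e, m.state i (by omega), m.state _ hi, m.guard i hi, m.reset i hi]

variable {A : TA ℕ} {N : ℕ}

theorem inSem (hg : D.Good N) (hc : D.Cond A) : RawExec.InSem natR A (some (N : ℝ)) ρ := by
  have hn := m.n
  have hpos := hg.pos
  have h00 : cut (ρ.ivl 0).lo (!(ρ.ivl 0).loC) = cut 0 false := (m.lo 0 hpos).trans hg.start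
  rw [cut_inj] at h00
  refine ⟨⟨⟨by omega, m.ivls.trans hn.symm, by rw [m.guards, hn], by rw [m.resets, hn], h00.1,
    by simpa using h00.2, ?_, ?_, ?_, ?_, ?_, ?_⟩, ?_⟩, ?_⟩
  · intro i hi
    rw [wf_iff, m.lo i (by omega), m.hi i (by omega)]
    exact hg.mono i (by omega)
  · intro i hi
    rw [consecutive_iff, m.hi i (by omega), m.lo _ (by omega)]
  · rw [m.state 0 hpos]
    exact hc.init
  · intro i hi
    rw [m.edge (by omega)]
    exact hc.edges i (by omega)
  · intro i hi x hx t ht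
    rw [m.mem (by omega)] at ht
    rw [m.mu (by omega), m.time_lo (by omega), m.state i (by omega)]
    exact hc.inv i (by omega) x hx t ht.1 ht.2
  · intro i hi q hq
    rw [m.guard i (by omega)] at hq
    rw [m.mu (by omega), m.time_lo (by omega), m.time_hi (by omega)]
    exact hc.guard i (by omega) q hq
  · rw [m.state _ (by omega), hn]
    exact hc.final
  · rintro _ ⟨⟩ t ht ⟨i, hi, hm⟩
    rw [m.mem (by omega)] at hm
    exact absurd (hg.lt_N (hm.2.trans_le (hg.le (by omega) le_rfl))) (not_lt.2 ht)

theorem good_cond (h : RawExec.InSem natR A (some (N : ℝ)) ρ) : D.Good N ∧ D.Cond A := by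
  obtain ⟨⟨⟨h1, h2, h3, h4, h5, h6, h7, h8, h9, h10, h11, h12⟩, h13⟩, h14⟩ := h
  rw [m.n] at *
  have hmono : ∀ i < D.n, D.C i < D.C (i + 1) := fun i hi => by
    rw [← m.lo i hi, ← m.hi i hi, ← wf_iff]
    exact h7 i hi
  refine ⟨⟨h1, ?_, hmono, ?_⟩, ⟨?_, ?_, ?_, ?_, ?_⟩⟩
  · rw [← m.lo 0 h1, loCut, h5, h6]
    rfl
  · by_contra hc
    rw [not_le] at hc
    obtain ⟨k, hk⟩ : ∃ k, D.n = k + 1 := ⟨D.n - 1, by omega⟩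
    obtain ⟨t, h15, h16⟩ := exists_point (max_lt hc (hk ▸ hmono k (by omega)))
    refine h14 N rfl t (time_mono ((le_max_left _ _).trans h15)) ⟨k, by rw [m.n]; omega, ?_⟩
    rw [m.mem (by omega), ← hk]
    exact ⟨(le_max_right _ _).trans h15, h16⟩
  · rw [← m.state 0 h1]
    exact h9
  · intro i hi
    rw [← m.edge hi]
    exact h10 i hi
  · intro i hi x hx t h15 h16
    have := h11 i hi x hx t ((m.mem hi).2 ⟨h15, h16⟩)
    rwa [m.mu hi, m.time_lo hi, m.state i hi] at this
  · intro i hi q hq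
    rw [← m.guard i hi] at hq
    have := h12 i hi q hq
    rwa [m.mu (by omega), m.time_lo (by omega), m.time_hi (by omega)] at this
  · rwa [m.state _ (by omega)] at h13

variable {s : ℝ → ℕ} (hg : D.Good N) (hr : D.Rep N s) {t : ℝ} (h0 : 0 ≤ t) (ht : t < N)
include hg hr h0 ht

theorem memLen_iff : RawExec.MemLen t ρ ↔ s t ≠ 0 := by
  rw [hr.alive t h0 ht]
  constructor
  · rintro ⟨i, hi, hm⟩
    rw [m.n] at hi
    exact ((m.mem hi).1 hm).2.trans_le (hg.le hi le_rfl)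
  · intro hc
    obtain ⟨i, hi, hm⟩ := Good.exists_idx (hg.point h0) hc
    exact ⟨i, by rwa [m.n], (m.mem hi).2 hm⟩

theorem stateAt_iff {v : ℕ} : ρ.StateAt t v ↔ s t ≠ 0 ∧ stL (s t) = v := by
  rw [hr.alive t h0 ht]
  constructor
  · rintro ⟨i, hi, hm, rfl⟩
    rw [m.n] at hi
    rw [m.mem hi] at hm
    exact ⟨hm.2.trans_le (hg.le hi le_rfl), by rw [hr.state t i hi hm.1 hm.2, m.state i hi]⟩
  · rintro ⟨hc, rfl⟩
    obtain ⟨i, hi, hm⟩ := Good.exists_idx (hg.point h0) hc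
    exact ⟨i, by rwa [m.n], (m.mem hi).2 hm, by rw [hr.state t i hi hm.1 hm.2, m.state i hi]⟩

end Match

/-! ### Equality of prefixes -/

/-- The schedules agree up to the time `t`, which lies in the `j`-th interval of both. -/
structure DAgree (D D' : Sched) (t : ℝ) (j : ℕ) : Prop where
  lt : j < D.n
  lt' : j < D'.n
  C : ∀ i ≤ j, D.C i = D'.C i
  v : ∀ i ≤ j, D.v i = D'.v i
  gd : ∀ i < j, D.gd i = D'.gd i
  rs : ∀ i < j, D.rs i = D'.rs i
  lo : D.C j ≤ cut t false
  hi : cut t false < D.C (j + 1)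
  hi' : cut t false < D'.C (j + 1)

theorem DAgree.symm {D D' : Sched} {t : ℝ} {j : ℕ} (h : DAgree D D' t j) : DAgree D' D t j :=
  ⟨h.lt', h.lt, fun i hi => (h.C i hi).symm, fun i hi => (h.v i hi).symm,
    fun i hi => (h.gd i hi).symm, fun i hi => (h.rs i hi).symm, by rw [← h.C j le_rfl]; exact h.lo,
    h.hi', h.hi⟩

theorem take_eq_iff {α : Type} {l l' : List α} {k : ℕ} (d : α) (h : k ≤ l.length) (h' : k ≤ l'.length) :
    l.take k = l'.take k ↔ ∀ i < k, l.getD i d = l'.getD i d := by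
  constructor
  · intro heq i hi
    rw [List.getD_eq_getElem?_getD, List.getD_eq_getElem?_getD, ← List.getElem?_take_of_lt hi, heq,
      List.getElem?_take_of_lt hi]
  · intro heq
    refine List.ext_getElem (by simp [h, h']) fun i h1 h2 => ?_
    have hi : i < k := by simp at h1; omega
    have := heq i hi
    rw [List.getD_eq_getElem _ _ (by omega), List.getD_eq_getElem _ _ (by omega)] at this
    simpa using this

section
variable {ρ ρ' : RawExec ℕ} {D D' : Sched} {N : ℕ} {t : ℝ} {j : ℕ}

open Classical in
theorem Match.idxAt_eq (m : Match ρ D) (hg : D.Good N) (hj : j < D.n) (h1 : D.C j ≤ cut t false)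
    (h2 : cut t false < D.C (j + 1)) : ρ.idxAt t = j := by
  have hl := m.ivls
  have hivl : ∀ i (hi : i < ρ.ivls.length), ρ.ivls[i] = ρ.ivl i := fun i hi => by
    rw [RawExec.ivl, List.getD_eq_getElem _ _ hi]
  rw [RawExec.idxAt, List.findIdx_eq (by omega)]
  refine ⟨?_, fun i hi => ?_⟩
  · rw [decide_eq_true_iff, hivl, m.mem hj]
    exact ⟨h1, h2⟩
  · rw [decide_eq_false_iff_not, hivl, m.mem (by omega)]
    rintro ⟨h3, h4⟩
    exact absurd (hg.idx_unique (by omega) hj h3 h4 h1 h2) hi.ne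

open Classical in
theorem Match.eqUpTo_iff (m : Match ρ D) (m' : Match ρ' D') (hg : D.Good N) (hg' : D'.Good N)
    (hj : j < D'.n) (h1 : D'.C j ≤ cut t false) (h2 : cut t false < D'.C (j + 1)) :
    RawExec.EqUpTo ρ ρ' t ↔ DAgree D D' t j := by
  have hn : ρ.states.length = D.n := m.n
  have hn' : ρ'.states.length = D'.n := m'.n
  have hl := m.ivls
  have hl' := m'.ivls
  have hi' := m'.idxAt_eq hg' hj h1 h2
  have hgl := m.guards
  have hgl' := m'.guards
  have hrl := m.resets
  have hrl' := m'.resets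
  constructor
  · intro he
    rw [RawExec.EqUpTo, RawExec.prefixUpTo, RawExec.prefixUpTo, hi'] at he
    simp only [RawExec.mk.injEq] at he
    obtain ⟨hs, hI, hgd, hrs⟩ := he
    have hs' := congrArg List.length hs
    have hI' := congrArg List.length hI
    simp only [List.length_take, List.length_append, List.length_singleton] at hs' hI'
    have hk : ρ.idxAt t = j := by omega
    have hlt : j < D.n := by omega
    have hmem : TIvl.Mem t (ρ.ivl j) := by
      have hlt' : ρ.idxAt t < ρ.ivls.length := by omega
      have h3 := List.findIdx_getElem (w := hlt')
      rw [decide_eq_true_iff] at h3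
      rw [← hk, RawExec.ivl, List.getD_eq_getElem _ _ hlt']
      exact h3
    rw [m.mem hlt] at hmem
    rw [hk] at hs hI hgd hrs
    obtain ⟨hI1, hI2⟩ := List.append_inj hI (by simp; omega)
    rw [take_eq_iff 0 (by omega) (by omega)] at hs
    rw [take_eq_iff default (by omega) (by omega)] at hI1
    rw [take_eq_iff [] (by omega) (by omega)] at hgd hrs
    simp only [List.cons.injEq, TIvl.mk.injEq, and_true, true_and] at hI2
    refine ⟨hlt, hj, fun i hi => ?_, fun i hi => ?_, fun i hi => ?_, fun i hi => ?_, hmem.1, hmem.2, h2⟩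
    · rw [← m.lo i (by omega), ← m'.lo i (by omega)]
      rcases hi.lt_or_eq with hi | rfl
      · rw [RawExec.ivl, hI1 i hi]; rfl
      · rw [loCut, loCut, hI2.1, hI2.2]
    · rw [← m.state i (by omega), ← m'.state i (by omega)]
      exact hs i (by omega)
    · rw [← m.guard i (by omega), ← m'.guard i (by omega)]
      exact hgd i hi
    · rw [← m.reset i (by omega), ← m'.reset i (by omega)]
      exact hrs i hi
  · intro h
    have hlt := h.lt
    have hi := m.idxAt_eq hg h.lt h.lo h.hi
    rw [RawExec.EqUpTo, RawExec.prefixUpTo, RawExec.prefixUpTo, hi, hi']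
    have hlo : ∀ i ≤ j, loCut (ρ.ivl i) = loCut (ρ'.ivl i) := fun i hi => by
      rw [m.lo i (by omega), m'.lo i (by omega), h.C i hi]
    have hloj := hlo j le_rfl
    rw [loCut, loCut, cut_inj, Bool.not_inj_iff] at hloj
    simp only [RawExec.mk.injEq]
    refine ⟨?_, ?_, ?_, ?_⟩
    · rw [take_eq_iff 0 (by omega) (by omega)]
      intro i hi
      have := h.v i (by omega)
      rwa [← m.state i (by omega), ← m'.state i (by omega)] at this
    · rw [hloj.1, hloj.2]
      congr 1
      rw [take_eq_iff default (by omega) (by omega)]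
      intro i hi
      exact ivl_ext (hlo i hi.le) (show hiCut (ρ.ivl i) = hiCut (ρ'.ivl i) by
        rw [m.hi i (by omega), m'.hi i (by omega), h.C _ hi])
    · rw [take_eq_iff [] (by omega) (by omega)]
      intro i hi
      have := h.gd i hi
      rwa [← m.guard i (by omega), ← m'.guard i (by omega)] at this
    · rw [take_eq_iff [] (by omega) (by omega)]
      intro i hi
      have := h.rs i hi
      rwa [← m.reset i (by omega), ← m'.reset i (by omega)] at this

variable {s s' : ℝ → ℕ}

theorem DAgree.ev_le (h : DAgree D D' t j) (hg : D.Good N) (hr : D.Rep N s)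
    (hr' : D'.Rep N s') {u : ℝ} {b : Bool} (h0 : 0 ≤ u) (hN : u < N) (hu : cut u b ≤ cut t false)
    (hne : ev s (cut u b) ≠ 0) : ev s (cut u b) = ev s' (cut u b) := by
  have hlt := h.lt
  have hlt' := h.lt'
  obtain ⟨i, hi, hc⟩ := hr.noev u h0 hN b hne
  have hij : i + 1 < j + 1 := (hg.lt_iff hi.le hlt).1 (hc ▸ hu.trans_lt h.hi)
  have h1 : D.C (i + 1) = D'.C (i + 1) := h.C _ (by omega)
  rw [hc, hr.event i hi, h1, hr'.event i (by omega), e, e, h.v i (by omega), h.v _ (by omega),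
    h.gd i (by omega), h.rs i (by omega)]

theorem DAgree.agree (h : DAgree D D' t j) (hg : D.Good N) (hg' : D'.Good N) (hr : D.Rep N s)
    (hr' : D'.Rep N s') : Agree N s s' t := by
  intro u h0 hN hu
  have hlt := h.lt
  have hlt' := h.lt'
  have hev : ∀ b, cut u b ≤ cut t false → evL b (s u) = evL b (s' u) := by
    intro b hc
    rw [← ev_cut, ← ev_cut]
    by_cases h1 : ev s (cut u b) = 0
    · by_cases h2 : ev s' (cut u b) = 0
      · rw [h1, h2]
      · exact (h.symm.ev_le hg' hr' hr h0 hN hc h2).symm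
    · exact h.ev_le hg hr hr' h0 hN hc h1
  have hcut : cut u false ≤ cut t false := cut_le.2 (hu.lt_or_eq.imp_right fun h => ⟨h, le_rfl⟩)
  have hal : cut u false < D.C D.n := (hcut.trans_lt h.hi).trans_le (hg.le hlt le_rfl)
  obtain ⟨i, hi, h1, h2⟩ := Good.exists_idx (hg.point h0) hal
  have hij : i < j + 1 := (hg.lt_iff hi.le hlt).1 (h1.trans_lt (hcut.trans_lt h.hi))
  refine ⟨⟨(hr.alive u h0 hN).2 hal, (hr'.alive u h0 hN).2
    ((hcut.trans_lt h.hi').trans_le (hg'.le hlt' le_rfl)), ?_, hev false hcut⟩,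
    fun hlt => hev true (cut_le.2 (Or.inl hlt))⟩
  rw [hr.state u i hi h1 h2, h.v i (by omega)]
  refine (hr'.state u i (by omega) (by rw [← h.C i (by omega)]; exact h1) ?_).symm
  rcases (Nat.lt_succ_iff.1 hij).lt_or_eq with h3 | rfl
  · rw [← h.C _ h3]; exact h2
  · exact hcut.trans_lt h.hi'

theorem Agree.ev_eq (h : Agree N s s' t) {c : Cut} (h0 : 0 ≤ time c) (hN : time c < N)
    (hc : c ≤ cut t false) : ev s c = ev s' c := by
  obtain ⟨u, b, rfl⟩ := exists_cut c
  have hu : u ≤ t := time_mono hc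
  cases b
  · exact (h u h0 hN hu).1.2.2.2
  · exact (h u h0 hN hu).2 ((cut_le.1 hc).resolve_right (by simp))

theorem Agree.dAgree (h : Agree N s s' t) (hg : D.Good N) (hg' : D'.Good N) (hr : D.Rep N s)
    (hr' : D'.Rep N s') (h0 : 0 ≤ t) (hN : t < N) (hj : j < D'.n) (h1 : D'.C j ≤ cut t false)
    (h2 : cut t false < D'.C (j + 1)) : DAgree D D' t j := by
  have hal := (hr.alive t h0 hN).1 (h t h0 hN le_rfl).1.1
  have hC : ∀ i ≤ j, i < D.n ∧ D.C i = D'.C i ∧ ∀ k < i, D.e k = D'.e k := by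
    intro i
    induction i with
    | zero => exact fun _ => ⟨hg.pos, by rw [hg.start, hg'.start], fun k hk => absurd hk (by omega)⟩
    | succ i ih =>
      intro hi
      obtain ⟨h3, h4, h5⟩ := ih (by omega)
      have h6 := hg'.time_C (i := i + 1) (by omega)
      have hle : D'.C (i + 1) ≤ cut t false := (hg'.le hi hj.le).trans h1
      have h7 := h.ev_eq h6.1 h6.2 hle
      rw [hr'.event i (by omega)] at h7
      obtain ⟨k, hk, hc⟩ := hr.noev _ h6.1 h6.2 (ofLex (D'.C (i + 1))).2
        (by rw [cut_time, h7]; exact Nat.succ_ne_zero _)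
      rw [cut_time] at hc
      rw [hc, hr.event k hk, Nat.add_right_cancel_iff] at h7
      have h8 : i < k + 1 := (hg.lt_iff h3.le hk.le).1 (by
        rw [h4, ← hc]; exact hg'.mono i (by omega))
      have hki : k = i := by
        by_contra hne
        have hlt : D.C (i + 1) < D.C (k + 1) := hg.lt (by omega) hk.le
        have h9 := hg.time_C (i := i + 1) (by omega)
        have h10 := h.ev_eq h9.1 h9.2 (hlt.le.trans (hc ▸ hle))
        rw [hr.event i (by omega)] at h10
        obtain ⟨l, hl, hc'⟩ := hr'.noev _ h9.1 h9.2 (ofLex (D.C (i + 1))).2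
          (by rw [cut_time, ← h10]; exact Nat.succ_ne_zero _)
        rw [cut_time] at hc'
        have h11 := (hg'.lt_iff (i := i) (by omega) hl.le).1 (by rw [← hc', ← h4]; exact hg.mono i h3)
        have h12 := (hg'.lt_iff (j := i + 1) hl.le (by omega)).1 (by rw [← hc', hc]; exact hlt)
        omega
      subst hki
      refine ⟨hk, hc.symm, fun l hl => ?_⟩
      rcases (Nat.lt_succ_iff.1 hl).lt_or_eq with h13 | rfl
      · exact h5 l h13
      · exact encIEdge_injective h7
  have hv : ∀ i ≤ j, D.v i = D'.v i := by
    intro i hi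
    obtain ⟨h3, h4, -⟩ := hC i hi
    have h5 : D.C i < cut t true := by
      rw [h4, lt_cut_true]; exact (hg'.le hi hj.le).trans h1
    obtain ⟨u, h6, h7⟩ := exists_point (lt_min h5 (lt_min (hg.mono i h3)
      (h4 ▸ hg'.mono i (by omega))))
    rw [lt_min_iff, lt_min_iff, lt_cut_true] at h7
    have hut : u ≤ t := time_mono h7.1
    rw [← hr.state u i h3 h6 h7.2.1, ← hr'.state u i (by omega) (h4 ▸ h6) h7.2.2]
    exact (h u (hg.nonneg h3.le h6) (by linarith) hut).1.2.2.1
  obtain ⟨h3, h4, h5⟩ := hC j le_rfl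
  refine ⟨h3, hj, fun i hi => (hC i hi).2.1, hv, fun i hi => ?_, fun i hi => ?_, h4 ▸ h1, ?_, h2⟩
  · exact congrArg (fun e => e.2.2.1) (h5 i hi)
  · exact congrArg (fun e => e.2.2.2) (h5 i hi)
  · by_contra hc
    rw [not_lt] at hc
    have hj1 : j + 1 < D.n := (hg.lt_iff h3 le_rfl).1 (hc.trans_lt hal)
    have h9 := hg.time_C hj1
    have h10 := h.ev_eq h9.1 h9.2 hc
    rw [hr.event j hj1] at h10
    obtain ⟨l, hl, hc'⟩ := hr'.noev _ h9.1 h9.2 (ofLex (D.C (j + 1))).2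
      (by rw [cut_time, ← h10]; exact Nat.succ_ne_zero _)
    rw [cut_time] at hc'
    have h11 := (hg'.lt_iff hj.le hl.le).1 (by rw [← hc', ← h4]; exact hg.mono j h3)
    have h12 := (hg'.lt_iff hl.le hj).1 (hc' ▸ hc.trans_lt h2)
    omega

theorem Match.eqUpTo_iff_agree (m : Match ρ D) (m' : Match ρ' D') (hg : D.Good N)
    (hg' : D'.Good N) (hr : D.Rep N s) (hr' : D'.Rep N s') (h0 : 0 ≤ t) (hN : t < N)
    (hm : RawExec.MemLen t ρ') : RawExec.EqUpTo ρ ρ' t ↔ Agree N s s' t := by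
  obtain ⟨j, hj, hm⟩ := hm
  rw [m'.n] at hj
  obtain ⟨h1, h2⟩ := (m'.mem hj).1 hm
  rw [m.eqUpTo_iff m' hg hg' hj h1 h2]
  exact ⟨fun h => h.agree hg hg' hr hr', fun h => h.dAgree hg hg' hr hr' h0 hN hj h1 h2⟩

end
end HyTime

namespace HyTime

open Sched

/-! ### Satisfaction over traces -/

/-- A bound for the letters of the traces. -/
def letters (a : ℕ) : ℕ := mkL a a a + 1

def Linked {Λ : Type} (ag : Λ → Λ → Prop) (S : ℕ → Λ) (t : ℝ) (d : Option ℕ) (s : Λ) : Prop :=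
  (d = none ∧ t = 0) ∨ ∃ d₀, d = some d₀ ∧ ag s (S d₀)

/-- The satisfaction relation over traces of executions. -/
def TSat {b : ℕ} (A : TA ℕ) (N : ℕ) : HF ℕ → (ℕ → ℝ → Fin b) → ℝ → Option ℕ → Prop
  | .pos p π, S, t, _ => (S π t : ℕ) ≠ 0 ∧ p ∈ A.labelOf (stL (S π t))
  | .neg p π, S, t, _ => (S π t : ℕ) ≠ 0 ∧ p ∉ A.labelOf (stL (S π t))
  | .disj φ ψ, S, t, d => TSat A N φ S t d ∨ TSat A N ψ S t d
  | .conj φ ψ, S, t, d => TSat A N φ S t d ∧ TSat A N ψ S t d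
  | .fut I φ, S, t, d => ∃ t' : ℝ, t < t' ∧ t' < N ∧ FIvl.Mem natR t t' I ∧ TSat A N φ S t' d
  | .glob I φ, S, t, d => ∀ t' : ℝ, t < t' → t' < N → FIvl.Mem natR t t' I → TSat A N φ S t' d
  | .untl I φ ψ, S, t, d => ∃ t' : ℝ, t < t' ∧ t' < N ∧ FIvl.Mem natR t t' I ∧
      TSat A N ψ S t' d ∧ ∀ t'' : ℝ, t < t'' → t'' < t' → TSat A N φ S t'' d
  | .ex π φ, S, t, d => ∃ s : ℝ → Fin b, FV N s ∧ Valid A N (fun t => s t) ∧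
      Linked (fun s s' : ℝ → Fin b => Agree N (fun t => s t) (fun t => s' t) t) S t d s ∧
      TSat A N φ (Function.update S π s) t (some π)
  | .all π φ, S, t, d => ∀ s : ℝ → Fin b, FV N s → Valid A N (fun t => s t) →
      Linked (fun s s' : ℝ → Fin b => Agree N (fun t => s t) (fun t => s' t) t) S t d s →
      TSat A N φ (Function.update S π s) t (some π)

/-- The signal `s` is the trace of the execution `ρ`. -/
def TraceOf (N : ℕ) (ρ : RawExec ℕ) (s : ℝ → ℕ) : Prop :=
  ∃ D, Match ρ D ∧ D.Good N ∧ D.Rep N s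

/-- The states of `ρ` can be read off the signal `s`. -/
def Shows (N : ℕ) (ρ : RawExec ℕ) (s : ℝ → ℕ) : Prop := ∀ t : ℝ, 0 ≤ t → t < N →
  (RawExec.MemLen t ρ ↔ s t ≠ 0) ∧ ∀ v, ρ.StateAt t v ↔ s t ≠ 0 ∧ stL (s t) = v

theorem TraceOf.shows {N : ℕ} {ρ : RawExec ℕ} {s : ℝ → ℕ} (h : TraceOf N ρ s) : Shows N ρ s := by
  obtain ⟨D, hm, hg, hr⟩ := h
  exact fun t h0 ht => ⟨hm.memLen_iff hg hr h0 ht, fun v => hm.stateAt_iff hg hr h0 ht⟩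

theorem TraceOf.eqUpTo_iff {N : ℕ} {ρ ρ' : RawExec ℕ} {s s' : ℝ → ℕ} (h : TraceOf N ρ s)
    (h' : TraceOf N ρ' s') {t : ℝ} (h0 : 0 ≤ t) (ht : t < N) :
    RawExec.MemLen t ρ' ∧ RawExec.EqUpTo ρ ρ' t ↔ Agree N s s' t := by
  obtain ⟨D, hm, hg, hr⟩ := h
  obtain ⟨D', hm', hg', hr'⟩ := h'
  constructor
  · rintro ⟨hl, he⟩
    exact (hm.eqUpTo_iff_agree hm' hg hg' hr hr' h0 ht hl).1 he
  · intro ha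
    have hl := (hm'.memLen_iff hg' hr' h0 ht).2 (ha t h0 ht le_rfl).1.2.1
    exact ⟨hl, (hm.eqUpTo_iff_agree hm' hg hg' hr hr' h0 ht hl).2 ha⟩

theorem exists_trace {A : TA ℕ} {N : ℕ} {ρ : RawExec ℕ}
    (h : RawExec.InSem natR A (some (N : ℝ)) ρ) : ∃ s : ℝ → Fin (letters (encTA A)), FV N s ∧
      Valid A N (fun t => s t) ∧ TraceOf N ρ fun t => s t := by
  obtain ⟨⟨⟨-, h1, h2, h3, -, -, -, h4, -⟩, -⟩, -⟩ := id h
  obtain ⟨D, hm⟩ := exists_sched ρ h1 h2 h3 h4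
  obtain ⟨hg, hc⟩ := hm.good_cond h
  refine ⟨fun t => ⟨D.trace t, Nat.lt_succ_of_le (trace_le hc t)⟩, fun j hj => ?_,
    fun x _ g _ => hg.rep.tv hg hc x g, D, hm, hg, hg.rep⟩
  obtain ⟨F, hF⟩ := hg.fv j hj
  exact ⟨F, fun t u h1 h2 h3 h4 => Fin.ext (hF t u h1 h2 h3 h4)⟩

theorem exists_exec {A : TA ℕ} {N b : ℕ} (hN : 0 < N) {s : ℝ → Fin b} (hs : FV N s)
    (hv : Valid A N fun t => s t) :
    ∃ ρ, RawExec.InSem natR A (some (N : ℝ)) ρ ∧ TraceOf N ρ fun t => s t := by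
  obtain ⟨D, hg, hr⟩ := hv.exists_sched hN fun j hj => (hs j hj).comp (fun x : Fin b => (x : ℕ))
  obtain ⟨ρ, hm⟩ := exists_match_of_sched D
  exact ⟨ρ, hm.inSem hg (hr.cond hg hv), D, hm, hg, hr⟩

theorem hSat_iff_tSat {A : TA ℕ} {N : ℕ} (hN : 0 < N) (φ : HF ℕ) :
    ∀ (Env : ℕ → RawExec ℕ) (S : ℕ → ℝ → Fin (letters (encTA A))) (t : ℝ) (d : Option ℕ),
      0 ≤ t → t < N → (∀ π, Shows N (Env π) fun t => S π t) →
      (∀ d₀, d = some d₀ → TraceOf N (Env d₀) fun t => S d₀ t) →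
      (HSat natR A (some (N : ℝ)) φ Env t d ↔ TSat A N φ S t d) := by
  have key : ∀ (Env : ℕ → RawExec ℕ) (S : ℕ → ℝ → Fin (letters (encTA A))) (t : ℝ) (d : Option ℕ)
      (π : ℕ) (φ : HF ℕ), (∀ (Env : ℕ → RawExec ℕ) (S : ℕ → ℝ → Fin (letters (encTA A))) (t : ℝ)
        (d : Option ℕ), 0 ≤ t → t < N → (∀ π, Shows N (Env π) fun t => S π t) →
        (∀ d₀, d = some d₀ → TraceOf N (Env d₀) fun t => S d₀ t) →
        (HSat natR A (some (N : ℝ)) φ Env t d ↔ TSat A N φ S t d)) →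
      0 ≤ t → t < N → (∀ π, Shows N (Env π) fun t => S π t) →
      (∀ d₀, d = some d₀ → TraceOf N (Env d₀) fun t => S d₀ t) → ∀ ρ s, TraceOf N ρ (fun t => s t) →
      (((d = none ∧ t = 0) ∨ ∃ d₀, d = some d₀ ∧ RawExec.MemLen t (Env d₀) ∧
          RawExec.EqUpTo ρ (Env d₀) t) ↔
        Linked (fun s s' : ℝ → Fin _ => Agree N (fun t => s t) (fun t => s' t) t) S t d s) ∧
      (HSat natR A (some (N : ℝ)) φ (Function.update Env π ρ) t (some π) ↔
        TSat A N φ (Function.update S π s) t (some π)) := by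
    intro Env S t d π φ ih h0 ht hsh hd ρ s hs
    constructor
    · refine or_congr Iff.rfl (exists_congr fun d₀ => and_congr_right fun hd₀ => ?_)
      exact hs.eqUpTo_iff (hd d₀ hd₀) h0 ht
    · refine ih _ _ _ _ h0 ht (fun π' => ?_) fun d₀ hd₀ => ?_
      · by_cases h : π' = π
        · subst h; simpa using hs.shows
        · simpa [h] using hsh π'
      · obtain rfl := Option.some_injective _ hd₀
        simpa using hs
  induction φ with
  | pos p π =>
    intro Env S t d h0 ht hsh _
    obtain ⟨h1, h2⟩ := hsh π t h0 ht
    simp only [HSat, TSat, h1, h2]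
    constructor
    · rintro ⟨h, v, ⟨-, rfl⟩, h3⟩
      exact ⟨h, h3⟩
    · rintro ⟨h, h3⟩
      exact ⟨h, _, ⟨h, rfl⟩, h3⟩
  | neg p π =>
    intro Env S t d h0 ht hsh _
    obtain ⟨h1, h2⟩ := hsh π t h0 ht
    simp only [HSat, TSat, h1, h2]
    constructor
    · rintro ⟨h, v, ⟨-, rfl⟩, h3⟩
      exact ⟨h, h3⟩
    · rintro ⟨h, h3⟩
      exact ⟨h, _, ⟨h, rfl⟩, h3⟩
  | disj φ ψ ih1 ih2 =>
    intro Env S t d h0 ht hsh hd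
    exact or_congr (ih1 Env S t d h0 ht hsh hd) (ih2 Env S t d h0 ht hsh hd)
  | conj φ ψ ih1 ih2 =>
    intro Env S t d h0 ht hsh hd
    exact and_congr (ih1 Env S t d h0 ht hsh hd) (ih2 Env S t d h0 ht hsh hd)
  | fut I φ ih =>
    intro Env S t d h0 ht hsh hd
    exact exists_congr fun t' => and_congr_right fun h1 => and_congr_right fun h2 =>
      and_congr_right fun _ => ih Env S t' d (h0.trans h1.le) h2 hsh hd
  | glob I φ ih =>
    intro Env S t d h0 ht hsh hd
    exact forall_congr' fun t' => forall_congr' fun h1 => forall_congr' fun h2 =>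
      forall_congr' fun _ => ih Env S t' d (h0.trans h1.le) h2 hsh hd
  | untl I φ ψ ih1 ih2 =>
    intro Env S t d h0 ht hsh hd
    exact exists_congr fun t' => and_congr_right fun h1 => and_congr_right fun (h2 : t' < N) =>
      and_congr_right fun _ => and_congr (ih2 Env S t' d (h0.trans h1.le) h2 hsh hd)
      (forall_congr' fun t'' => forall_congr' fun h3 => forall_congr' fun h4 =>
        ih1 Env S t'' d (h0.trans h3.le) (h4.trans h2) hsh hd)
  | ex π φ ih =>
    intro Env S t d h0 ht hsh hd
    have key := key Env S t d π φ ih h0 ht hsh hd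
    constructor
    · rintro ⟨ρ, h1, h2, h3⟩
      obtain ⟨s, h4, h5, h6⟩ := exists_trace h1
      obtain ⟨h7, h8⟩ := key ρ s h6
      exact ⟨s, h4, h5, h7.1 h2, h8.1 h3⟩
    · rintro ⟨s, h1, h2, h3, h4⟩
      obtain ⟨ρ, h5, h6⟩ := exists_exec hN h1 h2
      obtain ⟨h7, h8⟩ := key ρ s h6
      exact ⟨ρ, h5, h7.2 h3, h8.2 h4⟩
  | all π φ ih =>
    intro Env S t d h0 ht hsh hd
    have key := key Env S t d π φ ih h0 ht hsh hd
    constructor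
    · intro h s h1 h2 h3
      obtain ⟨ρ, h5, h6⟩ := exists_exec hN h1 h2
      obtain ⟨h7, h8⟩ := key ρ s h6
      exact h8.1 (h ρ h5 (h7.2 h3))
    · intro h ρ h1 h2
      obtain ⟨s, h4, h5, h6⟩ := exists_trace h1
      obtain ⟨h7, h8⟩ := key ρ s h6
      exact h8.2 (h s h4 h5 (h7.1 h2))

/-- Initially no path is quantified. -/
theorem shows_default (N : ℕ) : Shows N default fun _ => 0 := by
  have h : (default : RawExec ℕ).n = 0 := rfl
  exact fun t _ _ => ⟨by simp [RawExec.MemLen, h], fun v => by simp [RawExec.StateAt, h]⟩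

end HyTime

namespace HyTime

/-! ### Evaluation of coded sentences -/

/-- The value at the grid point `q` of the signal of the path `π`. -/
def dig (b L env π q : ℕ) : ℕ := env / b ^ (π * L + q) % b

@[fun_prop] theorem PR.dig {α : Type} [Primcodable α] {b L e p q : α → ℕ} (hb : PR b) (hL : PR L)
    (he : PR e) (hp : PR p) (hq : PR q) :
    PR fun x => dig (b x) (L x) (e x) (p x) (q x) := by
  unfold HyTime.dig; fun_prop

/-- Membership in a coded interval, in units of `1 / G`. -/
def fMemN (G i t t' : ℕ) : Bool :=
  (bif Nat.beq i.unpair.2.unpair.2.unpair.1 0 then Nat.blt (t + i.unpair.1 * G) t'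
    else Nat.ble (t + i.unpair.1 * G) t') &&
  (Nat.beq i.unpair.2.unpair.1 0 || bif Nat.beq i.unpair.2.unpair.2.unpair.2 0
    then Nat.blt t' (t + (i.unpair.2.unpair.1 - 1) * G)
    else Nat.ble t' (t + (i.unpair.2.unpair.1 - 1) * G))

@[fun_prop] theorem PR.fMemN {α : Type} [Primcodable α] {G i t t' : α → ℕ} (hG : PR G) (hi : PR i)
    (ht : PR t) (ht' : PR t') : PR fun x => fMemN (G x) (i x) (t x) (t' x) := by
  unfold HyTime.fMemN; fun_prop

theorem fMemN_iff {G tq tq' : ℕ} {t t' : ℝ} (hG : 0 < G) (I : FIvl ℕ) (ht : t * G = tq)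
    (ht' : t' * G = tq') : FIvl.Mem natR t t' I ↔ fMemN G (encFIvl I) tq tq' = true := by
  have hG' : (0 : ℝ) < G := by exact_mod_cast hG
  obtain ⟨lo, hi, c, c'⟩ := I
  have e1 : ∀ n : ℕ, t + n < t' ↔ tq + n * G < tq' := fun n => by
    rw [← mul_lt_mul_iff_of_pos_right hG', add_mul, ht, ht']; norm_cast
  have e2 : ∀ n : ℕ, t + n ≤ t' ↔ tq + n * G ≤ tq' := fun n => by
    rw [← mul_le_mul_iff_of_pos_right hG', add_mul, ht, ht']; norm_cast
  have e3 : ∀ n : ℕ, t' < t + n ↔ tq' < tq + n * G := fun n => by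
    rw [← mul_lt_mul_iff_of_pos_right hG', add_mul, ht, ht']; norm_cast
  have e4 : ∀ n : ℕ, t' ≤ t + n ↔ tq' ≤ tq + n * G := fun n => by
    rw [← mul_le_mul_iff_of_pos_right hG', add_mul, ht, ht']; norm_cast
  cases c <;> cases c' <;> cases hi <;> simp [FIvl.Mem, fMemN, encFIvl, natR, e1, e2, e3, e4]

/-- The trace of the path `π` in `env` is valid. -/
def validN (a N b B K env π k t : ℕ) : Bool := ball (a + 1) fun x => ball (a + 1) fun g =>
  Fo.evalN N B K (a, x, g) (fun _ q => dig b (N * B ^ K) env π q) Fo.valid k [t]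

@[fun_prop] theorem PR.validN {α : Type} [Primcodable α] {a N b B K e p k t : α → ℕ} (ha : PR a)
    (hN : PR N) (hb : PR b) (hB : PR B) (hK : PR K) (he : PR e) (hp : PR p) (hk : PR k)
    (ht : PR t) :
    PR fun x => validN (a x) (N x) (b x) (B x) (K x) (e x) (p x) (k x) (t x) := by
  unfold HyTime.validN
  refine PR.ball (by fun_prop) (PR.ball (by fun_prop) (Fo.pr_evalN _ ?_ ?_ ?_ ?_ ?_ ?_ ?_)) <;>
    fun_prop

/-- The trace of the path `π` in `env` agrees with the trace of `π'` in `env'` up to time `t`. -/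
def agreeN (N b B K env π env' π' k t : ℕ) : Bool :=
  Fo.evalN N B K (0, 0, 0) (fun i q => bif Nat.beq i 0 then dig b (N * B ^ K) env π q
    else dig b (N * B ^ K) env' π' q) Fo.agree k [t]

@[fun_prop] theorem PR.agreeN {α : Type} [Primcodable α] {N b B K e p e' p' k t : α → ℕ}
    (hN : PR N) (hb : PR b) (hB : PR B) (hK : PR K) (he : PR e) (hp : PR p) (he' : PR e')
    (hp' : PR p') (hk : PR k) (ht : PR t) :
    PR fun x => agreeN (N x) (b x) (B x) (K x) (e x) (p x) (e' x) (p' x) (k x) (t x) := by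
  unfold HyTime.agreeN
  refine Fo.pr_evalN _ ?_ ?_ ?_ ?_ ?_ ?_ ?_ <;> fun_prop

/-- The environment `env'` only differs from `env` in the signal of `π`, which is aligned to the
grid of level `k`. -/
def changeN (N b B K V env env' π k : ℕ) : Bool :=
  (ball V fun i => ball (N * B ^ K) fun q => Nat.beq i π ||
    Nat.beq (dig b (N * B ^ K) env' i q) (dig b (N * B ^ K) env i q)) &&
  ball (N * B ^ K) fun q => Nat.beq (q % B ^ (K - k)) 0 ||
    Nat.beq (dig b (N * B ^ K) env' π q)
      (dig b (N * B ^ K) env' π (q / B ^ (K - k) * B ^ (K - k) + 1))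

@[fun_prop] theorem PR.changeN {α : Type} [Primcodable α] {N b B K V e e' p k : α → ℕ}
    (hN : PR N) (hb : PR b) (hB : PR B) (hK : PR K) (hV : PR V) (he : PR e) (he' : PR e')
    (hp : PR p) (hk : PR k) :
    PR fun x => changeN (N x) (b x) (B x) (K x) (V x) (e x) (e' x) (p x) (k x) := by
  unfold HyTime.changeN; fun_prop

/-- The new signal is the trace of an execution extending the last quantified one. -/
def newN (a N b B K env env' π t d k : ℕ) : Bool :=
  validN a N b B K env' π k t && (Nat.beq d 0 && Nat.beq t 0 ||
    !Nat.beq d 0 && agreeN N b B K env' π env (d - 1) k t)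

@[fun_prop] theorem PR.newN {α : Type} [Primcodable α] {a N b B K e e' p t d k : α → ℕ}
    (ha : PR a) (hN : PR N) (hb : PR b) (hB : PR B) (hK : PR K) (he : PR e) (he' : PR e')
    (hp : PR p) (ht : PR t) (hd : PR d) (hk : PR k) :
    PR fun x => newN (a x) (N x) (b x) (B x) (K x) (e x) (e' x) (p x) (t x) (d x) (k x) := by
  unfold HyTime.newN; fun_prop

/-- The later grid points of level `k` in the coded interval `i`. -/
def timeN (B K i t q k : ℕ) : Bool :=
  Nat.blt t q && fMemN (B ^ K) i t q && Nat.beq (q % B ^ (K - k)) 0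

@[fun_prop] theorem PR.timeN {α : Type} [Primcodable α] {B K i t q k : α → ℕ} (hB : PR B)
    (hK : PR K) (hi : PR i) (ht : PR t) (hq : PR q) (hk : PR k) :
    PR fun x => timeN (B x) (K x) (i x) (t x) (q x) (k x) := by
  unfold HyTime.timeN; fun_prop

def pack (env t d k : ℕ) : ℕ := Nat.pair env (Nat.pair t (Nat.pair d k))

/-- A bound for the codes of the states of the evaluation. -/
def cap (N b B K V : ℕ) : ℕ := pack (b ^ (V * (N * B ^ K))) (N * B ^ K) V K + 1

@[fun_prop] theorem PR.pack {α : Type} [Primcodable α] {e t d k : α → ℕ} (he : PR e) (ht : PR t)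
    (hd : PR d) (hk : PR k) : PR fun x => pack (e x) (t x) (d x) (k x) := by
  unfold HyTime.pack; fun_prop

@[fun_prop] theorem PR.cap {α : Type} [Primcodable α] {N b B K V : α → ℕ} (hN : PR N) (hb : PR b)
    (hB : PR B) (hK : PR K) (hV : PR V) : PR fun x => cap (N x) (b x) (B x) (K x) (V x) := by
  unfold HyTime.cap; fun_prop

/-- The value of the formula with the code `c`, when the values of its subformulas are given. -/
def body (a N b B K V c env t d k : ℕ) (f : ℕ → ℕ → Bool) : Bool :=
  bif Nat.beq c.unpair.1 0 then
    !Nat.beq (dig b (N * B ^ K) env c.unpair.2.unpair.2 t) 0 &&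
      labelC a c.unpair.2.unpair.1 (stL (dig b (N * B ^ K) env c.unpair.2.unpair.2 t))
  else bif Nat.beq c.unpair.1 1 then
    !Nat.beq (dig b (N * B ^ K) env c.unpair.2.unpair.2 t) 0 &&
      !labelC a c.unpair.2.unpair.1 (stL (dig b (N * B ^ K) env c.unpair.2.unpair.2 t))
  else bif Nat.beq c.unpair.1 2 then
    f c.unpair.2.unpair.1 (pack env t d k) || f c.unpair.2.unpair.2 (pack env t d k)
  else bif Nat.beq c.unpair.1 3 then
    f c.unpair.2.unpair.1 (pack env t d k) && f c.unpair.2.unpair.2 (pack env t d k)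
  else bif Nat.beq c.unpair.1 4 then
    bex (N * B ^ K) fun q => timeN B K c.unpair.2.unpair.1 t q (k + 1) &&
      f c.unpair.2.unpair.2 (pack env q d (k + 1))
  else bif Nat.beq c.unpair.1 5 then
    ball (N * B ^ K) fun q => !timeN B K c.unpair.2.unpair.1 t q (k + 1) ||
      f c.unpair.2.unpair.2 (pack env q d (k + 1))
  else bif Nat.beq c.unpair.1 6 then
    bex (N * B ^ K) fun q => timeN B K c.unpair.2.unpair.1 t q (k + 1) &&
      f c.unpair.2.unpair.2.unpair.2 (pack env q d (k + 1)) && ball (N * B ^ K) fun q' =>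
        !(Nat.blt t q' && Nat.blt q' q && Nat.beq (q' % B ^ (K - (k + 2))) 0) ||
          f c.unpair.2.unpair.2.unpair.1 (pack env q' d (k + 2))
  else bif Nat.beq c.unpair.1 7 then
    bex (b ^ (V * (N * B ^ K))) fun e => changeN N b B K V env e c.unpair.2.unpair.1 (k + 1) &&
      newN a N b B K env e c.unpair.2.unpair.1 t d (k + 1) &&
      f c.unpair.2.unpair.2 (pack e t (c.unpair.2.unpair.1 + 1) (k + 1))
  else
    ball (b ^ (V * (N * B ^ K))) fun e => !(changeN N b B K V env e c.unpair.2.unpair.1 (k + 1) &&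
      newN a N b B K env e c.unpair.2.unpair.1 t d (k + 1)) ||
      f c.unpair.2.unpair.2 (pack e t (c.unpair.2.unpair.1 + 1) (k + 1))

theorem PR.body {α : Type} [Primcodable α] {a N b B K V c e t d k : α → ℕ}
    {f : α → ℕ → ℕ → Bool} (ha : PR a)
    (hN : PR N) (hb : PR b) (hB : PR B) (hK : PR K) (hV : PR V) (hc : PR c) (he : PR e) (ht : PR t)
    (hd : PR d) (hk : PR k) (hf : PR fun x : α × ℕ × ℕ => f x.1 x.2.1 x.2.2) :
    PR fun x => body (a x) (N x) (b x) (B x) (K x) (V x) (c x) (e x) (t x) (d x) (k x) (f x) := by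
  have hf0 : ∀ {g h : α → ℕ}, PR g → PR h → PR fun x => f x (g x) (h x) := fun {g h} hg hh =>
    PR.comp (f := fun x : α × ℕ × ℕ => f x.1 x.2.1 x.2.2) (g := fun x => (x, g x, h x)) hf
      (by fun_prop)
  have hf1 : ∀ {g h : α × ℕ → ℕ}, PR g → PR h → PR fun x => f x.1 (g x) (h x) := fun {g h} hg hh =>
    PR.comp (f := fun x : α × ℕ × ℕ => f x.1 x.2.1 x.2.2) (g := fun x => (x.1, g x, h x)) hf
      (by fun_prop)
  have hf2 : ∀ {g h : (α × ℕ) × ℕ → ℕ}, PR g → PR h → PR fun x => f x.1.1 (g x) (h x) :=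
    fun {g h} hg hh => PR.comp (f := fun x : α × ℕ × ℕ => f x.1 x.2.1 x.2.2)
      (g := fun x => (x.1.1, g x, h x)) hf (by fun_prop)
  unfold HyTime.body
  refine .cond (by fun_prop) (by fun_prop) <| .cond (by fun_prop) (by fun_prop) <|
    .cond (by fun_prop) (.or (hf0 ?_ ?_) (hf0 ?_ ?_)) <|
    .cond (by fun_prop) (.and (hf0 ?_ ?_) (hf0 ?_ ?_)) <|
    .cond (by fun_prop) (.bex ?_ (.and ?_ (hf1 ?_ ?_))) <|
    .cond (by fun_prop) (.ball ?_ (.or ?_ (hf1 ?_ ?_))) <|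
    .cond (by fun_prop) (.bex ?_ (.and (.and ?_ (hf1 ?_ ?_)) (.ball ?_ (.or ?_ (hf2 ?_ ?_))))) <|
    .cond (by fun_prop) (.bex ?_ (.and ?_ (hf1 ?_ ?_))) <|
    (.ball ?_ (.or ?_ (hf1 ?_ ?_))) <;> fun_prop

def step (a N b B K V : ℕ) (l : List Bool) : Bool :=
  body a N b B K V (l.length / cap N b B K V) (l.length % cap N b B K V).unpair.1
    (l.length % cap N b B K V).unpair.2.unpair.1 (l.length % cap N b B K V).unpair.2.unpair.2.unpair.1
    (l.length % cap N b B K V).unpair.2.unpair.2.unpair.2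
    fun c e => l.getD (c * cap N b B K V + e) false

/-- The value of the formula with the code `c` in a packed state `e`. -/
def val (a N b B K V c e : ℕ) : Bool := srec (step a N b B K V) (c * cap N b B K V + e)

@[fun_prop] theorem PR.val {α : Type} [Primcodable α] {a N b B K V c e : α → ℕ} (ha : PR a)
    (hN : PR N) (hb : PR b) (hB : PR B) (hK : PR K) (hV : PR V) (hc : PR c) (he : PR e) :
    PR fun x => val (a x) (N x) (b x) (B x) (K x) (V x) (c x) (e x) := by
  unfold HyTime.val
  refine PR.srec (g := fun x => step (a x) (N x) (b x) (B x) (K x) (V x)) (by fun_prop) ?_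
  unfold step
  refine PR.body ?_ ?_ ?_ ?_ ?_ ?_ ?_ ?_ ?_ ?_ ?_ ?_ <;> fun_prop

theorem pack_lt_cap {N b B K V env t d k : ℕ} (he : env ≤ b ^ (V * (N * B ^ K)))
    (ht : t ≤ N * B ^ K) (hd : d ≤ V) (hk : k ≤ K) : pack env t d k < cap N b B K V :=
  Nat.lt_succ_of_le <| Sched.pair_le_pair he <| Sched.pair_le_pair ht <| Sched.pair_le_pair hd hk

theorem val_eq {a N b B K V c env t d k : ℕ} (h : pack env t d k < cap N b B K V) :
    ∃ f : ℕ → ℕ → Bool, (∀ c' < c, ∀ e < cap N b B K V, f c' e = val a N b B K V c' e) ∧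
      val a N b B K V c (pack env t d k) = body a N b B K V c env t d k f := by
  set C := cap N b B K V with hC
  refine ⟨fun c' e => (srecTable (step a N b B K V) (c * C + pack env t d k)).getD (c' * C + e) false,
    fun c' hc e he => ?_, ?_⟩
  · have : (c' + 1) * C ≤ c * C := Nat.mul_le_mul_right _ hc
    exact srecTable_getD _ (by rw [add_mul] at this; omega)
  · have h1 : (c * C + pack env t d k) / C = c := by
      rw [mul_comm, Nat.mul_add_div (by omega), Nat.div_eq_of_lt h, add_zero]
    have h2 : (c * C + pack env t d k) % C = pack env t d k := by
      rw [mul_comm, Nat.mul_add_mod, Nat.mod_eq_of_lt h]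
    rw [val, srec, ← hC]
    conv_lhs => rw [step]
    simp only [srecTable_length, ← hC, h1, h2]
    simp only [pack, Nat.unpair_pair]

theorem PR.tower {α : Type} [Primcodable α] {Q s : α → ℕ} (hQ : PR Q) (hs : PR s) :
    PR fun x => tower (Q x) (s x) := by
  have h : ∀ Q s, HyTime.tower Q s = Nat.rec Q (fun _ T => Q * 2 ^ T) s := fun Q s => by
    induction s with
    | zero => rfl
    | succ s ih => simp only [HyTime.tower, ih]
  simp only [h]
  exact PR.nat_rec (k := fun x _ T => Q x * 2 ^ T) hs hQ (by fun_prop)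

@[fun_prop] theorem PR.fineness {α : Type} [Primcodable α] {b N K : α → ℕ} (hb : PR b) (hN : PR N)
    (hK : PR K) : PR fun x => fineness (b x) (N x) (K x) := by
  unfold HyTime.fineness
  exact (PR.tower (by fun_prop) hK).add (PR.const 1)

theorem one_lt_fineness (b N K : ℕ) : 1 < fineness b N K := by
  rw [fineness]
  have : ∀ Q s, 0 < Q → 0 < tower Q s := fun Q s hQ => by
    cases s with
    | zero => exact hQ
    | succ s => rw [tower]; positivity
  have := this _ K (pow_pos two_pos
    (((b * 2) ^ N) ^ (K + 1) + ((b * 2) ^ N) ^ (K + 1) * ((b * 2) ^ N) ^ (K + 1)))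
  omega

/-- The decision procedure. -/
def decideN (n : ℕ) : Bool :=
  val n.unpair.1 n.unpair.2.unpair.2 (letters n.unpair.1)
    (fineness (letters n.unpair.1) n.unpair.2.unpair.2 (2 * n.unpair.2.unpair.1 + 10))
    (2 * n.unpair.2.unpair.1 + 10) (n.unpair.2.unpair.1 + 1) n.unpair.2.unpair.1 (pack 0 0 0 0)

theorem PR.decideN : PR decideN := by
  unfold HyTime.decideN letters mkL; fun_prop

end HyTime

namespace HyTime

/-- The number of additional layers that a formula can distinguish. -/
def HF.rk : HF ℕ → ℕ
  | .pos _ _ => 0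
  | .neg _ _ => 0
  | .disj φ ψ => max φ.rk ψ.rk
  | .conj φ ψ => max φ.rk ψ.rk
  | .fut _ φ => φ.rk + 1
  | .glob _ φ => φ.rk + 1
  | .untl _ φ ψ => max φ.rk ψ.rk + 2
  | .ex _ φ => max 3 φ.rk + 1
  | .all _ φ => max 3 φ.rk + 1

theorem HF.rk_le (φ : HF ℕ) : φ.rk ≤ 2 * encHF φ + 4 := by
  induction φ with
  | pos | neg => simp [HF.rk]
  | disj φ ψ h1 h2 | conj φ ψ h1 h2 =>
    simp only [HF.rk, encHF]
    generalize encHF φ = m at *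
    generalize encHF ψ = n at *
    have := Nat.add_le_pair m n
    have := Nat.right_le_pair 2 (Nat.pair m n)
    have := Nat.right_le_pair 3 (Nat.pair m n)
    omega
  | fut I φ h1 | glob I φ h1 =>
    simp only [HF.rk, encHF]
    have := Nat.right_le_pair (encFIvl I) (encHF φ)
    have := Nat.add_le_pair 4 (Nat.pair (encFIvl I) (encHF φ))
    have := Nat.add_le_pair 5 (Nat.pair (encFIvl I) (encHF φ))
    omega
  | untl I φ ψ h1 h2 =>
    simp only [HF.rk, encHF]
    have := Nat.right_le_pair (encFIvl I) (Nat.pair (encHF φ) (encHF ψ))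
    have := Nat.add_le_pair (encHF φ) (encHF ψ)
    have := Nat.add_le_pair 6 (Nat.pair (encFIvl I) (Nat.pair (encHF φ) (encHF ψ)))
    omega
  | ex π φ h1 | all π φ h1 =>
    simp only [HF.rk, encHF]
    have := Nat.right_le_pair π (encHF φ)
    have := Nat.add_le_pair 7 (Nat.pair π (encHF φ))
    have := Nat.add_le_pair 8 (Nat.pair π (encHF φ))
    omega

/-- The only time is `t`. -/
def now (t : ℝ) : ℕ → ℝ := push t fun _ => 0

@[simp] theorem now_zero (t : ℝ) : now t 0 = t := rfl

section
variable {b N r : ℕ} {S S' : ℕ → ℝ → Fin b} {τ τ' : ℕ → ℝ}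

theorem push_now (t u : ℝ) : (fun i => push t (now u) (if i = 0 then 0 else i + 1)) = now t := by
  funext i
  cases i <;> rfl

theorem push_push_now (t u v : ℝ) :
    (fun i => push t (push u (now v)) (if i = 0 then 0 else i + 2)) = now t := by
  funext i
  cases i <;> rfl

theorem push_update {α : Type} (s : α) (S : ℕ → α) (π : ℕ) :
    (fun i => push s S (if i = π then 0 else i + 1)) = Function.update S π s := by
  funext i
  by_cases h : i = π
  · subst h; simp
  · simp [h]

theorem BF.to_now {t u t' u' : ℝ} (h : BF N r S (push t (now u)) S' (push t' (now u'))) :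
    BF N r S (now t) S' (now t') := by
  have := h.relayout id fun i => if i = 0 then 0 else i + 1
  rwa [push_now, push_now] at this

theorem BF.update {s s' : ℝ → Fin b} (h : BF N r (push s S) τ (push s' S') τ') (π : ℕ) :
    BF N r (Function.update S π s) τ (Function.update S' π s') τ' := by
  have := h.relayout (fun i => if i = π then 0 else i + 1) id
  rwa [push_update, push_update] at this

theorem BF.lt_iff (h : BF N r S τ S' τ') (i k : ℕ) : τ i < τ k ↔ τ' i < τ' k := by
  have := h.diff_le_iff k i 0
  simp only [Int.cast_zero, sub_nonpos] at this
  rw [← not_le, ← not_le, this]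

theorem BF.mem_iff (h : BF N r S τ S' τ') (i k : ℕ) (I : FIvl ℕ) :
    FIvl.Mem natR (τ i) (τ k) I ↔ FIvl.Mem natR (τ' i) (τ' k) I := by
  have h1 : ∀ n : ℕ, τ k ≤ τ i + n ↔ τ' k ≤ τ' i + n := fun n => by
    have := h.diff_le_iff k i n
    rwa [sub_le_iff_le_add', sub_le_iff_le_add', Int.cast_natCast] at this
  have h2 : ∀ n : ℕ, τ i + n ≤ τ k ↔ τ' i + n ≤ τ' k := fun n => by
    have := h.diff_le_iff i k (-n)
    push_cast at this
    constructor
    · intro hn; linarith [this.1 (by linarith)]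
    · intro hn; linarith [this.2 (by linarith)]
  obtain ⟨lo, hi, c, c'⟩ := I
  have h3 : ∀ n : ℕ, τ k < τ i + n ↔ τ' k < τ' i + n := fun n => by
    rw [← not_le, ← not_le, h2]
  have h4 : ∀ n : ℕ, τ i + n < τ k ↔ τ' i + n < τ' k := fun n => by
    rw [← not_le, ← not_le, h1]
  simp only [FIvl.Mem, natR, h1, h2, h3, h4]

variable [Inhabited (Fin b)] {A : TA ℕ}

theorem Valid.of_bf {s s' : ℝ → Fin b} (h : BF N r (push s S) τ (push s' S') τ') (hr : 3 ≤ r)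
    (hv : Valid A N fun t => s t) : Valid A N fun t => s' t := fun x hx g hg => by
  have h1 := Fo.evalR_congr (p := (encTA A, x, g)) Fo.valid (Fo.rank_valid.trans hr) h
  simp only [Fo.evalR_valid, push_zero] at h1
  exact h1.1 (hv x hx g hg)

theorem BF.agree_iff (h : BF N r S τ S' τ') (hr : 3 ≤ r) :
    Agree N (fun t => S 0 t) (fun t => S 1 t) (τ 0) ↔
      Agree N (fun t => S' 0 t) (fun t => S' 1 t) (τ' 0) := by
  have h1 := Fo.evalR_congr (p := (0, 0, 0)) Fo.agree (Fo.rank_agree.trans hr) h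
  rwa [Fo.evalR_agree, Fo.evalR_agree] at h1

theorem Linked.of_bf {s s' : ℝ → Fin b} {d : Option ℕ} (h : BF N r (push s S) τ (push s' S') τ')
    (hr : 3 ≤ r)
    (hl : Linked (fun s s' : ℝ → Fin b => Agree N (fun t => s t) (fun t => s' t) (τ 0)) S (τ 0) d s) :
    Linked (fun s s' : ℝ → Fin b => Agree N (fun t => s t) (fun t => s' t) (τ' 0)) S' (τ' 0) d s' := by
  obtain ⟨hd, ht⟩ | ⟨d₀, hd, ha⟩ := hl
  · exact .inl ⟨hd, (h.eq_zero_iff 0).1 ht⟩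
  · have := (h.relayout (push 0 fun _ => d₀ + 1) id).agree_iff hr
    simp only [push_zero, push_succ, id] at this
    exact .inr ⟨d₀, hd, this.1 ha⟩

theorem BF.forall_between {t t' u u' : ℝ} {P P' : ℝ → Prop}
    (h : BF N (r + 1) S (push u (now t)) S' (push u' (now t')))
    (hP : ∀ {v v'}, BF N r S (now v) S' (now v') → P v → P' v')
    (hv : ∀ v, t < v → v < u → P v) (v : ℝ) (h1 : t' < v) (h2 : v < u') : P' v := by
  have h0 : 0 ≤ t' := h.symm.nonneg 1
  have hN : u' < N := h.symm.lt 0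
  obtain ⟨v', k0, k2, hb⟩ := h.symm.step_time (h0.trans h1.le) (h2.trans hN)
  refine hP ?_ (hv v' ((hb.lt_iff 2 0).1 h1) ((hb.lt_iff 0 1).1 h2))
  have := hb.symm.relayout id fun i => if i = 0 then 0 else i + 2
  rwa [push_push_now, push_push_now] at this

theorem TSat.of_bf (φ : HF ℕ) : ∀ {r : ℕ} {S S' : ℕ → ℝ → Fin b} {t t' : ℝ} {d : Option ℕ},
    φ.rk ≤ r → BF N r S (now t) S' (now t') → TSat A N φ S t d → TSat A N φ S' t' d := by
  induction φ with
  | pos p π | neg p π =>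
    intro r S S' t t' d _ h hs
    have := h.letter π 0
    simp only [now_zero] at this
    simpa only [TSat, this] using hs
  | disj φ ψ ih1 ih2 =>
    intro r S S' t t' d hr h hs
    rw [HF.rk, max_le_iff] at hr
    exact hs.imp (ih1 hr.1 h) (ih2 hr.2 h)
  | conj φ ψ ih1 ih2 =>
    intro r S S' t t' d hr h hs
    rw [HF.rk, max_le_iff] at hr
    exact hs.imp (ih1 hr.1 h) (ih2 hr.2 h)
  | fut I φ ih =>
    intro r S S' t t' d hr h ⟨u, h1, h2, h3, h4⟩
    obtain ⟨r, rfl⟩ := Nat.exists_eq_add_of_lt (Nat.lt_of_lt_of_le (Nat.succ_pos _) hr)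
    rw [HF.rk] at hr
    obtain ⟨u', h0', h2', hb⟩ := h.step_time ((h.nonneg 0).trans h1.le) h2
    exact ⟨u', (hb.lt_iff 1 0).1 h1, h2', (hb.mem_iff 1 0 I).1 h3, ih (by omega) hb.to_now h4⟩
  | glob I φ ih =>
    intro r S S' t t' d hr h hs u h1 h2 h3
    obtain ⟨r, rfl⟩ := Nat.exists_eq_add_of_lt (Nat.lt_of_lt_of_le (Nat.succ_pos _) hr)
    rw [HF.rk] at hr
    obtain ⟨u', h0', h2', hb⟩ := h.symm.step_time ((h.symm.nonneg 0).trans h1.le) h2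
    exact ih (by omega) hb.to_now.symm
      (hs u' ((hb.lt_iff 1 0).1 h1) h2' ((hb.mem_iff 1 0 I).1 h3))
  | untl I φ ψ ih1 ih2 =>
    intro r S S' t t' d hr h ⟨u, h1, h2, h3, h4, h5⟩
    rw [HF.rk] at hr
    obtain ⟨r, rfl⟩ := Nat.exists_eq_add_of_le' (show 2 ≤ r by omega)
    obtain ⟨u', h0', h2', hb⟩ := h.step_time ((h.nonneg 0).trans h1.le) h2
    refine ⟨u', (hb.lt_iff 1 0).1 h1, h2', (hb.mem_iff 1 0 I).1 h3, ih2 (by omega) hb.to_now h4,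
      hb.forall_between (P := fun v => TSat A N φ S v d) (P' := fun v => TSat A N φ S' v d)
        (fun hb' => ih1 (r := r) (by omega) hb') h5⟩
  | ex π φ ih =>
    intro r S S' t t' d hr h ⟨s, h1, h2, h3, h4⟩
    rw [HF.rk] at hr
    obtain ⟨r, rfl⟩ := Nat.exists_eq_add_of_le' (show 1 ≤ r by omega)
    obtain ⟨s', h1', hb⟩ := h.step_sig h1
    exact ⟨s', h1', h2.of_bf hb (by omega), Linked.of_bf hb (by omega) h3,
      ih (by omega) (hb.update π) h4⟩
  | all π φ ih =>
    intro r S S' t t' d hr h hs s h1 h2 h3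
    rw [HF.rk] at hr
    obtain ⟨r, rfl⟩ := Nat.exists_eq_add_of_le' (show 1 ≤ r by omega)
    obtain ⟨s', h1', hb⟩ := h.symm.step_sig h1
    exact ih (by omega) (hb.update π).symm (hs s' h1' (h2.of_bf hb (by omega))
      (Linked.of_bf hb (by omega) h3))

end

end HyTime

namespace HyTime

theorem exists_digits {b M : ℕ} (f : ℕ → ℕ) (hf : ∀ i, f i < b) :
    ∃ e < b ^ M, ∀ i < M, e / b ^ i % b = f i := by
  set e := finFunctionFinEquiv (m := b) (n := M) fun i => ⟨f i, hf i⟩ with he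
  refine ⟨e, e.2, fun i hi => ?_⟩
  have := congrArg Fin.val (congrFun (finFunctionFinEquiv.symm_apply_apply
    fun i : Fin M => (⟨f i, hf i⟩ : Fin b)) ⟨i, hi⟩)
  exact this

/-- The number `e` codes the values of the first `V` signals on the grid. -/
def Rep {b : ℕ} (N B K V e : ℕ) (S : ℕ → ℝ → Fin b) : Prop := e < b ^ (V * (N * B ^ K)) ∧
  ∀ π < V, ∀ q < N * B ^ K, dig b (N * B ^ K) e π q = S π ((q : ℝ) / (B : ℝ) ^ K)

section
variable {b N B K V k r env π : ℕ} {S : ℕ → ℝ → Fin b} {τ : ℕ → ℝ}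

theorem exists_rep (N B K V : ℕ) (S : ℕ → ℝ → Fin b) : ∃ e, Rep N B K V e S := by
  obtain ⟨e, he, h⟩ := exists_digits (b := b) (M := V * (N * B ^ K))
    (fun i => S (i / (N * B ^ K)) (((i % (N * B ^ K) : ℕ) : ℝ) / (B : ℝ) ^ K)) fun i => Fin.is_lt _
  refine ⟨e, he, fun π hπ q hq => ?_⟩
  rw [dig, h, mul_comm π, Nat.mul_add_div (by omega), Nat.div_eq_of_lt hq, add_zero,
    Nat.mul_add_mod, Nat.mod_eq_of_lt hq]
  calc π * (N * B ^ K) + q < (π + 1) * (N * B ^ K) := by rw [add_mul]; omega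
    _ ≤ V * (N * B ^ K) := Nat.mul_le_mul_right _ hπ

theorem aligned_cell {G h : ℕ} (hG : 0 < G) {s : ℝ → Fin b}
    (hs : ∀ j < N, aligned G fun x => s (j + x)) {q : ℕ} (hq : q < N * (G * h)) (hqh : q % h ≠ 0) :
    s ((q : ℝ) / (G * h)) = s (((q / h * h + 1 : ℕ) : ℝ) / (G * h)) := by
  have hh : 0 < h := Nat.pos_of_ne_zero fun h0 => by simp [h0] at hq
  have hG' : (0 : ℝ) < G := by exact_mod_cast hG
  have hh' : (0 : ℝ) < h := by exact_mod_cast hh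
  set m := q / h with hm
  set ρ := q % h with hρ
  have hρh : ρ < h := Nat.mod_lt _ hh
  have hqm : q = m * h + ρ := (Nat.div_add_mod' q h).symm
  have hmi : m = m / G * G + m % G := (Nat.div_add_mod' m G).symm
  have hi : m % G < G := Nat.mod_lt _ hG
  have hj : m / G < N := by
    rw [hm, Nat.div_div_eq_div_mul, mul_comm h]
    exact Nat.div_lt_of_lt_mul (by rwa [mul_comm])
  have key : ∀ ρ : ℕ, ((m * h + ρ : ℕ) : ℝ) / (G * h) =
      (m / G : ℕ) + ((m % G : ℕ) / (G : ℝ) + ρ / (G * h)) := fun ρ => by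
    conv_lhs => rw [hmi]
    push_cast
    field_simp
    ring
  rw [hqm, key, key]
  have hc : ∀ ρ : ℕ, 0 < ρ → ρ < h → (0 : ℝ) < ρ / (G * h) ∧ (ρ : ℝ) / (G * h) < 1 / G := by
    intro ρ h1 h2
    have h1' : (0 : ℝ) < ρ := by exact_mod_cast h1
    have h2' : (ρ : ℝ) < h := by exact_mod_cast h2
    refine ⟨by positivity, ?_⟩
    rw [div_lt_div_iff₀ (by positivity) hG']
    nlinarith
  obtain ⟨a1, a2⟩ := hc ρ (by omega) hρh
  obtain ⟨a3, a4⟩ := hc 1 one_pos (by omega)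
  refine hs _ hj _ hi _ _ ?_ ?_ ?_ ?_
  · linarith
  · rw [add_div]; linarith
  · linarith
  · rw [add_div]; linarith

theorem changeN_iff {e : ℕ} : changeN N b B K V env e π k = true ↔
    (∀ i < V, ∀ q < N * B ^ K, i ≠ π →
      dig b (N * B ^ K) e i q = dig b (N * B ^ K) env i q) ∧
    ∀ q < N * B ^ K, q % B ^ (K - k) ≠ 0 → dig b (N * B ^ K) e π q =
      dig b (N * B ^ K) e π (q / B ^ (K - k) * B ^ (K - k) + 1) := by
  simp [changeN, or_iff_not_imp_left]

variable [Inhabited (Fin b)]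

theorem Cfg.exists_time_iff (h : Cfg N B k S τ) (hB : Fine (Fin b) N K B) (hB0 : 0 < B)
    (hk : r + k < K) {P : ℝ → Prop} {Q : ℕ → Prop}
    (hP : ∀ t t', BF N r S (push t τ) S (push t' τ) → P t → P t')
    (hQ : ∀ (t : ℝ) (q : ℕ), Cfg N B (k + 1) S (push t τ) → q < N * B ^ K → t * (B : ℝ) ^ K = q →
      (P t ↔ Q q)) :
    (∃ t : ℝ, 0 ≤ t ∧ t < N ∧ P t) ↔ ∃ q < N * B ^ K, q % B ^ (K - (k + 1)) = 0 ∧ Q q := by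
  have hBR : (0 : ℝ) < (B : ℝ) ^ K := by positivity
  have hpow : (B : ℝ) ^ K = (B : ℝ) ^ (k + 1) * (B : ℝ) ^ (K - (k + 1)) := by
    rw [← pow_add]; congr 1; omega
  constructor
  · rintro ⟨t, h0, ht, hp⟩
    obtain ⟨t', hc, hbf⟩ := h.time_down hB hk h0 ht
    obtain ⟨m, hm⟩ := hc.exists_grid hB0 0
    rw [push_zero] at hm
    have hq : t' * (B : ℝ) ^ K = (m * B ^ (K - (k + 1)) : ℕ) := by
      rw [hpow, ← mul_assoc, hm]; push_cast; rfl
    have hlt : m * B ^ (K - (k + 1)) < N * B ^ K := by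
      have := mul_lt_mul_of_pos_right (hc.lt 0) hBR
      rw [push_zero, hq] at this
      exact_mod_cast this
    exact ⟨_, hlt, Nat.mul_mod_left _ _, (hQ t' _ hc hlt hq).1 (hP _ _ hbf hp)⟩
  · rintro ⟨q, hq, hd, hp⟩
    obtain ⟨m, hm⟩ := Nat.dvd_of_mod_eq_zero hd
    have hq0 : (q : ℝ) / (B : ℝ) ^ K * (B : ℝ) ^ K = q := by field_simp
    have h0 : 0 ≤ (q : ℝ) / (B : ℝ) ^ K := by positivity
    have h1 : (q : ℝ) / (B : ℝ) ^ K < N := by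
      rw [div_lt_iff₀ hBR]; exact_mod_cast hq
    refine ⟨_, h0, h1, (hQ _ q (h.time_push hB0 h0 h1 (q := m) ?_) hq hq0).2 hp⟩
    rw [hm, hpow]
    push_cast
    field_simp

/-- The index of a grid point in the same cell as `t`. -/
noncomputable def cellIndex (G h : ℕ) (t : ℝ) : ℕ :=
  open Classical in if (⌊t * G⌋₊ : ℝ) = t * G then ⌊t * G⌋₊ * h else ⌊t * G⌋₊ * h + 1

theorem cellIndex_div {G h : ℕ} (hG : 0 < G) (hh : 0 < h) (q : ℕ) :
    cellIndex G h ((q : ℝ) / (G * h)) = if q % h = 0 then q else q / h * h + 1 := by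
  have e : (q : ℝ) / (G * h) * G = (q : ℝ) / h := by field_simp
  have hh' : (0 : ℝ) < h := by exact_mod_cast hh
  have key : ((q / h : ℕ) : ℝ) = (q : ℝ) / h ↔ q % h = 0 := by
    rw [eq_div_iff hh'.ne']
    norm_cast
    have := Nat.div_add_mod' q h
    omega
  rw [cellIndex, e, Nat.floor_div_natCast, Nat.floor_natCast]
  by_cases hq : q % h = 0
  · rw [if_pos hq, if_pos (key.2 hq), Nat.div_mul_cancel (Nat.dvd_of_mod_eq_zero hq)]
  · rw [if_neg hq, if_neg (key.not.2 hq)]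

theorem cellIndex_cell {G h : ℕ} (hG : 0 < G) (j i : ℕ) {x : ℝ} (h1 : (i : ℝ) / G < x)
    (h2 : x < (i + 1 : ℝ) / G) : cellIndex G h (j + x) = (j * G + i) * h + 1 := by
  have hG' : (0 : ℝ) < G := by exact_mod_cast hG
  rw [div_lt_iff₀ hG'] at h1
  rw [lt_div_iff₀ hG'] at h2
  have e : ⌊(j + x) * G⌋₊ = j * G + i := by
    have h0 : 0 ≤ x * G := (Nat.cast_nonneg i).trans h1.le
    rw [Nat.floor_eq_iff (by rw [add_mul]; positivity)]
    push_cast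
    constructor <;> linarith
  rw [cellIndex, e, if_neg]
  push_cast
  intro h
  linarith

theorem Cfg.exists_sig_iff (h : Cfg N B k S τ) (hr : Rep N B K V env S)
    (hB : Fine (Fin b) N K B) (hB0 : 0 < B) (hk : r + k < K) (hπ : π < V)
    {P : (ℝ → Fin b) → Prop} {Q : ℕ → Prop}
    (hP : ∀ s s', BF N r (push s S) τ (push s' S) τ → P s → P s')
    (hQ : ∀ s e, Cfg N B (k + 1) (push s S) τ → Rep N B K V e (Function.update S π s) →
      (P s ↔ Q e)) :
    (∃ s, FV N s ∧ P s) ↔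
      ∃ e < b ^ (V * (N * B ^ K)), changeN N b B K V env e π (k + 1) = true ∧ Q e := by
  have hG : 0 < B ^ (k + 1) := by positivity
  have hh : 0 < B ^ (K - (k + 1)) := by positivity
  have hpowN : B ^ K = B ^ (k + 1) * B ^ (K - (k + 1)) := by
    rw [← pow_add]; congr 1; omega
  have hpow : (B : ℝ) ^ K = (B ^ (k + 1) : ℕ) * (B ^ (K - (k + 1)) : ℕ) := by
    rw [← Nat.cast_mul, ← hpowN, Nat.cast_pow]
  simp only [changeN_iff]
  constructor
  · rintro ⟨s, hs, hp⟩
    obtain ⟨s', hs', hc, hbf⟩ := h.sig_down hB hk hs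
    obtain ⟨e, he⟩ := exists_rep N B K V (Function.update S π s')
    refine ⟨e, he.1, ⟨fun i hi q hq hne => ?_, fun q hq hne => ?_⟩,
      (hQ s' e hc he).1 (hP _ _ hbf hp)⟩
    · rw [he.2 i hi q hq, hr.2 i hi q hq, Function.update_of_ne hne]
    · have hle : q / B ^ (K - (k + 1)) * B ^ (K - (k + 1)) + 1 ≤ q := by
        have := Nat.div_add_mod' q (B ^ (K - (k + 1)))
        have := Nat.pos_of_ne_zero hne
        omega
      rw [he.2 π hπ q hq, he.2 π hπ _ (hle.trans_lt hq), Function.update_self, hpow]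
      refine congrArg Fin.val (aligned_cell hG (fun j hj => ?_) (by rwa [← hpowN]) hne)
      have := hc.aligned_sig hB0 0 j hj
      simp only [push_zero] at this
      exact this
  · rintro ⟨e, he, ⟨h1, h2⟩, hq⟩
    let s : ℝ → Fin b := fun t => ⟨dig b (N * B ^ K) e π
      (cellIndex (B ^ (k + 1)) (B ^ (K - (k + 1))) t), Nat.mod_lt _ (default : Fin b).pos⟩
    have hs : ∀ j : ℕ, aligned (B ^ (k + 1)) fun x => s (j + x) := fun j i hi t u a1 a2 a3 a4 => by
      simp only [s, cellIndex_cell hG j i a1 a2, cellIndex_cell hG j i a3 a4]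
    refine ⟨s, fun j hj => (hs j).pc hG, (hQ s e (h.sig_push hB0 fun j _ => hs j)
      ⟨he, fun i hi q hq => ?_⟩).2 hq⟩
    by_cases hi' : i = π
    · subst hi'
      rw [Function.update_self, hpow]
      simp only [s, cellIndex_div hG hh]
      split_ifs with hd
      · rfl
      · exact h2 q hq hd
    · rw [Function.update_of_ne hi', h1 i hi q hq hi', hr.2 i hi q hq]

end

end HyTime

namespace HyTime

section
variable {b N B K V k r env e π tq : ℕ} {S : ℕ → ℝ → Fin b} {t : ℝ} {A : TA ℕ} {d : Option ℕ}

theorem mul_now (ht : t * (B : ℝ) ^ K = tq) (i : ℕ) :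
    now t i * (B : ℝ) ^ K = ([tq].getD i 0 : ℕ) := by
  cases i <;> simp [now, ht]

theorem Cfg.to_now {u : ℝ} (h : Cfg N B k S (push u (now t))) : Cfg N B k S (now u) := by
  have := h.relayout id fun i => if i = 0 then 0 else i + 1
  rwa [push_now] at this

theorem Cfg.update {τ : ℕ → ℝ} {s : ℝ → Fin b} (h : Cfg N B k (push s S) τ) (π : ℕ) :
    Cfg N B k (Function.update S π s) τ := by
  have := h.relayout (fun i => if i = π then 0 else i + 1) id
  rwa [push_update] at this

variable [Inhabited (Fin b)]

theorem validN_iff (h : Cfg N B k S (now t)) (hB : Fine (Fin b) N K B) (hB0 : 0 < B)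
    (hk : k + 3 ≤ K) (ht : t * (B : ℝ) ^ K = tq) (j : ℕ)
    (hs : ∀ q < N * B ^ K, dig b (N * B ^ K) env π q = S j ((q : ℝ) / (B : ℝ) ^ K)) :
    validN (encTA A) N b B K env π k tq = true ↔ Valid A N fun t => S j t := by
  have hc := h.relayout (fun _ => j) id
  have key : ∀ x g, Fo.evalN N B K (encTA A, x, g) (fun _ q => dig b (N * B ^ K) env π q)
      Fo.valid k [tq] = true ↔ TV (encTA A) x g N fun t => S j t := fun x g => by
    rw [← Fo.evalR_iff_evalN hB hB0 Fo.valid (by have := Fo.rank_valid; omega) (mul_now ht)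
      (fun _ q hq => hs q hq) hc, Fo.evalR_valid]
  simp only [validN, ball_iff, key, Valid, Nat.lt_succ_iff]

theorem agreeN_iff (h : Cfg N B k S (now t)) (hB : Fine (Fin b) N K B) (hB0 : 0 < B)
    (hk : k + 3 ≤ K) (ht : t * (B : ℝ) ^ K = tq) (i j : ℕ) {env' π' : ℕ}
    (hi : ∀ q < N * B ^ K, dig b (N * B ^ K) env π q = S i ((q : ℝ) / (B : ℝ) ^ K))
    (hj : ∀ q < N * B ^ K, dig b (N * B ^ K) env' π' q = S j ((q : ℝ) / (B : ℝ) ^ K)) :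
    agreeN N b B K env π env' π' k tq = true ↔ Agree N (fun t => S i t) (fun t => S j t) t := by
  have hc := h.relayout (push i fun _ => j) id
  rw [agreeN, ← Fo.evalR_iff_evalN hB hB0 Fo.agree (by have := Fo.rank_agree; omega) (mul_now ht)
    (fun n q hq => ?_) hc, Fo.evalR_agree]
  · simp only [push_zero, push_succ, now_zero]
  · cases n with
    | zero => simpa using hi q hq
    | succ n => exact hj q hq

theorem newN_iff {s : ℝ → Fin b} (h : Cfg N B k (push s S) (now t)) (hB : Fine (Fin b) N K B)
    (hB0 : 0 < B) (hk : k + 3 ≤ K) (ht : t * (B : ℝ) ^ K = tq) (hr : Rep N B K V env S)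
    (he : Rep N B K V e (Function.update S π s)) (hπ : π < V) (hd : ∀ d₀, d = some d₀ → d₀ < V) :
    newN (encTA A) N b B K env e π tq (d.elim 0 (· + 1)) k = true ↔ Valid A N (fun t => s t) ∧
      Linked (fun s s' : ℝ → Fin b => Agree N (fun t => s t) (fun t => s' t) t) S t d s := by
  have hs : ∀ q < N * B ^ K,
      dig b (N * B ^ K) e π q = push s S 0 ((q : ℝ) / (B : ℝ) ^ K) := fun q hq => by
    rw [he.2 π hπ q hq, Function.update_self, push_zero]
  have hv := validN_iff (A := A) h hB hB0 hk ht 0 hs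
  simp only [push_zero] at hv
  rw [newN, Bool.and_eq_true, hv]
  refine and_congr_right fun _ => ?_
  cases d with
  | none =>
    have hBR : (0 : ℝ) < (B : ℝ) ^ K := by positivity
    have : t = 0 ↔ tq = 0 := by
      rw [← Nat.cast_eq_zero (R := ℝ), ← ht, mul_eq_zero, or_iff_left hBR.ne']
    simp [Linked, this]
  | some d₀ =>
    have ha := agreeN_iff h hB hB0 hk ht 0 (d₀ + 1) hs (hr.2 d₀ (hd d₀ rfl))
    simp only [push_zero, push_succ] at ha
    simp [Linked, ha, succ_beq_zero]

theorem later_iff (h : Cfg N B k S (now t)) (hB : Fine (Fin b) N K B) (hB0 : 0 < B)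
    (hk : r + k < K) (ht : t * (B : ℝ) ^ K = tq) (I : FIvl ℕ) {P : ℝ → Prop} {Q : ℕ → Prop}
    (hP : ∀ u u', BF N r S (push u (now t)) S (push u' (now t)) → P u → P u')
    (hQ : ∀ (u : ℝ) (q : ℕ), Cfg N B (k + 1) S (push u (now t)) → q < N * B ^ K →
      u * (B : ℝ) ^ K = q → (P u ↔ Q q)) :
    (∃ u : ℝ, t < u ∧ u < N ∧ FIvl.Mem natR t u I ∧ P u) ↔
      ∃ q < N * B ^ K, timeN B K (encFIvl I) tq q (k + 1) = true ∧ Q q := by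
  have hBR : (0 : ℝ) < (B : ℝ) ^ K := by positivity
  have h0 : 0 ≤ t := h.nonneg 0
  have := h.exists_time_iff (r := r) (P := fun u => t < u ∧ FIvl.Mem natR t u I ∧ P u)
    (Q := fun q => tq < q ∧ fMemN (B ^ K) (encFIvl I) tq q = true ∧ Q q) hB hB0 hk
    (fun u u' hb ⟨h1, h2, h3⟩ => ⟨(hb.lt_iff 1 0).1 h1, (hb.mem_iff 1 0 I).1 h2, hP _ _ hb h3⟩)
    fun u q hc hq hu => by
      rw [fMemN_iff (G := B ^ K) (tq := tq) (tq' := q) (by positivity) I (by rw [Nat.cast_pow, ht])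
        (by rw [Nat.cast_pow, hu]), hQ u q hc hq hu, ← mul_lt_mul_iff_of_pos_right hBR, ht, hu,
        Nat.cast_lt]
  refine Iff.trans ⟨?_, ?_⟩ (this.trans (exists_congr fun q => and_congr_right fun _ => ?_))
  · exact fun ⟨u, h1, h2, h3⟩ => ⟨u, h0.trans h1.le, h2, h1, h3⟩
  · exact fun ⟨u, _, h2, h1, h3⟩ => ⟨u, h1, h2, h3⟩
  · simp only [timeN, Bool.and_eq_true, Nat.blt_eq, Nat.beq_eq]
    exact ⟨fun ⟨h1, h2, h3, h4⟩ => ⟨⟨⟨h2, h3⟩, h1⟩, h4⟩, fun ⟨⟨⟨h2, h3⟩, h1⟩, h4⟩ => ⟨h1, h2, h3, h4⟩⟩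

theorem between_iff {u : ℝ} {q : ℕ} (h : Cfg N B k S (push u (now t))) (hB : Fine (Fin b) N K B)
    (hB0 : 0 < B) (hk : r + k < K) (ht : t * (B : ℝ) ^ K = tq) (hu : u * (B : ℝ) ^ K = q)
    {P : ℝ → Prop} {Q : ℕ → Prop} (hP : ∀ v v', BF N r S (now v) S (now v') → P v → P v')
    (hQ : ∀ (v : ℝ) (q' : ℕ), Cfg N B (k + 1) S (now v) → q' < N * B ^ K →
      v * (B : ℝ) ^ K = q' → (P v ↔ Q q')) :
    (∀ v : ℝ, t < v → v < u → P v) ↔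
      ∀ q' < N * B ^ K, tq < q' → q' < q → q' % B ^ (K - (k + 1)) = 0 → Q q' := by
  have hBR : (0 : ℝ) < (B : ℝ) ^ K := by positivity
  have h0 : 0 ≤ t := h.nonneg 1
  have hN : u < N := h.lt 0
  have := h.exists_time_iff (r := r) (P := fun v => t < v ∧ v < u ∧ ¬P v)
    (Q := fun q' => tq < q' ∧ q' < q ∧ ¬Q q') hB hB0 hk
    (fun v v' hb ⟨h1, h2, h3⟩ => ⟨(hb.lt_iff 2 0).1 h1, (hb.lt_iff 0 1).1 h2,
      fun h4 => h3 <| hP _ _ (by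
        have := hb.symm.relayout id fun i => if i = 0 then 0 else i + 2
        rwa [push_push_now, push_push_now] at this) h4⟩)
    fun v q' hc hq hv => by
      have hc' := hc.relayout id fun i => if i = 0 then 0 else i + 2
      rw [push_push_now] at hc'
      rw [hQ v q' hc' hq hv, ← mul_lt_mul_iff_of_pos_right hBR, ht, hv,
        Nat.cast_lt, ← mul_lt_mul_iff_of_pos_right hBR, hu, hv, Nat.cast_lt]
  have := not_congr this
  push Not at this
  refine Iff.trans ⟨?_, ?_⟩ (this.trans ⟨?_, ?_⟩)
  · exact fun h v _ _ h1 h2 => h v h1 h2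
  · exact fun h v h1 h2 => h v (h0.trans h1.le) (h2.trans hN) h1 h2
  · exact fun h q' h1 h2 h3 h4 => h q' h1 h4 h2 h3
  · exact fun h q' h1 h2 h3 h4 => h q' h1 h3 h4 h2

theorem tSat_iff_val (hB : Fine (Fin b) N K B) (hB0 : 0 < B) (φ : HF ℕ) :
    ∀ {k env tq : ℕ} {S : ℕ → ℝ → Fin b} {t : ℝ} {d : Option ℕ}, k + φ.rk ≤ K → encHF φ < V →
      (∀ d₀, d = some d₀ → d₀ < V) → Cfg N B k S (now t) → t * (B : ℝ) ^ K = tq →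
      Rep N B K V env S → (TSat A N φ S t d ↔
        val (encTA A) N b B K V (encHF φ) (pack env tq (d.elim 0 (· + 1)) k) = true) := by
  have hBR : (0 : ℝ) < (B : ℝ) ^ K := by positivity
  have tq_lt : ∀ {k tq : ℕ} {S : ℕ → ℝ → Fin b} {t : ℝ}, Cfg N B k S (now t) →
      t * (B : ℝ) ^ K = tq → tq < N * B ^ K := fun hc ht => by
    have := mul_lt_mul_of_pos_right (hc.lt 0) hBR
    rw [now_zero, ht] at this
    exact_mod_cast this
  have dig_eq : ∀ {k env tq π : ℕ} {S : ℕ → ℝ → Fin b} {t : ℝ}, π < V → Cfg N B k S (now t) →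
      t * (B : ℝ) ^ K = tq → Rep N B K V env S → dig b (N * B ^ K) env π tq = S π t :=
    fun hπ hc ht hr => by
      rw [hr.2 _ hπ _ (tq_lt hc ht), ← ht, mul_div_cancel_right₀ _ hBR.ne']
  have lt_cap : ∀ {k env tq : ℕ} {S S' : ℕ → ℝ → Fin b} {t : ℝ} {d : Option ℕ}, k ≤ K →
      (∀ d₀, d = some d₀ → d₀ < V) → Cfg N B k S (now t) → t * (B : ℝ) ^ K = tq →
      Rep N B K V env S' → pack env tq (d.elim 0 (· + 1)) k < cap N b B K V :=
    fun {k env tq S S' t d} hk hd hc ht hr => by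
      refine pack_lt_cap hr.1.le (tq_lt hc ht).le ?_ hk
      cases d with
      | none => exact Nat.zero_le _
      | some d₀ => exact hd d₀ rfl
  induction φ with
  | pos p π =>
    intro k env tq S t d hk hφ hd hc ht hr
    obtain ⟨f, hf, hv⟩ := val_eq (a := encTA A) (c := encHF (.pos p π))
      (lt_cap (by omega) hd hc ht hr)
    have := Nat.right_le_pair 0 (Nat.pair p π)
    have := Nat.right_le_pair p π
    have hπ : π < V := by rw [encHF] at hφ; omega
    rw [hv]
    simp [body, encHF, TSat, dig_eq hπ hc ht hr, ← Nat.beq_eq]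
  | neg p π =>
    intro k env tq S t d hk hφ hd hc ht hr
    obtain ⟨f, hf, hv⟩ := val_eq (a := encTA A) (c := encHF (.neg p π))
      (lt_cap (by omega) hd hc ht hr)
    have := Nat.right_le_pair 1 (Nat.pair p π)
    have := Nat.right_le_pair p π
    have hπ : π < V := by rw [encHF] at hφ; omega
    rw [hv, TSat, ← labelC_enc]
    simp [body, encHF, dig_eq hπ hc ht hr, ← Nat.beq_eq, -labelC_enc]
  | disj φ ψ ih1 ih2 =>
    intro k env tq S t d hk hφ hd hc ht hr
    obtain ⟨f, hf, hv⟩ := val_eq (a := encTA A) (c := encHF (.disj φ ψ))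
      (lt_cap (by omega) hd hc ht hr)
    rw [HF.rk] at hk
    have := Nat.add_le_pair 2 (Nat.pair (encHF φ) (encHF ψ))
    have := Nat.left_le_pair (encHF φ) (encHF ψ)
    have := Nat.right_le_pair (encHF φ) (encHF ψ)
    rw [encHF] at hφ hf
    have hl := lt_cap (by omega) hd hc ht hr
    rw [hv, TSat, ih1 (by omega) (by omega) hd hc ht hr, ih2 (by omega) (by omega) hd hc ht hr,
      ← hf _ (by omega) _ hl, ← hf _ (by omega) _ hl]
    simp [body, encHF]
  | conj φ ψ ih1 ih2 =>
    intro k env tq S t d hk hφ hd hc ht hr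
    obtain ⟨f, hf, hv⟩ := val_eq (a := encTA A) (c := encHF (.conj φ ψ))
      (lt_cap (by omega) hd hc ht hr)
    rw [HF.rk] at hk
    have := Nat.add_le_pair 3 (Nat.pair (encHF φ) (encHF ψ))
    have := Nat.left_le_pair (encHF φ) (encHF ψ)
    have := Nat.right_le_pair (encHF φ) (encHF ψ)
    rw [encHF] at hφ hf
    have hl := lt_cap (by omega) hd hc ht hr
    rw [hv, TSat, ih1 (by omega) (by omega) hd hc ht hr, ih2 (by omega) (by omega) hd hc ht hr,
      ← hf _ (by omega) _ hl, ← hf _ (by omega) _ hl]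
    simp [body, encHF]
  | fut I φ ih =>
    intro k env tq S t d hk hφ hd hc ht hr
    obtain ⟨f, hf, hv⟩ := val_eq (a := encTA A) (c := encHF (.fut I φ))
      (lt_cap (by omega) hd hc ht hr)
    rw [HF.rk] at hk
    have := Nat.add_le_pair 4 (Nat.pair (encFIvl I) (encHF φ))
    have := Nat.right_le_pair (encFIvl I) (encHF φ)
    rw [encHF] at hφ hf
    rw [hv, TSat, later_iff (r := φ.rk) hc hB hB0 (by omega) ht I
      (Q := fun q => f (encHF φ) (pack env q (d.elim 0 (· + 1)) (k + 1)) = true)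
      (fun u u' hb => TSat.of_bf φ le_rfl hb.to_now) fun u q hc' hq hu => ?_]
    · simp [body, encHF]
    · rw [ih (by omega) (by omega) hd hc'.to_now hu hr,
        hf _ (by omega) _ (lt_cap (by omega) hd hc'.to_now hu hr)]
  | glob I φ ih =>
    intro k env tq S t d hk hφ hd hc ht hr
    obtain ⟨f, hf, hv⟩ := val_eq (a := encTA A) (c := encHF (.glob I φ))
      (lt_cap (by omega) hd hc ht hr)
    rw [HF.rk] at hk
    have := Nat.add_le_pair 5 (Nat.pair (encFIvl I) (encHF φ))
    have := Nat.right_le_pair (encFIvl I) (encHF φ)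
    rw [encHF] at hφ hf
    have h := later_iff (r := φ.rk) hc hB hB0 (by omega) ht I
      (P := fun u => ¬TSat A N φ S u d)
      (Q := fun q => ¬f (encHF φ) (pack env q (d.elim 0 (· + 1)) (k + 1)) = true)
      (fun u u' hb => mt (TSat.of_bf φ le_rfl hb.to_now.symm)) fun u q hc' hq hu => ?_
    · rw [hv, TSat]
      have h := not_congr h
      push Not at h
      rw [h]
      simp [body, encHF, or_iff_not_imp_left]
    · rw [ih (by omega) (by omega) hd hc'.to_now hu hr,
        hf _ (by omega) _ (lt_cap (by omega) hd hc'.to_now hu hr)]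
  | untl I φ ψ ih1 ih2 =>
    intro k env tq S t d hk hφ hd hc ht hr
    obtain ⟨f, hf, hv⟩ := val_eq (a := encTA A) (c := encHF (.untl I φ ψ))
      (lt_cap (by omega) hd hc ht hr)
    rw [HF.rk] at hk
    have := Nat.add_le_pair 6 (Nat.pair (encFIvl I) (Nat.pair (encHF φ) (encHF ψ)))
    have := Nat.right_le_pair (encFIvl I) (Nat.pair (encHF φ) (encHF ψ))
    have := Nat.left_le_pair (encHF φ) (encHF ψ)
    have := Nat.right_le_pair (encHF φ) (encHF ψ)
    have := le_max_left φ.rk ψ.rk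
    have := le_max_right φ.rk ψ.rk
    rw [encHF] at hφ hf
    rw [hv, TSat, later_iff (r := max φ.rk ψ.rk + 1) hc hB hB0 (by omega) ht I
      (Q := fun q => f (encHF ψ) (pack env q (d.elim 0 (· + 1)) (k + 1)) = true ∧
        ∀ q' < N * B ^ K, tq < q' → q' < q → q' % B ^ (K - (k + 2)) = 0 →
          f (encHF φ) (pack env q' (d.elim 0 (· + 1)) (k + 2)) = true)
      (fun u u' hb hu => ⟨TSat.of_bf ψ (by omega) hb.to_now hu.1,
        hb.forall_between (fun hb' => TSat.of_bf φ (by omega) hb') hu.2⟩) fun u q hc' hq hu => ?_]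
    · simp [body, encHF, or_iff_not_imp_left, and_assoc]
    · refine and_congr ?_ (between_iff (r := φ.rk) hc' hB hB0 (by omega) ht hu
        (fun v v' hb => TSat.of_bf φ le_rfl hb) fun v q' hc'' hq' hv' => ?_)
      · rw [ih2 (by omega) (by omega) hd hc'.to_now hu hr,
          hf _ (by omega) _ (lt_cap (by omega) hd hc'.to_now hu hr)]
      · rw [ih1 (by omega) (by omega) hd hc'' hv' hr,
          hf _ (by omega) _ (lt_cap (by omega) hd hc'' hv' hr)]
  | ex π φ ih =>
    intro k env tq S t d hk hφ hd hc ht hr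
    obtain ⟨f, hf, hv⟩ := val_eq (a := encTA A) (c := encHF (.ex π φ))
      (lt_cap (by omega) hd hc ht hr)
    rw [HF.rk] at hk
    have := Nat.add_le_pair 7 (Nat.pair π (encHF φ))
    have := Nat.left_le_pair π (encHF φ)
    have := Nat.right_le_pair π (encHF φ)
    have := le_max_left 3 φ.rk
    have := le_max_right 3 φ.rk
    rw [encHF] at hφ hf
    have hd' : ∀ d₀, some π = some d₀ → d₀ < V := fun d₀ h => by injection h; omega
    rw [hv, TSat, hc.exists_sig_iff (r := max 3 φ.rk) (π := π) hr hB hB0 (by omega) (by omega)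
      (Q := fun e => newN (encTA A) N b B K env e π tq (d.elim 0 (· + 1)) (k + 1) = true ∧
        f (encHF φ) (pack e tq (π + 1) (k + 1)) = true)
      (fun s s' hb hs => ⟨hs.1.of_bf hb (by omega), Linked.of_bf hb (by omega) hs.2.1,
        TSat.of_bf φ (by omega) (hb.update π) hs.2.2⟩) fun s e hc' he => ?_]
    · simp [body, encHF, and_assoc]
    · have hc'' := hc'.update π
      rw [← and_assoc, newN_iff hc' hB hB0 (by omega) ht hr he (by omega) hd]
      have := hf (encHF φ) (by omega) _ (lt_cap (d := some π) (by omega) hd' hc'' ht he)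
      rw [ih (by omega) (by omega) hd' hc'' ht he, ← this]
      rfl
  | all π φ ih =>
    intro k env tq S t d hk hφ hd hc ht hr
    obtain ⟨f, hf, hv⟩ := val_eq (a := encTA A) (c := encHF (.all π φ))
      (lt_cap (by omega) hd hc ht hr)
    rw [HF.rk] at hk
    have := Nat.add_le_pair 8 (Nat.pair π (encHF φ))
    have := Nat.left_le_pair π (encHF φ)
    have := Nat.right_le_pair π (encHF φ)
    have := le_max_left 3 φ.rk
    have := le_max_right 3 φ.rk
    rw [encHF] at hφ hf
    have hd' : ∀ d₀, some π = some d₀ → d₀ < V := fun d₀ h => by injection h; omega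
    have h := hc.exists_sig_iff (r := max 3 φ.rk) (π := π) hr hB hB0 (by omega) (by omega)
      (P := fun s => Valid A N (fun t => s t) ∧
        Linked (fun s s' : ℝ → Fin b => Agree N (fun t => s t) (fun t => s' t) t) S t d s ∧
        ¬TSat A N φ (Function.update S π s) t (some π))
      (Q := fun e => newN (encTA A) N b B K env e π tq (d.elim 0 (· + 1)) (k + 1) = true ∧
        ¬f (encHF φ) (pack e tq (π + 1) (k + 1)) = true)
      (fun s s' hb hs => ⟨hs.1.of_bf hb (by omega), Linked.of_bf hb (by omega) hs.2.1,
        mt (TSat.of_bf φ (by omega) (hb.update π).symm) hs.2.2⟩) fun s e hc' he => ?_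
    · rw [hv, TSat]
      have h := not_congr h
      push Not at h
      rw [h]
      simp [body, encHF, or_iff_not_imp_left]
    · have hc'' := hc'.update π
      rw [← and_assoc, newN_iff hc' hB hB0 (by omega) ht hr he (by omega) hd]
      have := hf (encHF φ) (by omega) _ (lt_cap (d := some π) (by omega) hd' hc'' ht he)
      rw [ih (by omega) (by omega) hd' hc'' ht he, ← this]
      rfl

end

/-- The bounded-time verification problem for HCMTL* in the
interval-based semantics is decidable: there is a computable function which, on the code
of a triple `(A, φ, N)` of a timed automaton, an HCMTL* sentence and a positive natural
time bound, decides whether `{}, 0, ε ⊨^N_A φ`. -/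
theorem bounded_interval_verification_decidable :
    ∃ dec : ℕ → Bool, Computable dec ∧
      ∀ (A : TA ℕ) (φ : HF ℕ) (N : ℕ), φ.Sentence → 0 < N →
        (dec (Nat.pair (encTA A) (Nat.pair (encHF φ) N)) = true ↔
          HSat natR A (some (N : ℝ)) φ (fun _ => default) 0 none) := by
  refine ⟨decideN, PR.decideN.to_comp, fun A φ N _ hN => ?_⟩
  have : Inhabited (Fin (letters (encTA A))) := ⟨⟨0, Nat.succ_pos _⟩⟩
  set b := letters (encTA A) with hb
  set K := 2 * encHF φ + 10 with hK
  set V := encHF φ + 1 with hV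
  set B := fineness b N K with hB
  have hB0 : 0 < B := (one_lt_fineness b N K).trans' one_pos
  set S : ℕ → ℝ → Fin b := fun _ _ => ⟨0, Nat.succ_pos _⟩
  have hc : Cfg N B 0 S (now 0) := by
    have := Cfg.initial (B := B) hN (⟨0, Nat.succ_pos _⟩ : Fin b)
    convert this using 1
    funext i
    cases i <;> rfl
  have hr : Rep N B K V 0 S :=
    ⟨pow_pos (Nat.succ_pos _) _, fun π _ q _ => by simp [dig, S]⟩
  have h1 := hSat_iff_tSat hN φ (fun _ => default) S 0 none le_rfl (by exact_mod_cast hN)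
    (fun _ => shows_default N) (fun _ h => nomatch h)
  have h2 := tSat_iff_val (A := A) (V := V) (fine_fineness b N K) hB0 φ (k := 0) (d := none)
    (by have := φ.rk_le; omega) (Nat.lt_succ_self _) (fun _ h => nomatch h) hc (tq := 0)
    (by simp) hr
  rw [h1, h2]
  simp only [decideN, Nat.unpair_pair]
  rfl

end HyTime
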